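/- arXiv:0911.0948 — 2 statements merged into one kernel-verified Lean document; each statement's English description precedes it below -/
import Mathlib

section
/- Let n ≥ 3 and a > 0. Then for every radial v ∈ C_c^∞(B_1), ∫_{B_1} |x|^{-(n-2)} |∇v|² dx ≥ (n-2)^{-2(n-1)/n} S_n · ( ∫_{B_1} |x|^{-n} X_1(a,|x|)^{2(n-1)/(n-2)} |v|^{2n/(n-2)} dx )^{(n-2)/n}, and this constant is sharp among radial functions: for every C > (n-2)^{-2(n-1)/n} S_n there exists a nonzero radial v ∈ C_c^∞(B_1) for which the reverse strict inequality with constant C holds. -/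
open MeasureTheory Real

/-- The best Sobolev constant `S_n = π n (n-2) (Γ(n/2)/Γ(n))^(2/n)`. -/
noncomputable def sobolevConst (n : ℕ) : ℝ :=
  Real.pi * n * ((n : ℝ) - 2) * (Real.Gamma ((n : ℝ) / 2) / Real.Gamma (n : ℝ)) ^ (2 / (n : ℝ))

/-- `X_1(a,s) = (a - ln s)⁻¹`. -/
noncomputable def X1 (a s : ℝ) : ℝ := (a - Real.log s)⁻¹

section SechIntegrals

open Filter Topology

theorem tendsto_cosh_atTop : Tendsto Real.cosh atTop atTop := by
  refine tendsto_atTop_mono (fun x => ?_) (Real.tendsto_exp_atTop.atTop_div_const (zero_lt_two' ℝ))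
  rw [Real.cosh_eq]
  have := Real.exp_pos (-x)
  linarith

theorem tendsto_cosh_atBot : Tendsto Real.cosh atBot atTop := by
  have := tendsto_cosh_atTop.comp tendsto_neg_atBot_atTop
  simpa [Function.comp_def] using this

theorem tendsto_inv_cosh_pow_atTop {n : ℕ} (hn : n ≠ 0) :
    Tendsto (fun x => (Real.cosh x ^ n)⁻¹) atTop (𝓝 0) :=
  ((tendsto_pow_atTop hn).comp tendsto_cosh_atTop).inv_tendsto_atTop

theorem tendsto_inv_cosh_pow_atBot {n : ℕ} (hn : n ≠ 0) :
    Tendsto (fun x => (Real.cosh x ^ n)⁻¹) atBot (𝓝 0) :=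
  ((tendsto_pow_atTop hn).comp tendsto_cosh_atBot).inv_tendsto_atTop

theorem tendsto_sinh_atTop : Tendsto Real.sinh atTop atTop :=
  tendsto_atTop_mono' _ ((eventually_ge_atTop 0).mono fun _ hx => Real.self_le_sinh_iff.2 hx)
    tendsto_id

theorem tendsto_sinh_atBot : Tendsto Real.sinh atBot atBot := by
  have := tendsto_neg_atTop_atBot.comp (tendsto_sinh_atTop.comp tendsto_neg_atBot_atTop)
  simpa [Function.comp_def] using this

theorem one_add_sq_div_two_le_cosh (x : ℝ) : 1 + x ^ 2 / 2 ≤ Real.cosh x := by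
  have h : Real.cosh x = 1 + 2 * Real.sinh (x / 2) ^ 2 := by
    have := Real.cosh_two_mul (x / 2)
    rw [Real.cosh_sq, mul_div_cancel₀ x (two_ne_zero)] at this
    linarith
  have h2 : (x / 2) ^ 2 ≤ Real.sinh (x / 2) ^ 2 := by
    rw [sq_le_sq]
    rcases le_total 0 (x / 2) with h0 | h0
    · rw [abs_of_nonneg h0, abs_of_nonneg (Real.sinh_nonneg_iff.2 h0)]
      exact Real.self_le_sinh_iff.2 h0
    · rw [abs_of_nonpos h0, abs_of_nonpos (Real.sinh_nonpos_iff.2 h0)]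
      exact neg_le_neg (Real.sinh_le_self_iff.2 h0)
  nlinarith

theorem continuous_inv_cosh_pow (n : ℕ) : Continuous fun x => (Real.cosh x ^ n)⁻¹ :=
  (Real.continuous_cosh.pow n).inv₀ fun x => (pow_pos (Real.cosh_pos x) n).ne'

theorem integrable_inv_cosh_pow {n : ℕ} (hn : n ≠ 0) :
    Integrable fun x => (Real.cosh x ^ n)⁻¹ := by
  refine (integrable_inv_one_add_sq.const_mul 2).mono'
    (continuous_inv_cosh_pow n).aestronglyMeasurable (Eventually.of_forall fun x => ?_)
  have h1 := Real.one_le_cosh x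
  have h2 : Real.cosh x ≤ Real.cosh x ^ n := le_self_pow₀ h1 hn
  have h3 := one_add_sq_div_two_le_cosh x
  rw [Real.norm_of_nonneg (by positivity), ← div_eq_mul_inv, inv_le_comm₀ (by positivity)
    (by positivity), inv_div]
  nlinarith [sq_nonneg x]

/-- The integral over the line of the `n`-th power of the hyperbolic secant. -/
noncomputable def sechIntegral (n : ℕ) : ℝ := ∫ x, (Real.cosh x ^ n)⁻¹

theorem sechIntegral_one : sechIntegral 1 = π := by
  have := integral_of_hasDerivAt_of_tendsto (f := fun x => Real.arctan (Real.sinh x))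
    (f' := fun x => (Real.cosh x ^ 1)⁻¹) (m := -(π / 2)) (n := π / 2) (fun x => ?_)
    (integrable_inv_cosh_pow one_ne_zero)
    ((tendsto_nhds_of_tendsto_nhdsWithin Real.tendsto_arctan_atBot).comp tendsto_sinh_atBot)
    ((tendsto_nhds_of_tendsto_nhdsWithin Real.tendsto_arctan_atTop).comp tendsto_sinh_atTop)
  · rw [sechIntegral, this]; ring
  · refine (Real.hasDerivAt_sinh x).arctan.congr_deriv ?_
    have := Real.cosh_pos x
    rw [add_comm 1, ← Real.cosh_sq]
    field_simp

theorem hasDerivAt_sinh_mul_inv_cosh_pow (n : ℕ) (x : ℝ) :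
    HasDerivAt (fun x => Real.sinh x * (Real.cosh x ^ (n + 1))⁻¹)
      ((n + 1) * (Real.cosh x ^ (n + 2))⁻¹ - n * (Real.cosh x ^ n)⁻¹) x := by
  have hc := Real.cosh_pos x
  have hp := ((Real.hasDerivAt_cosh x).pow (n + 1)).inv (pow_pos hc _).ne'
  refine ((Real.hasDerivAt_sinh x).mul hp).congr_deriv ?_
  have hs : Real.sinh x ^ 2 = Real.cosh x ^ 2 - 1 := Real.sinh_sq x
  simp only [Pi.pow_apply, Pi.inv_apply]
  field_simp
  push_cast
  ring_nf
  rw [hs]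
  ring

theorem sechIntegral_two : sechIntegral 2 = 2 := by
  have ht : Tendsto (fun x => Real.sinh x * (Real.cosh x ^ (0 + 1))⁻¹) atTop (𝓝 1) := by
    have h0 := (Real.tendsto_exp_neg_atTop_nhds_zero.mul
      (tendsto_inv_cosh_pow_atTop one_ne_zero)).const_sub 1
    rw [mul_zero, sub_zero] at h0
    refine h0.congr fun x => ?_
    have := Real.cosh_pos x
    field_simp
    rw [← Real.cosh_sub_sinh]
    ring
  have hb : Tendsto (fun x => Real.sinh x * (Real.cosh x ^ (0 + 1))⁻¹) atBot (𝓝 (-1)) := by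
    have := (ht.comp tendsto_neg_atBot_atTop).neg
    simpa [Function.comp_def] using this
  have := integral_of_hasDerivAt_of_tendsto (hasDerivAt_sinh_mul_inv_cosh_pow 0) ?_ hb ht
  · simp only [CharP.cast_eq_zero, zero_add, one_mul, zero_mul, sub_zero] at this
    rw [sechIntegral, this]; norm_num
  · simpa using integrable_inv_cosh_pow two_ne_zero

theorem sechIntegral_add_two {n : ℕ} (hn : n ≠ 0) :
    (n + 1) * sechIntegral (n + 2) = n * sechIntegral n := by
  have hle : ∀ x, ‖Real.sinh x * (Real.cosh x ^ (n + 1))⁻¹‖ ≤ (Real.cosh x ^ n)⁻¹ := fun x => by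
    have hc := Real.cosh_pos x
    rw [norm_mul, Real.norm_of_nonneg (by positivity : 0 ≤ (Real.cosh x ^ (n + 1))⁻¹), pow_succ,
      mul_inv_rev, ← mul_assoc]
    refine mul_le_of_le_one_left (by positivity) ?_
    rw [← div_eq_mul_inv, div_le_one hc, Real.norm_eq_abs]
    refine abs_le_of_sq_le_sq ?_ hc.le
    rw [Real.sinh_sq]; linarith
  have h2 := (integrable_inv_cosh_pow (n := n + 2) (by omega)).const_mul ((n : ℝ) + 1)
  have h0 := (integrable_inv_cosh_pow hn).const_mul (n : ℝ)
  have := integral_of_hasDerivAt_of_tendsto (hasDerivAt_sinh_mul_inv_cosh_pow n) (h2.sub h0)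
    (squeeze_zero_norm hle (tendsto_inv_cosh_pow_atBot hn))
    (squeeze_zero_norm hle (tendsto_inv_cosh_pow_atTop hn))
  rw [integral_sub h2 h0, integral_const_mul, integral_const_mul, sub_zero] at this
  exact sub_eq_zero.1 this

theorem sechIntegral_eq {n : ℕ} (hn : n ≠ 0) :
    sechIntegral n = 2 ^ (n - 1) * Real.Gamma (n / 2) ^ 2 / Real.Gamma n := by
  induction n using Nat.twoStepInduction with
  | zero => exact absurd rfl hn
  | one => simp [-one_div, sechIntegral_one, Real.Gamma_one_half_eq, Real.sq_sqrt Real.pi_nonneg]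
  | more n ih _ =>
    rcases eq_or_ne n 0 with rfl | h0
    · simp [sechIntegral_two]
    · have hrec := sechIntegral_add_two h0
      have hpos : (0 : ℝ) < n := by positivity
      have e1 : Real.Gamma ((n + 2 : ℕ) / 2) = n / 2 * Real.Gamma (n / 2) := by
        rw [← Real.Gamma_add_one (by positivity)]
        congr 1; push_cast; ring
      have e2 : Real.Gamma ((n + 2 : ℕ) : ℝ) = (n + 1) * (n * Real.Gamma n) := by
        rw [← Real.Gamma_add_one (by positivity), ← Real.Gamma_add_one (by positivity)]
        congr 1; push_cast; ring
      have hG : 0 < Real.Gamma n := Real.Gamma_pos_of_pos hpos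
      have e3 : (2 : ℝ) ^ (n + 2 - 1) = 4 * 2 ^ (n - 1) := by
        obtain ⟨k, rfl⟩ := Nat.exists_eq_succ_of_ne_zero h0
        simp only [Nat.succ_eq_add_one, Nat.add_sub_cancel]
        rw [show k + 1 + 2 - 1 = k + 2 by omega]; ring
      rw [ih h0] at hrec
      rw [e1, e2, e3, ← mul_right_inj' (by positivity : (n : ℝ) + 1 ≠ 0), hrec]
      field_simp
      ring

theorem sechIntegral_pos {n : ℕ} (hn : n ≠ 0) : 0 < sechIntegral n := by
  have : (0 : ℝ) < n := by positivity
  have := Real.Gamma_pos_of_pos this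
  have := Real.Gamma_pos_of_pos (by positivity : (0 : ℝ) < n / 2)
  rw [sechIntegral_eq hn]
  positivity

theorem sinh_sq_mul_inv_cosh_pow (m : ℕ) (x : ℝ) :
    Real.sinh x ^ 2 * (Real.cosh x ^ (m + 2))⁻¹
      = (Real.cosh x ^ m)⁻¹ - (Real.cosh x ^ (m + 2))⁻¹ := by
  have := Real.cosh_pos x
  rw [Real.sinh_sq]
  field_simp
  ring

theorem integrable_sinh_sq_mul_inv_cosh_pow {m : ℕ} (hm : m ≠ 0) :
    Integrable fun x => Real.sinh x ^ 2 * (Real.cosh x ^ (m + 2))⁻¹ := by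
  simp_rw [sinh_sq_mul_inv_cosh_pow]
  exact (integrable_inv_cosh_pow hm).sub (integrable_inv_cosh_pow (by omega))

theorem integral_sinh_sq_mul_inv_cosh_pow {m : ℕ} (hm : m ≠ 0) :
    ∫ x, Real.sinh x ^ 2 * (Real.cosh x ^ (m + 2))⁻¹ = sechIntegral (m + 2) / m := by
  have hrec := sechIntegral_add_two hm
  have hpos : (0 : ℝ) < m := by positivity
  rw [eq_div_iff hpos.ne']
  simp_rw [sinh_sq_mul_inv_cosh_pow]
  rw [integral_sub (integrable_inv_cosh_pow hm) (integrable_inv_cosh_pow (by omega))]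
  change (sechIntegral m - sechIntegral (m + 2)) * m = _
  linarith

end SechIntegrals

section Calibration

open Filter Topology

/-- The extremal profile `θ ↦ (cosh θ)^(-m/2)` of the one-dimensional inequality. -/
noncomputable def sechProfile (m : ℕ) (θ : ℝ) : ℝ := Real.cosh θ ^ (-((m : ℝ) / 2))

theorem sechProfile_pos (m : ℕ) (θ : ℝ) : 0 < sechProfile m θ :=
  Real.rpow_pos_of_pos (Real.cosh_pos θ) _

theorem hasDerivAt_sechProfile (m : ℕ) (θ : ℝ) :
    HasDerivAt (sechProfile m)
      (-((m : ℝ) / 2) * (sechProfile m θ * (Real.sinh θ / Real.cosh θ))) θ := by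
  have hc := Real.cosh_pos θ
  refine ((Real.hasDerivAt_cosh θ).rpow_const (p := -((m : ℝ) / 2)) (Or.inl hc.ne')).congr_deriv ?_
  rw [sechProfile, Real.rpow_sub_one hc.ne']
  ring

theorem contDiff_sechProfile (m : ℕ) {k : WithTop ℕ∞} : ContDiff ℝ k (sechProfile m) :=
  Real.contDiff_cosh.rpow_const_of_ne fun θ => (Real.cosh_pos θ).ne'

theorem sechProfile_rpow {m : ℕ} (hm : m ≠ 0) (k : ℕ) (θ : ℝ) :
    sechProfile m θ ^ (2 * (k : ℝ) / m) = (Real.cosh θ ^ k)⁻¹ := by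
  have : (m : ℝ) ≠ 0 := Nat.cast_ne_zero.2 hm
  rw [sechProfile, ← Real.rpow_mul (Real.cosh_pos θ).le,
    show -((m : ℝ) / 2) * (2 * (k : ℝ) / m) = -(k : ℝ) by field_simp,
    Real.rpow_neg (Real.cosh_pos θ).le, Real.rpow_natCast]

theorem sechProfile_sq (m : ℕ) (θ : ℝ) : sechProfile m θ ^ 2 = (Real.cosh θ ^ m)⁻¹ := by
  rw [sechProfile, ← Real.rpow_natCast, ← Real.rpow_mul (Real.cosh_pos θ).le,
    show -((m : ℝ) / 2) * ((2 : ℕ) : ℝ) = -(m : ℝ) by push_cast; ring,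
    Real.rpow_neg (Real.cosh_pos θ).le, Real.rpow_natCast]

theorem tendsto_sechProfile_atTop {m : ℕ} (hm : m ≠ 0) :
    Tendsto (sechProfile m) atTop (𝓝 0) :=
  (tendsto_rpow_neg_atTop (by positivity)).comp tendsto_cosh_atTop

/-- The speed of the heteroclinic orbit, as a function of its position. -/
noncomputable def calibrationSpeed (m : ℕ) (s : ℝ) : ℝ := s * √(1 - |s| ^ (4 / (m : ℝ)))

/-- A primitive of `calibrationSpeed`. -/
noncomputable def calibration (m : ℕ) (s : ℝ) : ℝ := ∫ u in (0)..s, calibrationSpeed m u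

theorem continuous_calibrationSpeed (m : ℕ) : Continuous (calibrationSpeed m) :=
  continuous_id.mul (continuous_const.sub
    (continuous_abs.rpow_const fun _ => Or.inr (by positivity))).sqrt

theorem hasDerivAt_calibration (m : ℕ) (s : ℝ) :
    HasDerivAt (calibration m) (calibrationSpeed m s) s :=
  intervalIntegral.integral_hasDerivAt_right
    ((continuous_calibrationSpeed m).intervalIntegrable _ _)
    ((continuous_calibrationSpeed m).stronglyMeasurableAtFilter _ _)
    (continuous_calibrationSpeed m).continuousAt

theorem continuous_calibration (m : ℕ) : Continuous (calibration m) :=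
  continuous_iff_continuousAt.2 fun s => (hasDerivAt_calibration m s).continuousAt

theorem calibration_zero (m : ℕ) : calibration m 0 = 0 := intervalIntegral.integral_same

theorem calibrationSpeed_sechProfile {m : ℕ} (hm : m ≠ 0) {θ : ℝ} (hθ : 0 ≤ θ) :
    calibrationSpeed m (sechProfile m θ) = sechProfile m θ * (Real.sinh θ / Real.cosh θ) := by
  have hc := Real.cosh_pos θ
  have h4 : (4 : ℝ) / m = 2 * ((2 : ℕ) : ℝ) / m := by norm_num
  rw [calibrationSpeed, abs_of_pos (sechProfile_pos m θ), h4, sechProfile_rpow hm]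
  congr 1
  have hs := Real.sinh_nonneg_iff.2 hθ
  have : 1 - (Real.cosh θ ^ 2)⁻¹ = (Real.sinh θ / Real.cosh θ) ^ 2 := by
    rw [div_pow, Real.sinh_sq]
    field_simp
  rw [this, Real.sqrt_sq (by positivity)]

theorem calibration_one {m : ℕ} (hm : m ≠ 0) : calibration m 1 = sechIntegral (m + 2) / 4 := by
  have hpos : (0 : ℝ) < m := by positivity
  set f : ℝ → ℝ := fun θ => Real.sinh θ ^ 2 * (Real.cosh θ ^ (m + 2))⁻¹ with hf
  have hint : Integrable f := integrable_sinh_sq_mul_inv_cosh_pow hm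
  have hhalf : ∫ θ in Set.Ioi 0, f θ = sechIntegral (m + 2) / m / 2 := by
    have h := integral_comp_abs (f := f)
    have h1 : ∀ x, f |x| = f x := fun x => by
      rcases abs_choice x with h | h <;> simp [h, hf]
    simp_rw [h1] at h
    rw [hf, integral_sinh_sq_mul_inv_cosh_pow hm] at h
    rw [h]; ring
  have h := integral_Ioi_of_hasDerivAt_of_tendsto' (a := 0)
    (f := fun θ => calibration m (sechProfile m θ)) (f' := fun θ => -((m : ℝ) / 2) * f θ) (m := 0)
    (fun θ hθ => ?_) (hint.integrableOn.const_mul _) ?_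
  · rw [integral_const_mul, hhalf, zero_sub] at h
    have h0 : sechProfile m 0 = 1 := by simp [sechProfile]
    rw [h0] at h
    rw [← neg_inj, ← h]
    field_simp
    ring
  · refine ((hasDerivAt_calibration m _).comp θ (hasDerivAt_sechProfile m θ)).congr_deriv ?_
    have hc := Real.cosh_pos θ
    rw [calibrationSpeed_sechProfile hm hθ, hf]
    have : (Real.cosh θ ^ (m + 2))⁻¹ = sechProfile m θ ^ 2 / Real.cosh θ ^ 2 := by
      rw [sechProfile_sq]; field_simp; ring
    simp only [this]
    ring
  · have := ((continuous_calibration m).tendsto 0).comp (tendsto_sechProfile_atTop hm)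
    rwa [calibration_zero] at this

theorem calibration_inequality {m : ℕ} (s p ε : ℝ) (hm : m ≠ 0) (hs : |s| ≤ 1) (hε : ε ^ 2 = 1) :
    s * p + ε * (calibrationSpeed m s * p)
      ≤ (p + s / 2) ^ 2 - |s| ^ (2 * ((m + 2 : ℕ) : ℝ) / m) / 4 := by
  have hpos : (0 : ℝ) < m := by positivity
  have h1 : |s| ^ (4 / (m : ℝ)) ≤ 1 := Real.rpow_le_one (abs_nonneg s) hs (by positivity)
  set r := √(1 - |s| ^ (4 / (m : ℝ))) with hr
  have hr2 : r ^ 2 = 1 - |s| ^ (4 / (m : ℝ)) := Real.sq_sqrt (by linarith)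
  have hq : |s| ^ (2 * ((m + 2 : ℕ) : ℝ) / m) = s ^ 2 * |s| ^ (4 / (m : ℝ)) := by
    rw [← sq_abs, ← Real.rpow_natCast, ← Real.rpow_add_of_nonneg (abs_nonneg s) (by norm_num)
      (by positivity)]
    congr 1
    push_cast
    field_simp
    ring
  rw [hq, show calibrationSpeed m s = s * r from rfl,
    show |s| ^ (4 / (m : ℝ)) = 1 - r ^ 2 by linarith]
  have hεr : (ε * (s * r)) ^ 2 = (s * r) ^ 2 := by rw [mul_pow, hε, one_mul]
  linarith [sq_nonneg (p - ε * (s * r) / 2)]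

theorem normalized_energy_inequality {m : ℕ} (hm : m ≠ 0) {u : ℝ → ℝ} (hu : ContDiff ℝ 1 u)
    (hle : ∀ t, |u t| ≤ 1) {t₀ : ℝ} (h1 : u t₀ = 1) (hbot : Tendsto u atBot (𝓝 0))
    (htop : Tendsto u atTop (𝓝 0)) (hE : Integrable fun t => (deriv u t + u t / 2) ^ 2)
    (hN : Integrable fun t => |u t| ^ (2 * ((m + 2 : ℕ) : ℝ) / m)) :
    sechIntegral (m + 2) / 2 + (∫ t, |u t| ^ (2 * ((m + 2 : ℕ) : ℝ) / m)) / 4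
      ≤ ∫ t, (deriv u t + u t / 2) ^ 2 := by
  set q : ℝ := 2 * ((m + 2 : ℕ) : ℝ) / m with hq
  have hdc : Continuous (deriv u) := hu.continuous_deriv_one
  have huc : Continuous u := hu.continuous
  set f : ℝ → ℝ := fun t => (deriv u t + u t / 2) ^ 2 - |u t| ^ q / 4 with hf
  have hfi : Integrable f := hE.sub (hN.div_const 4)
  have hfc : Continuous f := ((hdc.add (huc.div_const 2)).pow 2).sub
    ((huc.abs.rpow_const fun _ => Or.inr (by positivity)).div_const 4)
  have key : ∀ ε : ℝ, ε ^ 2 = 1 → ∀ a b, a ≤ b →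
      (u b ^ 2 / 2 + ε * calibration m (u b)) - (u a ^ 2 / 2 + ε * calibration m (u a))
        ≤ ∫ t in a..b, f t := by
    intro ε hε a b hab
    have hd : ∀ t, HasDerivAt (fun t => u t ^ 2 / 2 + ε * calibration m (u t))
        (u t * deriv u t + ε * (calibrationSpeed m (u t) * deriv u t)) t := fun t => by
      have hut := (hu.differentiable one_ne_zero t).hasDerivAt
      refine (((hut.pow 2).div_const 2).add
        (((hasDerivAt_calibration m _).comp t hut).const_mul ε)).congr_deriv ?_
      simp
      ring
    have hc : Continuous fun t =>
        u t * deriv u t + ε * (calibrationSpeed m (u t) * deriv u t) :=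
      (huc.mul hdc).add
        (continuous_const.mul (((continuous_calibrationSpeed m).comp huc).mul hdc))
    rw [← intervalIntegral.integral_eq_sub_of_hasDerivAt (fun t _ => hd t)
      (hc.intervalIntegrable _ _)]
    exact intervalIntegral.integral_mono_on hab (hc.intervalIntegrable _ _)
      (hfc.intervalIntegrable _ _) fun t _ => calibration_inequality _ _ ε hm (hle t) hε
  have hlim := intervalIntegral_tendsto_integral hfi tendsto_neg_atTop_atBot tendsto_id
  have hcal : ∀ {l : Filter ℝ}, Tendsto u l (𝓝 0) → ∀ ε : ℝ,
      Tendsto (fun t => u t ^ 2 / 2 + ε * calibration m (u t)) l (𝓝 0) := fun {l} h ε => by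
    have := ((h.pow 2).div_const 2).add
      ((((continuous_calibration m).tendsto 0).comp h).const_mul ε)
    simpa [calibration_zero] using this
  have hlow := ((hcal htop (-1)).const_add (2 * calibration m 1)).sub
    ((hcal hbot 1).comp tendsto_neg_atTop_atBot)
  have hfin := le_of_tendsto_of_tendsto hlow hlim ?_
  · rw [integral_sub hE (hN.div_const 4), integral_div, calibration_one hm] at hfin
    linarith
  · filter_upwards [eventually_ge_atTop t₀, eventually_ge_atTop (-t₀)] with T hT hT'
    have i1 := key 1 (by norm_num) (-T) t₀ (by linarith)
    have i2 := key (-1) (by norm_num) t₀ T hT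
    have i3 := intervalIntegral.integral_add_adjacent_intervals
      (hfc.intervalIntegrable (μ := volume) (-T) t₀) (hfc.intervalIntegrable t₀ T)
    rw [h1] at i1 i2
    simp only [Function.comp_apply, id]
    linarith

end Calibration

section GagliardoNirenberg

open Filter Topology

/-- The sharp constant in the one-dimensional Gagliardo-Nirenberg inequality. -/
noncomputable def gnConst (m : ℕ) : ℝ :=
  (m + 2) / (4 * m) * (m * sechIntegral (m + 2)) ^ (2 / ((m : ℝ) + 2))

theorem gnConst_mul_rpow_le {m : ℕ} (hm : m ≠ 0) {N : ℝ} (hN : 0 ≤ N) :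
    gnConst m * N ^ ((m : ℝ) / (m + 2)) ≤ sechIntegral (m + 2) / 2 + N / 4 := by
  have hpos : (0 : ℝ) < m := by positivity
  have hJ := sechIntegral_pos (n := m + 2) (by omega)
  have h := Real.geom_mean_le_arith_mean2_weighted (w₁ := 2 / ((m : ℝ) + 2))
    (w₂ := (m : ℝ) / (m + 2)) (p₁ := m * sechIntegral (m + 2)) (p₂ := N) (by positivity)
    (by positivity) (by positivity) hN (by field_simp; ring)
  rw [gnConst, mul_assoc]
  refine (mul_le_mul_of_nonneg_left h (by positivity)).trans_eq ?_
  field_simp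
  ring

theorem gagliardo_nirenberg {m : ℕ} (hm : m ≠ 0) {w : ℝ → ℝ} (hw : ContDiff ℝ 1 w)
    (hbot : Tendsto w atBot (𝓝 0)) (htop : Tendsto w atTop (𝓝 0))
    (hE : Integrable fun t => (deriv w t + w t / 2) ^ 2) :
    gnConst m * (∫ t, |w t| ^ (2 * ((m + 2 : ℕ) : ℝ) / m)) ^ ((m : ℝ) / (m + 2))
      ≤ ∫ t, (deriv w t + w t / 2) ^ 2 := by
  have hpos : (0 : ℝ) < m := by positivity
  set q : ℝ := 2 * ((m + 2 : ℕ) : ℝ) / m with hq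
  have hq0 : 0 < q := by positivity
  have hE0 : 0 ≤ ∫ t, (deriv w t + w t / 2) ^ 2 := integral_nonneg fun t => sq_nonneg _
  have hexp : 0 < (m : ℝ) / (m + 2) := by positivity
  by_cases hN : Integrable fun t => |w t| ^ q
  swap
  · rwa [integral_undef hN, Real.zero_rpow hexp.ne', mul_zero]
  by_cases hzero : ∀ t, w t = 0
  · simp_rw [hzero, abs_zero, Real.zero_rpow hq0.ne']
    rw [integral_zero, Real.zero_rpow hexp.ne', mul_zero]
    exact integral_nonneg fun t => sq_nonneg _
  push Not at hzero
  obtain ⟨t₁, ht₁⟩ := hzero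
  obtain ⟨t₀, ht₀⟩ := hw.continuous.abs.exists_forall_ge' t₁ (by
    have hco : Tendsto (fun t => |w t|) (cocompact ℝ) (𝓝 0) := by
      rw [cocompact_eq_atBot_atTop]
      simpa using (hbot.sup htop).abs
    filter_upwards [hco.eventually_lt_const (abs_pos.2 ht₁)] with t ht using ht.le)
  have hc : w t₀ ≠ 0 := abs_pos.1 ((abs_pos.2 ht₁).trans_le (ht₀ t₁))
  set c := w t₀
  have hc' : 0 < |c| := abs_pos.2 hc
  have hder : ∀ t, deriv (fun t => c⁻¹ * w t) t = c⁻¹ * deriv w t := fun t =>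
    deriv_const_mul_field _
  have hEu : ∀ t, (deriv (fun t => c⁻¹ * w t) t + c⁻¹ * w t / 2) ^ 2
      = c⁻¹ ^ 2 * (deriv w t + w t / 2) ^ 2 := fun t => by rw [hder]; ring
  have hNu : ∀ t, |c⁻¹ * w t| ^ q = |c|⁻¹ ^ q * |w t| ^ q := fun t => by
    rw [abs_mul, abs_inv, Real.mul_rpow (by positivity) (abs_nonneg _)]
  have h := normalized_energy_inequality hm (u := fun t => c⁻¹ * w t) (contDiff_const.mul hw)
    (fun t => ?_) (t₀ := t₀) (inv_mul_cancel₀ hc) (by simpa using hbot.const_mul c⁻¹)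
    (by simpa using htop.const_mul c⁻¹) (by simp_rw [hEu]; exact hE.const_mul _)
    (by simp_rw [← hq, hNu]; exact hN.const_mul _)
  · simp_rw [← hq, hEu, hNu] at h
    rw [integral_const_mul, integral_const_mul] at h
    have hN0 : 0 ≤ ∫ t, |w t| ^ q := integral_nonneg fun t => by positivity
    have h2 := (gnConst_mul_rpow_le hm (by positivity : 0 ≤ |c|⁻¹ ^ q * ∫ t, |w t| ^ q)).trans h
    rw [Real.mul_rpow (by positivity) hN0, ← Real.rpow_mul (by positivity),
      show q * ((m : ℝ) / (m + 2)) = (2 : ℕ) by rw [hq]; push_cast; field_simp,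
      Real.rpow_natCast, ← abs_inv, sq_abs, mul_left_comm] at h2
    exact le_of_mul_le_mul_left h2 (by positivity)
  · rw [abs_mul, abs_inv, inv_mul_le_iff₀ hc', mul_one]
    exact ht₀ t

/-- The extremal function of the one-dimensional Gagliardo-Nirenberg inequality. -/
noncomputable def gnExtremal (m : ℕ) (t : ℝ) : ℝ := sechProfile m (t / m)

theorem gnExtremal_pos (m : ℕ) (t : ℝ) : 0 < gnExtremal m t := sechProfile_pos m _

theorem contDiff_gnExtremal (m : ℕ) {k : WithTop ℕ∞} : ContDiff ℝ k (gnExtremal m) :=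
  (contDiff_sechProfile m).comp (contDiff_id.div_const _)

theorem hasDerivAt_gnExtremal {m : ℕ} (hm : m ≠ 0) (t : ℝ) :
    HasDerivAt (gnExtremal m)
      (-(gnExtremal m t * (Real.sinh (t / m) / Real.cosh (t / m))) / 2) t := by
  have hpos : (0 : ℝ) < m := by positivity
  refine ((hasDerivAt_sechProfile m (t / m)).comp t
    ((hasDerivAt_id t).div_const (m : ℝ))).congr_deriv ?_
  rw [gnExtremal]
  field_simp

theorem abs_sinh_div_cosh_le (x : ℝ) : |Real.sinh x / Real.cosh x| ≤ 1 := by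
  rw [← Real.tanh_eq_sinh_div_cosh]
  exact (Real.abs_tanh_lt_one x).le

theorem abs_deriv_gnExtremal_le {m : ℕ} (hm : m ≠ 0) (t : ℝ) :
    |deriv (gnExtremal m) t| ≤ gnExtremal m t := by
  have h0 := gnExtremal_pos m t
  rw [(hasDerivAt_gnExtremal hm t).deriv, abs_div, abs_neg, abs_mul, abs_of_pos h0, abs_two]
  have := mul_le_of_le_one_right h0.le (abs_sinh_div_cosh_le (t / m))
  linarith

theorem integrable_gnExtremal_sq {m : ℕ} (hm : m ≠ 0) :
    Integrable fun t => gnExtremal m t ^ 2 := by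
  simp_rw [gnExtremal, sechProfile_sq]
  exact (integrable_inv_cosh_pow hm).comp_div (Nat.cast_ne_zero.2 hm)

theorem gnExtremal_rpow {m : ℕ} (hm : m ≠ 0) (t : ℝ) :
    gnExtremal m t ^ (2 * ((m + 2 : ℕ) : ℝ) / m) = (Real.cosh (t / m) ^ (m + 2))⁻¹ :=
  sechProfile_rpow hm _ _

theorem integrable_gnExtremal_rpow {m : ℕ} (hm : m ≠ 0) :
    Integrable fun t => gnExtremal m t ^ (2 * ((m + 2 : ℕ) : ℝ) / m) := by
  simp_rw [gnExtremal_rpow hm]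
  exact (integrable_inv_cosh_pow (n := m + 2) (by omega)).comp_div (Nat.cast_ne_zero.2 hm)

theorem integral_gnExtremal_rpow {m : ℕ} (hm : m ≠ 0) :
    ∫ t, gnExtremal m t ^ (2 * ((m + 2 : ℕ) : ℝ) / m) = m * sechIntegral (m + 2) := by
  simp_rw [gnExtremal_rpow hm]
  rw [Measure.integral_comp_div (fun x => (Real.cosh x ^ (m + 2))⁻¹), Nat.abs_cast, smul_eq_mul]
  rfl

theorem integral_gnExtremal_energy {m : ℕ} (hm : m ≠ 0) :
    ∫ t, (deriv (gnExtremal m) t + gnExtremal m t / 2) ^ 2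
      = (m + 2) / 4 * sechIntegral (m + 2) := by
  have hpos : (0 : ℝ) < m := by positivity
  have hpt : ∀ t, (deriv (gnExtremal m) t + gnExtremal m t / 2) ^ 2
      = (fun x => 1 / 4 * ((Real.cosh x ^ m)⁻¹ + Real.sinh x ^ 2 * (Real.cosh x ^ (m + 2))⁻¹
          - 2 * (Real.sinh x * (Real.cosh x ^ (m + 1))⁻¹))) (t / m) := fun t => by
    have hc := Real.cosh_pos (t / m)
    rw [(hasDerivAt_gnExtremal hm t).deriv]
    have h2 : gnExtremal m t ^ 2 = _ := sechProfile_sq m (t / m)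
    have : (-(gnExtremal m t * (Real.sinh (t / m) / Real.cosh (t / m))) / 2
        + gnExtremal m t / 2) ^ 2
        = 1 / 4 * gnExtremal m t ^ 2 * (1 - Real.sinh (t / m) / Real.cosh (t / m)) ^ 2 := by ring
    rw [this, h2]
    field_simp
    ring
  have i0 := integrable_inv_cosh_pow hm
  have i2 := integrable_sinh_sq_mul_inv_cosh_pow hm
  have i1 : Integrable fun x => Real.sinh x * (Real.cosh x ^ (m + 1))⁻¹ := by
    refine i0.mono' (Real.continuous_sinh.mul
      (continuous_inv_cosh_pow (m + 1))).aestronglyMeasurable (Eventually.of_forall fun x => ?_)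
    have hc := Real.cosh_pos x
    rw [show Real.sinh x * (Real.cosh x ^ (m + 1))⁻¹
      = Real.sinh x / Real.cosh x * (Real.cosh x ^ m)⁻¹ by field_simp; ring, norm_mul,
      Real.norm_of_nonneg (by positivity : 0 ≤ (Real.cosh x ^ m)⁻¹), Real.norm_eq_abs]
    exact mul_le_of_le_one_left (by positivity) (abs_sinh_div_cosh_le x)
  have hodd : ∫ x, Real.sinh x * (Real.cosh x ^ (m + 1))⁻¹ = 0 := by
    have := integral_neg_eq_self (fun x => Real.sinh x * (Real.cosh x ^ (m + 1))⁻¹) volume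
    simp only [Real.sinh_neg, Real.cosh_neg, neg_mul, integral_neg] at this
    linarith
  have hrec := sechIntegral_add_two hm
  simp_rw [hpt]
  rw [Measure.integral_comp_div (fun x => 1 / 4 * ((Real.cosh x ^ m)⁻¹
    + Real.sinh x ^ 2 * (Real.cosh x ^ (m + 2))⁻¹
    - 2 * (Real.sinh x * (Real.cosh x ^ (m + 1))⁻¹))), integral_const_mul,
    integral_sub (by exact i0.add i2) (i1.const_mul 2), integral_add i0 i2, integral_const_mul, hodd,
    integral_sinh_sq_mul_inv_cosh_pow hm, Nat.abs_cast, smul_eq_mul]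
  change m * (1 / 4 * (sechIntegral m + _ - _)) = _
  field_simp
  linarith

theorem gnConst_mul_gnExtremal {m : ℕ} (hm : m ≠ 0) :
    gnConst m * (m * sechIntegral (m + 2)) ^ ((m : ℝ) / (m + 2))
      = (m + 2) / 4 * sechIntegral (m + 2) := by
  have hpos : (0 : ℝ) < m := by positivity
  have hJ := sechIntegral_pos (n := m + 2) (by omega)
  rw [gnConst, mul_assoc, ← Real.rpow_add (by positivity),
    show 2 / ((m : ℝ) + 2) + m / (m + 2) = 1 by field_simp; ring, Real.rpow_one]
  field_simp

theorem exists_compactSupport_lt_gagliardo_nirenberg {m : ℕ} (hm : m ≠ 0) {K : ℝ}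
    (hK : gnConst m < K) :
    ∃ w : ℝ → ℝ, ContDiff ℝ (⊤ : ℕ∞) w ∧ HasCompactSupport w ∧
      ∫ t, (deriv w t + w t / 2) ^ 2
        < K * (∫ t, |w t| ^ (2 * ((m + 2 : ℕ) : ℝ) / m)) ^ ((m : ℝ) / (m + 2)) := by
  have hpos : (0 : ℝ) < m := by positivity
  have hJ := sechIntegral_pos (n := m + 2) (by omega)
  set q : ℝ := 2 * ((m + 2 : ℕ) : ℝ) / m with hq
  have hq0 : 0 < q := by positivity
  let φ : ContDiffBump (0 : ℝ) := ⟨1, 2, one_pos, one_lt_two⟩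
  have hφ : ContDiff ℝ (⊤ : ℕ∞) φ := φ.contDiff
  have hφ1 : ContDiff ℝ 1 φ := hφ.of_le (by exact_mod_cast le_top)
  obtain ⟨B, hB⟩ := hφ1.continuous_deriv_one.bounded_above_of_compact_support
    φ.hasCompactSupport.deriv
  let R : ℕ → ℝ := fun k => (k : ℝ) + 1
  have hR : ∀ k, 1 ≤ R k := fun k => by simp [R]
  have hRlim : Tendsto (fun k => (R k)⁻¹) atTop (𝓝 0) :=
    (tendsto_atTop_add_const_right _ _ tendsto_natCast_atTop_atTop).inv_tendsto_atTop
  let w : ℕ → ℝ → ℝ := fun k t => φ (t * (R k)⁻¹) * gnExtremal m t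
  have hw : ∀ k, ContDiff ℝ (⊤ : ℕ∞) (w k) := fun k =>
    (hφ.comp (contDiff_id.mul contDiff_const)).mul (contDiff_gnExtremal m)
  have hsupp : ∀ k, HasCompactSupport (w k) := fun k => by
    have hne : (R k)⁻¹ ≠ 0 := inv_ne_zero (by linarith [hR k])
    exact (φ.hasCompactSupport.comp_homeomorph (Homeomorph.mulRight₀ _ hne)).mul_right
  have hderiv : ∀ k t, deriv (w k) t = deriv φ (t * (R k)⁻¹) * (R k)⁻¹ * gnExtremal m t
      + φ (t * (R k)⁻¹) * deriv (gnExtremal m) t := fun k t => by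
    have h1 := (hφ1.differentiable one_ne_zero (t * (R k)⁻¹)).hasDerivAt.comp t
      ((hasDerivAt_id t).mul_const (R k)⁻¹)
    have h2 := (hasDerivAt_gnExtremal hm t).differentiableAt.hasDerivAt
    have h3 : deriv (w k) t = _ := (h1.mul h2).deriv
    simpa using h3
  have hφlim : ∀ t, Tendsto (fun k => φ (t * (R k)⁻¹)) atTop (𝓝 1) := fun t => by
    have h := (hφ.continuous.tendsto (t * 0)).comp (hRlim.const_mul t)
    have h1 : φ (t * 0) = 1 := by
      rw [mul_zero]
      exact φ.one_of_mem_closedBall (by simp [φ])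
    rwa [h1] at h
  have hφ'lim : ∀ t, Tendsto (fun k => deriv φ (t * (R k)⁻¹) * (R k)⁻¹) atTop (𝓝 0) := fun t => by
    have h := ((hφ1.continuous_deriv_one.tendsto (t * 0)).comp (hRlim.const_mul t)).mul hRlim
    simpa using h
  have hElim : Tendsto (fun k => ∫ t, (deriv (w k) t + w k t / 2) ^ 2) atTop
      (𝓝 (∫ t, (deriv (gnExtremal m) t + gnExtremal m t / 2) ^ 2)) := by
    refine tendsto_integral_of_dominated_convergence
      (fun t => (B + 2) ^ 2 * gnExtremal m t ^ 2) (fun k => ?_)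
      ((integrable_gnExtremal_sq hm).const_mul _) (fun k => Eventually.of_forall fun t => ?_)
      (Eventually.of_forall fun t => ?_)
    · have h1 : ContDiff ℝ 1 (w k) := (hw k).of_le (by exact_mod_cast le_top)
      exact ((h1.continuous_deriv_one.add
        (h1.continuous.div_const 2)).pow 2).aestronglyMeasurable
    · have hW := gnExtremal_pos m t
      have hRk : (R k)⁻¹ ≤ 1 := inv_le_one_of_one_le₀ (hR k)
      have hRk0 : 0 ≤ (R k)⁻¹ := inv_nonneg.2 (by linarith [hR k])
      have hφ0 := φ.nonneg (x := t * (R k)⁻¹)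
      have hφl := φ.le_one (x := t * (R k)⁻¹)
      have hB0 : 0 ≤ B := (norm_nonneg _).trans (hB 0)
      have e1 : |deriv φ (t * (R k)⁻¹) * (R k)⁻¹ * gnExtremal m t| ≤ B * gnExtremal m t := by
        rw [abs_mul, abs_mul, abs_of_pos hW, abs_of_nonneg hRk0]
        refine mul_le_mul_of_nonneg_right ?_ hW.le
        have := mul_le_mul (hB (t * (R k)⁻¹)) hRk hRk0 hB0
        rwa [mul_one] at this
      have e2 : |φ (t * (R k)⁻¹) * deriv (gnExtremal m) t| ≤ gnExtremal m t := by
        rw [abs_mul, abs_of_nonneg hφ0]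
        exact (mul_le_of_le_one_left (abs_nonneg _) hφl).trans (abs_deriv_gnExtremal_le hm t)
      have e3 : |w k t / 2| ≤ gnExtremal m t := by
        rw [abs_div, abs_two, abs_mul, abs_of_nonneg hφ0, abs_of_pos hW]
        have := mul_le_of_le_one_left hW.le hφl
        linarith
      rw [Real.norm_of_nonneg (sq_nonneg _), ← mul_pow, hderiv, ← sq_abs]
      refine pow_le_pow_left₀ (abs_nonneg _) ?_ 2
      refine (abs_add_le _ _).trans ?_
      have := abs_add_le (deriv φ (t * (R k)⁻¹) * (R k)⁻¹ * gnExtremal m t)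
        (φ (t * (R k)⁻¹) * deriv (gnExtremal m) t)
      linarith
    · simp_rw [hderiv]
      have := (((hφ'lim t).mul_const (gnExtremal m t)).add
        ((hφlim t).mul_const (deriv (gnExtremal m) t))).add
        (((hφlim t).mul_const (gnExtremal m t)).div_const 2)
      simpa using this.pow 2
  have hNlim : Tendsto (fun k => ∫ t, |w k t| ^ q) atTop (𝓝 (∫ t, gnExtremal m t ^ q)) := by
    refine tendsto_integral_of_dominated_convergence (fun t => gnExtremal m t ^ q) (fun k => ?_)
      (integrable_gnExtremal_rpow hm) (fun k => Eventually.of_forall fun t => ?_)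
      (Eventually.of_forall fun t => ?_)
    · exact ((hw k).continuous.abs.rpow_const fun _ => Or.inr hq0.le).aestronglyMeasurable
    · have hW := gnExtremal_pos m t
      rw [Real.norm_of_nonneg (by positivity)]
      refine Real.rpow_le_rpow (abs_nonneg _) ?_ hq0.le
      rw [abs_mul, abs_of_nonneg φ.nonneg, abs_of_pos hW]
      exact mul_le_of_le_one_left hW.le φ.le_one
    · have := ((hφlim t).mul_const (gnExtremal m t)).abs.rpow_const (p := q) (Or.inr hq0.le)
      rwa [one_mul, abs_of_pos (gnExtremal_pos m t)] at this
  rw [integral_gnExtremal_energy hm] at hElim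
  rw [integral_gnExtremal_rpow hm] at hNlim
  have hlt : (m + 2) / 4 * sechIntegral (m + 2)
      < K * (m * sechIntegral (m + 2)) ^ ((m : ℝ) / (m + 2)) := by
    rw [← gnConst_mul_gnExtremal hm]
    exact mul_lt_mul_of_pos_right hK (by positivity)
  obtain ⟨k, hk⟩ := (hElim.eventually_lt
    ((hNlim.rpow_const (p := (m : ℝ) / (m + 2)) (Or.inr (by positivity))).const_mul K) hlt).exists
  exact ⟨w k, hw k, hsupp k, hk⟩

end GagliardoNirenberg

section RadialReduction

open Filter Topology

theorem setIntegral_ball_comp_norm {n : ℕ} (hn : n ≠ 0) (f : ℝ → ℝ) :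
    ∫ x in Metric.ball (0 : EuclideanSpace ℝ (Fin n)) 1, f ‖x‖
      = n * volume.real (Metric.ball (0 : EuclideanSpace ℝ (Fin n)) 1)
        * ∫ r in Set.Ioo 0 1, r ^ (n - 1) * f r := by
  have : NeZero n := ⟨hn⟩
  have h := integral_fun_norm_addHaar (volume : Measure (EuclideanSpace ℝ (Fin n)))
    ((Set.Iio 1).indicator f)
  have hball : ∫ x : EuclideanSpace ℝ (Fin n), (Set.Iio 1).indicator f ‖x‖
      = ∫ x in Metric.ball (0 : EuclideanSpace ℝ (Fin n)) 1, f ‖x‖ := by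
    rw [← integral_indicator Metric.isOpen_ball.measurableSet]
    congr 1 with x
    simp [Set.indicator]
  have hIoo : (fun y : ℝ => y ^ (n - 1) • (Set.Iio (1 : ℝ)).indicator f y)
      = (Set.Iio 1).indicator fun y => y ^ (n - 1) * f y := by
    ext y
    by_cases hy : y ∈ Set.Iio (1 : ℝ) <;> simp [hy]
  rw [finrank_euclideanSpace_fin, nsmul_eq_mul, smul_eq_mul, ← mul_assoc, hball, hIoo,
    setIntegral_indicator measurableSet_Iio, Set.Ioi_inter_Iio] at h
  exact h

/-- The radius with `log (a - log r) = τ`. -/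
noncomputable def loglogRadius (a τ : ℝ) : ℝ := Real.exp (a - Real.exp τ)

theorem loglogRadius_pos (a τ : ℝ) : 0 < loglogRadius a τ := Real.exp_pos _

theorem hasDerivAt_loglogRadius (a τ : ℝ) :
    HasDerivAt (loglogRadius a) (-(loglogRadius a τ * Real.exp τ)) τ :=
  ((Real.hasDerivAt_exp τ).const_sub a).exp.congr_deriv (by rw [loglogRadius]; ring)

theorem contDiff_loglogRadius (a : ℝ) {k : WithTop ℕ∞} : ContDiff ℝ k (loglogRadius a) :=
  (contDiff_const.sub Real.contDiff_exp).exp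

theorem loglogRadius_injective (a : ℝ) : Function.Injective (loglogRadius a) := fun x y h => by
  simpa [loglogRadius] using h

theorem loglogRadius_image_univ (a : ℝ) :
    loglogRadius a '' Set.univ = Set.Ioo 0 (Real.exp a) := by
  ext r
  simp only [Set.image_univ, Set.mem_range, Set.mem_Ioo]
  constructor
  · rintro ⟨τ, rfl⟩
    exact ⟨loglogRadius_pos a τ, Real.exp_lt_exp.2 (sub_lt_self _ (Real.exp_pos _))⟩
  · rintro ⟨h0, h1⟩
    have := (Real.log_lt_iff_lt_exp h0).2 h1
    refine ⟨Real.log (a - Real.log r), ?_⟩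
    rw [loglogRadius, Real.exp_log (by linarith), sub_sub_cancel, Real.exp_log h0]

theorem tendsto_loglogRadius_atTop (a : ℝ) : Tendsto (loglogRadius a) atTop (𝓝 0) :=
  Real.tendsto_exp_atBot.comp
    (tendsto_atBot_add_const_left _ a (tendsto_neg_atTop_atBot.comp Real.tendsto_exp_atTop))

theorem one_le_loglogRadius {a τ : ℝ} (ha : 0 < a) (h : τ ≤ Real.log a) :
    1 ≤ loglogRadius a τ := by
  rw [loglogRadius, Real.one_le_exp_iff, sub_nonneg]
  exact (Real.exp_le_exp.2 h).trans_eq (Real.exp_log ha)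

theorem abs_deriv_loglogRadius (a τ : ℝ) :
    |-(loglogRadius a τ * Real.exp τ)| = loglogRadius a τ * Real.exp τ := by
  have := loglogRadius_pos a τ
  rw [abs_neg, abs_of_nonneg (by positivity)]

theorem setIntegral_Ioo_eq_integral_loglogRadius {a : ℝ} (ha : 0 < a) {F : ℝ → ℝ}
    (hF : ∀ r, 1 ≤ r → F r = 0) :
    ∫ r in Set.Ioo 0 1, F r
      = ∫ τ, loglogRadius a τ * Real.exp τ * F (loglogRadius a τ) := by
  have h1 : ∫ r in Set.Ioo 0 (Real.exp a), F r = ∫ r in Set.Ioo 0 1, F r :=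
    setIntegral_eq_of_subset_of_forall_sdiff_eq_zero measurableSet_Ioo
      (Set.Ioo_subset_Ioo_right (Real.one_le_exp ha.le)) fun r hr =>
        hF r (by_contra fun h => hr.2 ⟨hr.1.1, not_le.1 h⟩)
  rw [← h1, ← loglogRadius_image_univ, integral_image_eq_integral_abs_deriv_smul
    MeasurableSet.univ (fun τ _ => (hasDerivAt_loglogRadius a τ).hasDerivWithinAt)
    (loglogRadius_injective a).injOn, setIntegral_univ]
  simp_rw [abs_deriv_loglogRadius, smul_eq_mul]

/-- The profile of a radial function in Emden-Fowler coordinates. -/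
noncomputable def emdenFowler (a : ℝ) (g : ℝ → ℝ) (τ : ℝ) : ℝ :=
  Real.exp (-τ / 2) * g (loglogRadius a τ)

theorem contDiff_emdenFowler (a : ℝ) {g : ℝ → ℝ} (hg : ContDiff ℝ 1 g) :
    ContDiff ℝ 1 (emdenFowler a g) :=
  (contDiff_id.neg.div_const 2).exp.mul (hg.comp (contDiff_loglogRadius a))

theorem emdenFowler_energy (a : ℝ) {g : ℝ → ℝ} (hg : ContDiff ℝ 1 g) (τ : ℝ) :
    (deriv (emdenFowler a g) τ + emdenFowler a g τ / 2) ^ 2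
      = loglogRadius a τ * Real.exp τ *
        (loglogRadius a τ * deriv g (loglogRadius a τ) ^ 2) := by
  have h1 := (hg.differentiable one_ne_zero (loglogRadius a τ)).hasDerivAt.comp τ
    (hasDerivAt_loglogRadius a τ)
  have h2 := ((hasDerivAt_id τ).neg.div_const 2).exp
  have h3 : deriv (emdenFowler a g) τ = _ := (h2.mul h1).deriv
  have h4 : deriv (emdenFowler a g) τ + emdenFowler a g τ / 2
      = -(Real.exp (-τ / 2) * (deriv g (loglogRadius a τ) * (loglogRadius a τ * Real.exp τ))) := by
    rw [h3, emdenFowler]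
    simp only [Pi.neg_apply, id, Function.comp_apply]
    ring
  have h5 : Real.exp (-τ / 2) ^ 2 * Real.exp τ = 1 := by
    rw [← Real.exp_nat_mul, ← Real.exp_add]
    norm_num
    ring
  rw [h4]
  linear_combination (deriv g (loglogRadius a τ) ^ 2 * loglogRadius a τ ^ 2 * Real.exp τ) * h5

theorem integrable_emdenFowler_energy (a : ℝ) {g : ℝ → ℝ} (hg : ContDiff ℝ 1 g) :
    Integrable fun τ => (deriv (emdenFowler a g) τ + emdenFowler a g τ / 2) ^ 2 := by
  have h : IntegrableOn (fun r => r * deriv g r ^ 2) (Set.Ioo 0 (Real.exp a)) :=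
    ((continuous_id.mul (hg.continuous_deriv_one.pow 2)).integrableOn_Icc).mono_set
      Set.Ioo_subset_Icc_self
  rw [← loglogRadius_image_univ, integrableOn_image_iff_integrableOn_abs_deriv_smul
    MeasurableSet.univ (fun τ _ => (hasDerivAt_loglogRadius a τ).hasDerivWithinAt)
    (loglogRadius_injective a).injOn, integrableOn_univ] at h
  simp_rw [emdenFowler_energy a hg]
  simpa only [abs_deriv_loglogRadius, smul_eq_mul] using h

theorem tendsto_emdenFowler_atTop (a : ℝ) {g : ℝ → ℝ} (hg : Continuous g) :
    Tendsto (emdenFowler a g) atTop (𝓝 0) := by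
  have h1 : Tendsto (fun τ : ℝ => Real.exp (-τ / 2)) atTop (𝓝 0) :=
    Real.tendsto_exp_atBot.comp (tendsto_neg_atTop_atBot.atBot_div_const two_pos)
  have h2 := h1.mul ((hg.tendsto 0).comp (tendsto_loglogRadius_atTop a))
  rw [zero_mul] at h2
  exact h2

theorem tendsto_emdenFowler_atBot {a : ℝ} (ha : 0 < a) {g : ℝ → ℝ} (hg : ∀ r, 1 ≤ r → g r = 0) :
    Tendsto (emdenFowler a g) atBot (𝓝 0) := by
  refine tendsto_const_nhds.congr' ?_
  filter_upwards [eventually_le_atBot (Real.log a)] with τ hτ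
  rw [emdenFowler, hg _ (one_le_loglogRadius ha hτ), mul_zero]

theorem norm_gradient_comp_norm {E : Type*} [NormedAddCommGroup E] [InnerProductSpace ℝ E]
    [CompleteSpace E] {g : ℝ → ℝ} (hg : Differentiable ℝ g) {x : E} (hx : x ≠ 0) :
    ‖gradient (fun y : E => g ‖y‖) x‖ = |deriv g ‖x‖| := by
  have : Nontrivial E := ⟨x, 0, hx⟩
  have hd : DifferentiableAt ℝ (fun y : E => ‖y‖) x := differentiableAt_id.norm ℝ hx
  have h : HasFDerivAt (fun y : E => g ‖y‖) _ x :=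
    (hg ‖x‖).hasDerivAt.comp_hasFDerivAt x hd.hasFDerivAt
  rw [gradient, LinearIsometryEquiv.norm_map, h.fderiv, norm_smul, norm_fderiv_norm hd, mul_one,
    Real.norm_eq_abs]

theorem deriv_eq_zero_of_forall_ge {g : ℝ → ℝ} {ρ r : ℝ} (hg : ∀ r, ρ ≤ r → g r = 0)
    (hr : ρ < r) : deriv g r = 0 := by
  have : g =ᶠ[𝓝 r] fun _ => 0 := by
    filter_upwards [lt_mem_nhds hr] with s hs using hg s hs.le
  rw [this.deriv_eq, deriv_const]

theorem radial_energy_eq {m : ℕ} (hm : m ≠ 0) {a : ℝ} (ha : 0 < a) {g : ℝ → ℝ}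
    (hg : ContDiff ℝ 1 g) {ρ : ℝ} (hρ : ρ < 1) (hg0 : ∀ r, ρ ≤ r → g r = 0) :
    ∫ x in Metric.ball (0 : EuclideanSpace ℝ (Fin (m + 2))) 1,
        ‖x‖ ^ (-(m : ℝ)) * ‖gradient (fun y : EuclideanSpace ℝ (Fin (m + 2)) => g ‖y‖) x‖ ^ 2
      = (m + 2 : ℕ) * volume.real (Metric.ball (0 : EuclideanSpace ℝ (Fin (m + 2))) 1)
        * ∫ τ, (deriv (emdenFowler a g) τ + emdenFowler a g τ / 2) ^ 2 := by
  have h1 : ∀ x : EuclideanSpace ℝ (Fin (m + 2)),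
      ‖x‖ ^ (-(m : ℝ)) * ‖gradient (fun y : EuclideanSpace ℝ (Fin (m + 2)) => g ‖y‖) x‖ ^ 2
        = (fun r => r ^ (-(m : ℝ)) * deriv g r ^ 2) ‖x‖ := fun x => by
    rcases eq_or_ne x 0 with rfl | hx
    · have : -(m : ℝ) ≠ 0 := neg_ne_zero.2 (Nat.cast_ne_zero.2 hm)
      simp [Real.zero_rpow this]
    · rw [norm_gradient_comp_norm (hg.differentiable one_ne_zero) hx, sq_abs]
  simp_rw [h1]
  rw [setIntegral_ball_comp_norm (by omega) fun r => r ^ (-(m : ℝ)) * deriv g r ^ 2,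
    setIntegral_Ioo_eq_integral_loglogRadius ha]
  · congr 2 with τ
    rw [emdenFowler_energy a hg, Real.rpow_neg (loglogRadius_pos a τ).le, Real.rpow_natCast,
      show m + 2 - 1 = m + 1 by omega]
    have := loglogRadius_pos a τ
    field_simp
    ring
  · intro r hr
    rw [deriv_eq_zero_of_forall_ge hg0 (hρ.trans_le hr)]
    simp

theorem radial_potential_eq {m : ℕ} (hm : m ≠ 0) {a : ℝ} (ha : 0 < a) {g : ℝ → ℝ}
    (hg0 : ∀ r, 1 ≤ r → g r = 0) :
    ∫ x in Metric.ball (0 : EuclideanSpace ℝ (Fin (m + 2))) 1,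
        ‖x‖ ^ (-((m + 2 : ℕ) : ℝ)) * (X1 a ‖x‖) ^ (2 * (((m + 2 : ℕ) : ℝ) - 1) / m) *
          |g ‖x‖| ^ (2 * ((m + 2 : ℕ) : ℝ) / m)
      = (m + 2 : ℕ) * volume.real (Metric.ball (0 : EuclideanSpace ℝ (Fin (m + 2))) 1)
        * ∫ τ, |emdenFowler a g τ| ^ (2 * ((m + 2 : ℕ) : ℝ) / m) := by
  have hpos : (0 : ℝ) < m := by positivity
  have hq : 2 * ((m + 2 : ℕ) : ℝ) / m ≠ 0 := by positivity
  rw [setIntegral_ball_comp_norm (by omega) fun r => r ^ (-((m + 2 : ℕ) : ℝ)) *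
    (X1 a r) ^ (2 * (((m + 2 : ℕ) : ℝ) - 1) / m) * |g r| ^ (2 * ((m + 2 : ℕ) : ℝ) / m),
    setIntegral_Ioo_eq_integral_loglogRadius ha]
  · congr 2 with τ
    have hr := loglogRadius_pos a τ
    have hX : X1 a (loglogRadius a τ) = Real.exp (-τ) := by
      rw [X1, loglogRadius, Real.log_exp, sub_sub_cancel, Real.exp_neg]
    rw [hX, emdenFowler, abs_mul, Real.abs_exp, Real.mul_rpow (Real.exp_pos _).le (abs_nonneg _),
      ← Real.exp_mul, ← Real.exp_mul, Real.rpow_neg hr.le, Real.rpow_natCast,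
      show m + 2 - 1 = m + 1 by omega]
    have hexp : Real.exp τ * Real.exp (-τ * (2 * (((m + 2 : ℕ) : ℝ) - 1) / m))
        = Real.exp (-τ / 2 * (2 * ((m + 2 : ℕ) : ℝ) / m)) := by
      rw [← Real.exp_add]
      congr 1
      push_cast
      field_simp
      ring
    rw [← hexp]
    field_simp
    ring
  · intro r hr
    rw [hg0 r hr, abs_zero, Real.zero_rpow hq, mul_zero, mul_zero]

theorem rpow_mul_gnConst {m : ℕ} (hm : m ≠ 0) :
    ((m + 2 : ℕ) * volume.real (Metric.ball (0 : EuclideanSpace ℝ (Fin (m + 2))) 1))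
        ^ (2 / ((m : ℝ) + 2)) * gnConst m
      = (m : ℝ) ^ (-(2 * (((m + 2 : ℕ) : ℝ) - 1)) / ((m + 2 : ℕ) : ℝ)) * sobolevConst (m + 2) := by
  have hpos : (0 : ℝ) < m := by positivity
  have hn : (0 : ℝ) < (m + 2 : ℕ) := by positivity
  have hG := Real.Gamma_pos_of_pos hn
  have hG2 := Real.Gamma_pos_of_pos (half_pos hn)
  have hJ := sechIntegral_pos (n := m + 2) (by omega)
  have hvol : volume.real (Metric.ball (0 : EuclideanSpace ℝ (Fin (m + 2))) 1)
      = √π ^ (m + 2) / (((m + 2 : ℕ) : ℝ) / 2 * Real.Gamma (((m + 2 : ℕ) : ℝ) / 2)) := by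
    rw [← Real.Gamma_add_one (half_pos hn).ne', Measure.real, EuclideanSpace.volume_ball,
      Fintype.card_fin, ENNReal.ofReal_one, one_pow, one_mul, ENNReal.toReal_ofReal]
    have := Real.Gamma_pos_of_pos (by positivity : 0 < ((m + 2 : ℕ) : ℝ) / 2 + 1)
    positivity
  have hprod : (m + 2 : ℕ) * volume.real (Metric.ball (0 : EuclideanSpace ℝ (Fin (m + 2))) 1)
      * (m * sechIntegral (m + 2))
      = m * (2 * √π) ^ (m + 2)
        * (Real.Gamma (((m + 2 : ℕ) : ℝ) / 2) / Real.Gamma ((m + 2 : ℕ) : ℝ)) := by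
    rw [hvol, sechIntegral_eq (by omega), mul_pow, show m + 2 - 1 = m + 1 by omega]
    field_simp
    ring
  have hroot : ((2 * √π) ^ (m + 2)) ^ (2 / ((m : ℝ) + 2)) = 4 * π := by
    rw [← Real.rpow_natCast, ← Real.rpow_mul (by positivity),
      show ((m + 2 : ℕ) : ℝ) * (2 / ((m : ℝ) + 2)) = (2 : ℕ) by push_cast; field_simp,
      Real.rpow_natCast, mul_pow, Real.sq_sqrt Real.pi_nonneg]
    norm_num
  have hm2 : (m : ℝ) ^ (-(2 * (((m + 2 : ℕ) : ℝ) - 1)) / ((m + 2 : ℕ) : ℝ))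
      = (m : ℝ) ^ (2 / ((m : ℝ) + 2)) / m ^ 2 := by
    rw [← Real.rpow_natCast _ 2, ← Real.rpow_sub hpos]
    congr 1
    push_cast
    field_simp
    ring
  rw [gnConst, mul_left_comm, ← Real.mul_rpow (by positivity) (by positivity), hprod,
    Real.mul_rpow (by positivity) (by positivity), Real.mul_rpow (by positivity) (by positivity),
    hroot, hm2, sobolevConst]
  push_cast
  field_simp
  ring

/-- The radial function with a given Emden-Fowler profile. -/
noncomputable def radialOfProfile (a : ℝ) (w : ℝ → ℝ) (r : ℝ) : ℝ :=
  √(a - Real.log r) * w (Real.log (a - Real.log r))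

theorem emdenFowler_radialOfProfile (a : ℝ) (w : ℝ → ℝ) :
    emdenFowler a (radialOfProfile a w) = w := by
  ext τ
  rw [emdenFowler, radialOfProfile, loglogRadius, Real.log_exp, sub_sub_cancel, Real.log_exp,
    Real.sqrt_eq_rpow, ← Real.exp_mul, ← mul_assoc, ← Real.exp_add]
  ring_nf
  simp

theorem radialOfProfile_eq_zero_of_le_abs {a b : ℝ} {w : ℝ → ℝ} (hw : ∀ τ, τ ≤ b → w τ = 0)
    {r : ℝ} (hr : loglogRadius a b ≤ |r|) : radialOfProfile a w r = 0 := by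
  have h0 : 0 < |r| := (loglogRadius_pos a b).trans_le hr
  have h := (Real.le_log_iff_exp_le h0).2 hr
  rw [Real.log_abs] at h
  rcases le_or_gt (a - Real.log r) 0 with h1 | h1
  · rw [radialOfProfile, Real.sqrt_eq_zero_of_nonpos h1, zero_mul]
  · rw [radialOfProfile, hw _ ((Real.log_le_iff_le_exp h1).2 (by linarith)), mul_zero]

theorem radialOfProfile_eventuallyEq_zero {a b T : ℝ} {w : ℝ → ℝ}
    (hb : Real.log a < b) (hw : ∀ τ, τ ≤ b → w τ = 0) (hwT : ∀ τ, T ≤ τ → w τ = 0) :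
    radialOfProfile a w =ᶠ[𝓝 0] fun _ => 0 := by
  filter_upwards [Metric.ball_mem_nhds 0 (loglogRadius_pos a T)] with r hr
  rw [mem_ball_zero_iff, Real.norm_eq_abs] at hr
  rcases eq_or_ne r 0 with rfl | h0
  · rw [radialOfProfile, Real.log_zero, sub_zero, hw _ hb.le, mul_zero]
  · have h := (Real.log_lt_iff_lt_exp (abs_pos.2 h0)).2 hr
    rw [Real.log_abs] at h
    have hT := Real.exp_pos T
    rw [radialOfProfile, hwT _ ((Real.le_log_iff_exp_le (by linarith)).2 (by linarith)), mul_zero]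

theorem contDiff_radialOfProfile {a b T : ℝ} {w : ℝ → ℝ}
    (hb : Real.log a < b) (hwc : ContDiff ℝ (⊤ : ℕ∞) w) (hw : ∀ τ, τ ≤ b → w τ = 0)
    (hwT : ∀ τ, T ≤ τ → w τ = 0) : ContDiff ℝ (⊤ : ℕ∞) (radialOfProfile a w) := by
  refine contDiff_iff_contDiffAt.2 fun r => ?_
  rcases eq_or_ne r 0 with rfl | h0
  · exact contDiffAt_const.congr_of_eventuallyEq
      (radialOfProfile_eventuallyEq_zero hb hw hwT)
  rcases lt_or_ge (loglogRadius a b) |r| with h | h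
  · refine (contDiffAt_const (c := (0 : ℝ))).congr_of_eventuallyEq ?_
    filter_upwards [continuous_abs.continuousAt.eventually (lt_mem_nhds h)] with s hs
      using radialOfProfile_eq_zero_of_le_abs hw hs.le
  · have h1 := (Real.log_le_iff_le_exp (abs_pos.2 h0)).2 h
    rw [Real.log_abs] at h1
    have h2 := Real.exp_pos b
    have h3 : a - Real.log r ≠ 0 := by linarith
    have hin : ContDiffAt ℝ (⊤ : ℕ∞) (fun r => a - Real.log r) r :=
      contDiffAt_const.sub (Real.contDiffAt_log.2 h0)
    exact (hin.sqrt h3).mul (hwc.contDiffAt.comp r (hin.log h3))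

theorem contDiff_comp_norm {E : Type*} [NormedAddCommGroup E] [InnerProductSpace ℝ E]
    {g : ℝ → ℝ} {k : WithTop ℕ∞} (hg : ContDiff ℝ k g) (h0 : g =ᶠ[𝓝 0] fun _ => 0) :
    ContDiff ℝ k fun x : E => g ‖x‖ := by
  refine contDiff_iff_contDiffAt.2 fun x => ?_
  rcases eq_or_ne x 0 with rfl | hx
  · refine (contDiffAt_const (c := (0 : ℝ))).congr_of_eventuallyEq ?_
    have : Tendsto (fun x : E => ‖x‖) (𝓝 0) (𝓝 0) := tendsto_norm_zero
    exact this.eventually h0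
  · exact hg.contDiffAt.comp x (contDiffAt_norm ℝ hx)

theorem exists_radial_profile {E : Type*} [NormedAddCommGroup E] [NormedSpace ℝ E]
    [ProperSpace E] [Nontrivial E] {v : E → ℝ} (hv : ContDiff ℝ 1 v)
    (hsupp : tsupport v ⊆ Metric.ball 0 1) (hrad : ∃ g : ℝ → ℝ, ∀ x, v x = g ‖x‖) :
    ∃ g : ℝ → ℝ, ∃ ρ < 1, ContDiff ℝ 1 g ∧ (∀ r, ρ ≤ r → g r = 0) ∧ v = fun x => g ‖x‖ := by
  obtain ⟨g, hg⟩ := hrad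
  obtain ⟨ρ', hρ', hs⟩ := exists_lt_subset_ball (isClosed_tsupport v) hsupp
  obtain ⟨e, he⟩ := exists_norm_eq E zero_le_one
  refine ⟨fun r => v (r • e), max ρ' 0, max_lt hρ' one_pos,
    hv.comp (contDiff_id.smul contDiff_const), fun r hr => ?_, ?_⟩
  · by_contra hne
    have h := hs (subset_tsupport v hne)
    rw [mem_ball_zero_iff, norm_smul, he, mul_one, Real.norm_eq_abs] at h
    have := le_abs_self r
    have := (le_max_left ρ' 0).trans hr
    linarith
  · ext x
    change v x = v (‖x‖ • e)
    rw [hg, hg, norm_smul, he, mul_one, norm_norm]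

end RadialReduction

theorem stmt10 (n : ℕ) (hn : 3 ≤ n) (a : ℝ) (ha0 : 0 < a) :
    (∀ v : EuclideanSpace ℝ (Fin n) → ℝ, ContDiff ℝ (⊤ : ℕ∞) v → HasCompactSupport v →
      tsupport v ⊆ Metric.ball (0 : EuclideanSpace ℝ (Fin n)) 1 → (∃ g : ℝ → ℝ, ∀ x : EuclideanSpace ℝ (Fin n), v x = g ‖x‖) →
      (∫ x in Metric.ball (0 : EuclideanSpace ℝ (Fin n)) 1, ‖x‖ ^ (-((n : ℝ) - 2)) * ‖gradient v x‖ ^ 2)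
        ≥ ((n : ℝ) - 2) ^ (-(2 * ((n : ℝ) - 1)) / (n : ℝ)) * sobolevConst n *
          (∫ x in Metric.ball (0 : EuclideanSpace ℝ (Fin n)) 1,
              ‖x‖ ^ (-(n : ℝ)) * (X1 a ‖x‖) ^ (2 * ((n : ℝ) - 1) / ((n : ℝ) - 2)) *
                |v x| ^ (2 * (n : ℝ) / ((n : ℝ) - 2)))
            ^ (((n : ℝ) - 2) / (n : ℝ)))
    ∧
    (∀ C : ℝ, C > ((n : ℝ) - 2) ^ (-(2 * ((n : ℝ) - 1)) / (n : ℝ)) * sobolevConst n →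
      ∃ v : EuclideanSpace ℝ (Fin n) → ℝ, v ≠ 0 ∧ ContDiff ℝ (⊤ : ℕ∞) v ∧ HasCompactSupport v ∧
        tsupport v ⊆ Metric.ball (0 : EuclideanSpace ℝ (Fin n)) 1 ∧ (∃ g : ℝ → ℝ, ∀ x : EuclideanSpace ℝ (Fin n), v x = g ‖x‖) ∧
        (∫ x in Metric.ball (0 : EuclideanSpace ℝ (Fin n)) 1, ‖x‖ ^ (-((n : ℝ) - 2)) * ‖gradient v x‖ ^ 2)
          < C *
          (∫ x in Metric.ball (0 : EuclideanSpace ℝ (Fin n)) 1,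
              ‖x‖ ^ (-(n : ℝ)) * (X1 a ‖x‖) ^ (2 * ((n : ℝ) - 1) / ((n : ℝ) - 2)) *
                |v x| ^ (2 * (n : ℝ) / ((n : ℝ) - 2)))
            ^ (((n : ℝ) - 2) / (n : ℝ))) := by
  obtain ⟨m, rfl⟩ : ∃ m, n = m + 2 := ⟨n - 2, by omega⟩
  have hm : m ≠ 0 := by omega
  have hpos : (0 : ℝ) < m := by positivity
  have hm2 : ((m + 2 : ℕ) : ℝ) - 2 = m := by push_cast; ring
  rw [hm2]
  set ω : ℝ := (m + 2 : ℕ) * volume.real (Metric.ball (0 : EuclideanSpace ℝ (Fin (m + 2))) 1)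
    with hω
  have hω0 : 0 < ω := by
    have := ENNReal.toReal_pos (Metric.measure_ball_pos volume
      (0 : EuclideanSpace ℝ (Fin (m + 2))) one_pos).ne' measure_ball_lt_top.ne
    rw [hω]
    exact mul_pos (by positivity) this
  have hc := rpow_mul_gnConst hm
  rw [← hω] at hc
  have hωmul : ω ^ (2 / ((m : ℝ) + 2)) * ω ^ ((m : ℝ) / (m + 2)) = ω := by
    rw [← Real.rpow_add hω0, show 2 / ((m : ℝ) + 2) + m / (m + 2) = 1 by field_simp; ring,
      Real.rpow_one]
  rw [← hc]
  constructor
  · intro v hv _ hsupp hrad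
    obtain ⟨g, ρ, hρ, hg, hg0, rfl⟩ :=
      exists_radial_profile (hv.of_le (by exact_mod_cast le_top)) hsupp hrad
    have hg1 : ∀ r, 1 ≤ r → g r = 0 := fun r hr => hg0 r (hρ.le.trans hr)
    have hgn := gagliardo_nirenberg hm (contDiff_emdenFowler a hg)
      (tendsto_emdenFowler_atBot ha0 hg1) (tendsto_emdenFowler_atTop a hg.continuous)
      (integrable_emdenFowler_energy a hg)
    rw [radial_energy_eq hm ha0 hg hρ hg0, radial_potential_eq hm ha0 hg1, ← hω,
      Real.mul_rpow hω0.le (integral_nonneg fun τ => by positivity)]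
    push_cast at hgn ⊢
    refine (Eq.trans_le ?_ (mul_le_mul_of_nonneg_left hgn hω0.le)).ge
    nth_rw 3 [← hωmul]
    ring
  · intro C hC
    have hK : gnConst m < C / ω ^ (2 / ((m : ℝ) + 2)) := by
      rw [lt_div_iff₀ (by positivity), mul_comm]
      exact hC
    obtain ⟨w₀, hw₀, hw₀s, hlt₀⟩ := exists_compactSupport_lt_gagliardo_nirenberg hm hK
    obtain ⟨L, hL⟩ := hw₀s.isCompact.isBounded.subset_closedBall 0
    have hw₀0 : ∀ t, L < |t| → w₀ t = 0 := fun t ht => by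
      by_contra hne
      have := hL (subset_tsupport _ hne)
      rw [mem_closedBall_zero_iff, Real.norm_eq_abs] at this
      linarith
    set b := Real.log a + 1
    have hb : Real.log a < b := lt_add_one _
    set s := b + |L| + 1 with hs
    set w : ℝ → ℝ := fun τ => w₀ (τ - s) with hwdef
    have hlL := le_abs_self L
    have hwb : ∀ τ, τ ≤ b → w τ = 0 := fun τ hτ => hw₀0 _ (by
      have := neg_le_abs (τ - s)
      linarith)
    have hwT : ∀ τ, s + |L| + 1 ≤ τ → w τ = 0 := fun τ hτ => hw₀0 _ (by
      have := le_abs_self (τ - s)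
      linarith)
    have hw : ContDiff ℝ (⊤ : ℕ∞) w := hw₀.comp (contDiff_id.sub contDiff_const)
    have hlt : ∫ t, (deriv w t + w t / 2) ^ 2 < C / ω ^ (2 / ((m : ℝ) + 2)) *
        (∫ t, |w t| ^ (2 * ((m + 2 : ℕ) : ℝ) / m)) ^ ((m : ℝ) / (m + 2)) := by
      have hd : ∀ t, deriv w t = deriv w₀ (t - s) := fun t => deriv_comp_sub_const _ _ _
      simp_rw [hd, hwdef]
      rw [integral_sub_right_eq_self (fun t => (deriv w₀ t + w₀ t / 2) ^ 2) s,
        integral_sub_right_eq_self (fun t => |w₀ t| ^ (2 * ((m + 2 : ℕ) : ℝ) / m)) s]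
      exact hlt₀
    set g := radialOfProfile a w
    set ρ := loglogRadius a b
    have hρ : ρ < 1 := by
      have := Real.exp_lt_exp.2 hb
      rw [Real.exp_log ha0] at this
      exact Real.exp_lt_one_iff.2 (by linarith)
    have hg : ContDiff ℝ (⊤ : ℕ∞) g := contDiff_radialOfProfile hb hw hwb hwT
    have hg1 : ContDiff ℝ 1 g := hg.of_le (by exact_mod_cast le_top)
    have hg0 : ∀ r, ρ ≤ r → g r = 0 := fun r hr =>
      radialOfProfile_eq_zero_of_le_abs hwb (hr.trans (le_abs_self r))
    have hsupp : tsupport (fun x : EuclideanSpace ℝ (Fin (m + 2)) => g ‖x‖)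
        ⊆ Metric.closedBall 0 ρ := by
      refine closure_minimal (fun x hx => ?_) Metric.isClosed_closedBall
      rw [mem_closedBall_zero_iff]
      by_contra! h
      exact hx (hg0 _ h.le)
    have key : (∫ x in Metric.ball (0 : EuclideanSpace ℝ (Fin (m + 2))) 1, ‖x‖ ^ (-(m : ℝ)) *
          ‖gradient (fun y : EuclideanSpace ℝ (Fin (m + 2)) => g ‖y‖) x‖ ^ 2)
        < C * (∫ x in Metric.ball (0 : EuclideanSpace ℝ (Fin (m + 2))) 1,
            ‖x‖ ^ (-((m + 2 : ℕ) : ℝ)) * (X1 a ‖x‖) ^ (2 * (((m + 2 : ℕ) : ℝ) - 1) / m) *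
              |g ‖x‖| ^ (2 * ((m + 2 : ℕ) : ℝ) / m)) ^ ((m : ℝ) / ((m + 2 : ℕ) : ℝ)) := by
      rw [radial_energy_eq hm ha0 hg1 hρ hg0,
        radial_potential_eq hm ha0 fun r hr => hg0 r (hρ.le.trans hr), ← hω,
        Real.mul_rpow hω0.le (integral_nonneg fun τ => by positivity),
        emdenFowler_radialOfProfile]
      push_cast at hlt ⊢
      refine (mul_lt_mul_of_pos_left hlt hω0).trans_eq ?_
      nth_rw 1 [← hωmul]
      field_simp
    refine ⟨fun x => g ‖x‖, fun hzero => ?_, contDiff_comp_norm hg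
      (radialOfProfile_eventuallyEq_zero hb hwb hwT),
      (isCompact_closedBall 0 ρ).of_isClosed_subset (isClosed_tsupport _) hsupp,
      hsupp.trans (Metric.closedBall_subset_ball hρ), ⟨g, fun _ => rfl⟩, key⟩
    have hz : ∀ x : EuclideanSpace ℝ (Fin (m + 2)), g ‖x‖ = 0 := fun x => congrFun hzero x
    simp_rw [hz, abs_zero] at key
    rw [Real.zero_rpow (by positivity)] at key
    simp only [mul_zero, integral_zero] at key
    rw [Real.zero_rpow (by positivity), mul_zero] at key
    exact key.not_ge (integral_nonneg fun x => by positivity)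
end

section
/- Let n ≥ 3 and a > 0, and set C_n(a) := (n-2)^{-2(n-1)/n} S_n if a ≥ 1/(n-2) and C_n(a) := a^{2(n-1)/n} S_n if 0 < a < 1/(n-2). Then C_n(a) is never attained by a smooth function in the weighted inequality: for every nonzero v ∈ C_c^∞(B_1), ∫_{B_1} |x|^{-(n-2)} |∇v|² dx > C_n(a) · ( ∫_{B_1} |x|^{-n} X_1(a,|x|)^{2(n-1)/(n-2)} |v|^{2n/(n-2)} dx )^{(n-2)/n} holds with strict inequality. -/
open MeasureTheory Real

/-- The inverse of a primitive of a positive density. -/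
lemma exists_quantile {g : ℝ → ℝ} (hg : Continuous g) {δ : ℝ} (hδ : 0 < δ) (hgδ : ∀ z, δ ≤ g z)
    (c : ℝ) : ∃ q : ℝ → ℝ, StrictMono q ∧ (∀ u, HasDerivAt q (1 / g (q u)) u) ∧
      ∀ z, q (∫ t in c..z, g t) = z := by
  set G : ℝ → ℝ := fun z => ∫ t in c..z, g t with hG
  have hGd : ∀ z, HasDerivAt G (g z) z := fun z =>
    intervalIntegral.integral_hasDerivAt_right (hg.intervalIntegrable _ _)
      (hg.stronglyMeasurableAtFilter _ _) hg.continuousAt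
  have hGdiff : Differentiable ℝ G := fun z => (hGd z).differentiableAt
  have hmono : StrictMono G := strictMono_of_deriv_pos fun z => by
    rw [(hGd z).deriv]; exact hδ.trans_le (hgδ z)
  have hlin : Monotone fun z => G z - δ * z := by
    refine monotone_of_deriv_nonneg (by fun_prop) fun z => ?_
    have : HasDerivAt (fun z => G z - δ * z) (g z - δ * 1) z :=
      (hGd z).sub ((hasDerivAt_id z).const_mul δ)
    rw [this.deriv]; linarith [hgδ z]
  have hGc : G c = 0 := by simp [hG]
  have htop : Filter.Tendsto G Filter.atTop Filter.atTop := by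
    refine Filter.tendsto_atTop_mono' _ ?_
      ((Filter.tendsto_id.const_mul_atTop hδ).atTop_add
        (tendsto_const_nhds (x := -(δ * c))))
    filter_upwards [Filter.eventually_ge_atTop c] with z hz
    have := hlin hz
    simp only [hGc, id] at this ⊢
    linarith
  have hbot : Filter.Tendsto G Filter.atBot Filter.atBot := by
    refine Filter.tendsto_atBot_mono' _ ?_
      ((Filter.tendsto_id.const_mul_atBot hδ).atBot_add
        (tendsto_const_nhds (x := -(δ * c))))
    filter_upwards [Filter.eventually_le_atBot c] with z hz
    have := hlin hz
    simp only [hGc, id] at this ⊢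
    linarith
  have hsurj : Function.Surjective G := hGdiff.continuous.surjective htop hbot
  let e := hmono.orderIsoOfSurjective G hsurj
  have he : ∀ z, e z = G z := fun z => rfl
  refine ⟨e.symm, e.symm.strictMono, fun u => ?_, fun z => ?_⟩
  · rw [one_div]
    refine HasDerivAt.of_local_left_inverse e.symm.continuous.continuousAt (hGd _)
      (hδ.trans_le (hgδ _)).ne' (Filter.Eventually.of_forall fun y => ?_)
    exact e.apply_symm_apply y
  · exact e.symm_apply_apply z

/-- Monotone transport of the density `p` to the density `g` on `[-R, R]`. -/
lemma transport_line {g q : ℝ → ℝ} {R L m : ℝ} (hR : 0 < R) (hg : Continuous g)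
    (hgpos : ∀ z, 0 < g z)
    (hq : StrictMono q) (hqd : ∀ u, HasDerivAt q (1 / g (q u)) u)
    (hqi : ∀ z, q (∫ t in (-R)..z, g t) = z)
    {p : ℝ → ℝ} (hp : Continuous p) (hp0 : ∀ t, 0 ≤ p t)
    (hpL : ∀ t, L ≤ |t| → p t = 0) (hpi : Integrable p) (hm : ∫ t, p t = m) (hmpos : 0 < m) :
    let I := ∫ t in (-R)..R, g t
    let Z := fun t => q (I / m * ∫ τ in (-L)..t, p τ)
    (∀ t, HasDerivAt Z (I * p t / (m * g (Z t))) t) ∧ (∀ t, |Z t| ≤ R) ∧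
    ∀ h : ℝ → ℝ, Continuous h → ∫ t, h (Z t) * p t = m / I * ∫ z in (-R)..R, h z * g z := by
  intro I Z
  have hI : 0 < I := intervalIntegral.intervalIntegral_pos_of_pos
    (hg.intervalIntegrable _ _) hgpos (by linarith)
  have hZ : ∀ t, HasDerivAt Z (I * p t / (m * g (Z t))) t := fun t => by
    have h1 : HasDerivAt (fun t => I / m * ∫ τ in (-L)..t, p τ) (I / m * p t) t :=
      (intervalIntegral.integral_hasDerivAt_right (hp.intervalIntegrable _ _)
        (hp.stronglyMeasurableAtFilter _ _) hp.continuousAt).const_mul _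
    refine ((hqd _).comp t h1).congr_deriv ?_
    rw [one_div_mul_eq_div, div_mul_eq_mul_div, div_div]
  have hL : 0 < L := by
    by_contra! hcon
    have : p = 0 := funext fun t => hpL t (hcon.trans (abs_nonneg t))
    rw [this] at hm
    simp at hm
    exact hmpos.ne hm
  have hN : ∀ t, ∫ τ in (-L)..t, p τ = ∫ τ in Set.Iic t, p τ := fun t => by
    rw [← intervalIntegral.integral_Iic_sub_Iic hpi.integrableOn hpi.integrableOn,
      setIntegral_eq_zero_of_forall_eq_zero (t := Set.Iic (-L)) fun τ hτ => hpL τ ?_, sub_zero]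
    rw [Set.mem_Iic] at hτ
    exact le_abs.2 (Or.inr (by linarith))
  have hNL : ∫ τ in (-L)..L, p τ = m := by
    rw [hN, ← hm]
    refine setIntegral_eq_integral_of_forall_compl_eq_zero fun t ht => hpL t ?_
    rw [Set.mem_Iic, not_le] at ht
    exact le_abs.2 (Or.inl ht.le)
  have e1 : Z (-L) = -R := by simpa [Z] using hqi (-R)
  have e2 : Z L = R := by
    simp only [Z]
    rw [hNL, div_mul_cancel₀ _ hmpos.ne']
    exact hqi R
  refine ⟨hZ, fun t => ?_, fun h hh => ?_⟩
  · have hN0 : 0 ≤ ∫ τ in (-L)..t, p τ := by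
      rw [hN]; exact integral_nonneg hp0
    have hNm : ∫ τ in (-L)..t, p τ ≤ m := by
      rw [hN, ← hm]
      exact setIntegral_le_integral hpi (Filter.Eventually.of_forall hp0)
    rw [abs_le]
    constructor
    · rw [← e1]
      refine hq.monotone ?_
      simp only [intervalIntegral.integral_same, mul_zero]
      positivity
    · rw [← e2]
      refine hq.monotone ?_
      rw [hNL]
      gcongr
  have hZc : Continuous Z := continuous_iff_continuousAt.2 fun t => (hZ t).continuousAt
  have hsub := intervalIntegral.integral_comp_mul_deriv (a := -L) (b := L)
    (f := Z) (f' := fun t => I * p t / (m * g (Z t))) (g := fun z => h z * g z)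
    (fun t _ => hZ t) (by
      refine Continuous.continuousOn ?_
      refine (continuous_const.mul hp).div (continuous_const.mul (hg.comp hZc)) fun t => ?_
      exact (mul_pos hmpos (hgpos _)).ne') (hh.mul hg)
  rw [e1, e2] at hsub
  have hsupp : ∫ t, h (Z t) * p t = ∫ t in (-L)..L, h (Z t) * p t := by
    rw [intervalIntegral.integral_of_le (by linarith), ← integral_Icc_eq_integral_Ioc]
    refine (setIntegral_eq_integral_of_forall_compl_eq_zero fun t ht => ?_).symm
    rw [hpL t, mul_zero]
    by_contra hcon
    exact ht (abs_le.1 (not_le.1 hcon).le)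
  rw [hsupp, ← hsub, ← intervalIntegral.integral_const_mul]
  refine intervalIntegral.integral_congr fun t _ => ?_
  have := hgpos (Z t)
  simp only [Function.comp]
  field_simp

/-- The integral of `F` over the coordinates in `s`. -/
noncomputable def margR {ι : Type*} [DecidableEq ι] (F : (ι → ℝ) → ℝ) (s : Finset ι)
    (x : ι → ℝ) : ℝ :=
  ∫ y : s → ℝ, F (Function.updateFinset x s y)

section Marginal

set_option linter.unusedSectionVars false

variable {ι : Type*} [DecidableEq ι] [Fintype ι] {F : (ι → ℝ) → ℝ} {L : ℝ} {s : Finset ι}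

lemma continuous_updateFinset_pair (s : Finset ι) :
    Continuous fun z : (ι → ℝ) × (s → ℝ) => Function.updateFinset z.1 s z.2 := by
  refine continuous_pi fun i => ?_
  by_cases hi : i ∈ s
  · simp only [Function.updateFinset, hi, dite_true]; fun_prop
  · simp only [Function.updateFinset, hi, dite_false]; fun_prop

lemma margR_fibre_eq_zero (hL : ∀ x i, L ≤ |x i| → F x = 0) (x : ι → ℝ) {y : s → ℝ}
    (hy : y ∉ Set.Icc (fun _ => -L) (fun _ => L)) : F (Function.updateFinset x s y) = 0 := by
  by_contra hcon
  refine hy ⟨fun i => ?_, fun i => ?_⟩ <;>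
  · have := mt (hL (Function.updateFinset x s y) i) hcon
    simp only [Function.updateFinset, i.2, dite_true, Subtype.coe_eta, not_le] at this
    have := abs_lt.1 this
    first | exact this.1.le | exact this.2.le

lemma margR_fibre_hasCompactSupport (hL : ∀ x i, L ≤ |x i| → F x = 0) (x : ι → ℝ) :
    HasCompactSupport fun y : s → ℝ => F (Function.updateFinset x s y) :=
  HasCompactSupport.intro isCompact_Icc fun _ hy => margR_fibre_eq_zero hL x hy

lemma margR_fibre_continuous (hF : Continuous F) (x : ι → ℝ) :
    Continuous fun y : s → ℝ => F (Function.updateFinset x s y) :=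
  hF.comp ((continuous_updateFinset_pair s).comp (Continuous.prodMk_right x))

lemma ofReal_margR (hF : Continuous F) (hF0 : ∀ x, 0 ≤ F x)
    (hL : ∀ x i, L ≤ |x i| → F x = 0) (x : ι → ℝ) :
    ENNReal.ofReal (margR F s x) =
      lmarginal (fun _ => volume) s (fun x => ENNReal.ofReal (F x)) x := by
  rw [margR, ofReal_integral_eq_lintegral_ofReal
    ((margR_fibre_continuous hF x).integrable_of_hasCompactSupport
      (margR_fibre_hasCompactSupport hL x)) (Filter.Eventually.of_forall fun _ => hF0 _)]
  rfl

lemma margR_nonneg (hF0 : ∀ x, 0 ≤ F x) (x : ι → ℝ) : 0 ≤ margR F s x :=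
  integral_nonneg fun _ => hF0 _

lemma updateFinset_restrict_self (x : ι → ℝ) :
    Function.updateFinset x s (fun i => x i) = x := by
  ext i; simp [Function.updateFinset]

lemma margR_pos (hF : Continuous F) (hF0 : ∀ x, 0 ≤ F x)
    (hL : ∀ x i, L ≤ |x i| → F x = 0) {x : ι → ℝ} (hx : F x ≠ 0) : 0 < margR F s x := by
  refine (margR_fibre_continuous hF x).integral_pos_of_hasCompactSupport_nonneg_nonzero
    (margR_fibre_hasCompactSupport hL x) (fun _ => hF0 _) (x := fun i => x i) ?_
  rwa [updateFinset_restrict_self]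

lemma continuous_margR (hF : Continuous F) (hL : ∀ x i, L ≤ |x i| → F x = 0) :
    Continuous (margR F s) := by
  have h : margR F s = fun x => ∫ y in Set.Icc (fun _ => -L) (fun _ => L),
      F (Function.updateFinset x s y) := by
    ext x
    exact (setIntegral_eq_integral_of_forall_compl_eq_zero
      fun y hy => margR_fibre_eq_zero hL x hy).symm
  rw [h]
  exact continuous_parametric_integral_of_continuous
    (f := fun x y => F (Function.updateFinset x s y))
    (hF.comp (continuous_updateFinset_pair s)) isCompact_Icc

lemma margR_eq_zero (hL : ∀ x i, L ≤ |x i| → F x = 0) {i : ι} (hi : i ∉ s) {x : ι → ℝ}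
    (hx : L ≤ |x i|) : margR F s x = 0 := by
  rw [margR]
  refine integral_eq_zero_of_ae (Filter.Eventually.of_forall fun y => hL _ i ?_)
  simpa [Function.updateFinset, hi] using hx

lemma margR_update (F : (ι → ℝ) → ℝ) {i : ι} (hi : i ∈ s) (x : ι → ℝ) (t : ℝ) :
    margR F s (Function.update x i t) = margR F s x := by
  simp only [margR]
  congr 1
  ext y
  congr 1
  ext j
  by_cases hj : j ∈ s
  · simp [Function.updateFinset, hj]
  · have : j ≠ i := fun h => hj (h ▸ hi)
    simp [Function.updateFinset, hj, this]

lemma margR_line_integrable (hF : Continuous F) (hL : ∀ x i, L ≤ |x i| → F x = 0) {i : ι}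
    (hi : i ∉ s) (x : ι → ℝ) :
    Integrable fun t => margR F s (Function.update x i t) := by
  refine ((continuous_margR hF hL).comp
    (continuous_const.update i continuous_id)).integrable_of_hasCompactSupport ?_
  refine HasCompactSupport.intro (isCompact_Icc (a := -L) (b := L)) fun t ht => ?_
  refine margR_eq_zero hL hi ?_
  by_contra! hcon
  rw [id, Function.update_self] at hcon
  exact ht (abs_le.1 hcon.le)

lemma integral_margR_line (hF : Continuous F) (hF0 : ∀ x, 0 ≤ F x)
    (hL : ∀ x i, L ≤ |x i| → F x = 0) {i : ι}
    (hi : i ∉ s) (x : ι → ℝ) :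
    ∫ t, margR F s (Function.update x i t) = margR F (insert i s) x := by
  rw [← ENNReal.ofReal_eq_ofReal_iff (integral_nonneg fun _ => margR_nonneg hF0 _)
    (margR_nonneg hF0 _), ofReal_margR hF hF0 hL, lmarginal_insert _
      hF.measurable.ennreal_ofReal hi, ofReal_integral_eq_lintegral_ofReal (margR_line_integrable hF hL hi x)
        (Filter.Eventually.of_forall fun _ => margR_nonneg hF0 _)]
  simp_rw [ofReal_margR hF hF0 hL]

lemma margR_empty (F : (ι → ℝ) → ℝ) (x : ι → ℝ) : margR F ∅ x = F x := by
  have h : ∀ y, Function.updateFinset x ∅ y = x := fun y => by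
    ext; simp [Function.updateFinset]
  simp [margR, h, Measure.real, volume_pi]

lemma margR_univ (hF : Continuous F) (hF0 : ∀ x, 0 ≤ F x)
    (hL : ∀ x i, L ≤ |x i| → F x = 0) (x : ι → ℝ) :
    ENNReal.ofReal (margR F Finset.univ x) = ∫⁻ x, ENNReal.ofReal (F x) := by
  rw [ofReal_margR hF hF0 hL, ← lintegral_eq_lmarginal_univ]
  rfl

end Marginal
/-- The coordinates of index at least `j`. -/
def tailCoords (n j : ℕ) : Finset (Fin n) := Finset.univ.filter fun i => j ≤ i.val

lemma mem_tailCoords {n j : ℕ} {i : Fin n} : i ∈ tailCoords n j ↔ j ≤ i.val := by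
  simp [tailCoords]

lemma tailCoords_zero (n : ℕ) : tailCoords n 0 = Finset.univ := by
  ext; simp [tailCoords]

lemma tailCoords_self (n : ℕ) : tailCoords n n = ∅ := by
  ext i; simp [tailCoords]

lemma insert_tailCoords {n : ℕ} (k : Fin n) :
    insert k (tailCoords n (k + 1)) = tailCoords n k := by
  ext i
  simp only [Finset.mem_insert, mem_tailCoords, Fin.ext_iff]
  omega

lemma prod_range_div_of_ne_zero {f : ℕ → ℝ} (hf : ∀ j, f j ≠ 0) (n : ℕ) :
    ∏ j ∈ Finset.range n, f (j + 1) / f j = f n / f 0 := by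
  induction n with
  | zero => simp [hf 0]
  | succ n ih =>
    have := hf n
    rw [Finset.prod_range_succ, ih]
    field_simp

lemma exists_knothe {n : ℕ} {F : (Fin n → ℝ) → ℝ} (hF : Continuous F) (hF0 : ∀ x, 0 ≤ F x)
    {L : ℝ} (hL : ∀ x i, L ≤ |x i| → F x = 0) {m : ℝ} (hm : ∀ x, margR F Finset.univ x = m)
    {g : Fin n → ℝ → ℝ} (hg : ∀ k, Continuous (g k))
    {δ : Fin n → ℝ} (hδ : ∀ k, 0 < δ k) (hgδ : ∀ k z, δ k ≤ g k z)
    {R : ℝ} (hR : 0 < R) :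
    ∃ Z μ : Fin n → (Fin n → ℝ) → ℝ,
      (∀ k, Measurable (Z k)) ∧ (∀ k, Measurable (μ k)) ∧ (∀ k x, 0 ≤ μ k x) ∧
      (∀ k j x t, j < k → Z j (Function.update x k t) = Z j x) ∧
      (∀ k x, (∀ t, F (Function.update x k t) = 0) ∨
        (∀ t, HasDerivAt (fun t => Z k (Function.update x k t)) (μ k (Function.update x k t)) t) ∧
        (∀ t, |Z k (Function.update x k t)| ≤ R) ∧
        Continuous fun t => μ k (Function.update x k t)) ∧
      (∀ x, F x ≠ 0 → (∏ k, μ k x * g k (Z k x)) = F x / m * ∏ k, ∫ z in (-R)..R, g k z) ∧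
      (∀ h : Fin n → ℝ → ℝ, (∀ k, Continuous (h k)) → (∀ k z, 0 ≤ h k z) →
        ∫⁻ x, ENNReal.ofReal (F x * ∏ k, h k (Z k x)) =
          ENNReal.ofReal (m * ∏ k, ((∫ z in (-R)..R, h k z * g k z) /
            ∫ z in (-R)..R, g k z))) := by
  have hgpos : ∀ k z, 0 < g k z := fun k z => (hδ k).trans_le (hgδ k z)
  choose q hq hqd hqi using fun k => exists_quantile (hg k) (hδ k) (hgδ k) (-R)
  set I : Fin n → ℝ := fun k => ∫ z in (-R)..R, g k z with hI
  have hIpos : ∀ k, 0 < I k := fun k => intervalIntegral.intervalIntegral_pos_of_pos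
    ((hg k).intervalIntegrable _ _) (hgpos k) (by linarith)
  set P : ℕ → (Fin n → ℝ) → ℝ := fun j => margR F (tailCoords n j) with hP
  have hPc : ∀ j, Continuous (P j) := fun j => continuous_margR hF hL
  have hP0 : ∀ j x, 0 ≤ P j x := fun j x => margR_nonneg hF0 x
  have hPpos : ∀ j x, F x ≠ 0 → 0 < P j x := fun j x hx => margR_pos hF hF0 hL hx
  have hPupd : ∀ j (k : Fin n) x t, j ≤ k.val → P j (Function.update x k t) = P j x :=
    fun j k x t hjk => margR_update F (mem_tailCoords.2 hjk) x t
  have hnot : ∀ k : Fin n, k ∉ tailCoords n (k + 1) := fun k => by simp [mem_tailCoords]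
  have hPint : ∀ (k : Fin n) x, ∫ t, P (k + 1) (Function.update x k t) = P k x := fun k x => by
    simp only [hP]
    rw [integral_margR_line hF hF0 hL (hnot k), insert_tailCoords]
  set Z : Fin n → (Fin n → ℝ) → ℝ := fun k x =>
    q k (I k / P k x * ∫ τ in (-L)..(x k), P (k + 1) (Function.update x k τ)) with hZ
  have hZm : ∀ k, Measurable (Z k) := fun k => by
    refine (hq k).monotone.measurable.comp (((hPc k).measurable.const_div _).mul
      (Continuous.measurable ?_))
    refine intervalIntegral.continuous_parametric_intervalIntegral_of_continuous
      (f := fun x τ => P (k + 1) (Function.update x k τ)) ?_ (continuous_apply k)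
    exact (hPc _).comp (continuous_fst.update k continuous_snd)
  set μ : Fin n → (Fin n → ℝ) → ℝ := fun k x => I k * P (k + 1) x / (P k x * g k (Z k x)) with hμ
  have hZline : ∀ k x t, Z k (Function.update x k t) =
      q k (I k / P k x * ∫ τ in (-L)..t, P (k + 1) (Function.update x k τ)) := fun k x t => by
    simp only [hZ, Function.update_self, Function.update_idem, hPupd k k x t le_rfl]
  have hline : ∀ (k : Fin n) x, 0 < P k x →
      (∀ t, HasDerivAt (fun t => Z k (Function.update x k t)) (μ k (Function.update x k t)) t) ∧
      (∀ t, |Z k (Function.update x k t)| ≤ R) ∧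
      ∀ h : ℝ → ℝ, Continuous h → ∫ t, h (Z k (Function.update x k t)) *
        P (k + 1) (Function.update x k t) = P k x / I k * ∫ z in (-R)..R, h z * g k z := by
    intro k x hx
    have := transport_line (L := L) (p := fun t => P (k + 1) (Function.update x k t)) hR (hg k)
      (hgpos k) (hq k) (hqd k) (hqi k)
      ((hPc _).comp (continuous_const.update k continuous_id)) (fun t => hP0 _ _)
      (fun t ht => margR_eq_zero hL (hnot k) (by simpa using ht))
      (margR_line_integrable hF hL (hnot k) x) (hPint k x) hx
    simp only [hμ, hZline, hPupd k k x _ le_rfl]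
    exact this
  have hdep : ∀ (k j : Fin n) x t, j < k → Z j (Function.update x k t) = Z j x := by
    intro k j x t hjk
    have hne : j ≠ k := hjk.ne
    simp only [hZ, Function.update_of_ne hne, hPupd j k x t (le_of_lt hjk)]
    congr 3
    ext τ
    rw [Function.update_comm hne.symm, hPupd _ _ _ _ (Nat.succ_le_of_lt hjk)]
  refine ⟨Z, μ, hZm, fun k => ?_, fun k x => ?_, hdep, fun k x => ?_,
    fun x hx => ?_, fun h hh hh0 => ?_⟩
  · exact ((hPc _).measurable.const_mul _).div
      ((hPc _).measurable.mul ((hg k).measurable.comp (hZm k)))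
  · exact div_nonneg (mul_nonneg (hIpos k).le (hP0 _ _)) (mul_nonneg (hP0 _ _) (hgpos _ _).le)
  · rcases (hP0 k x).eq_or_lt with h0 | hpos
    · left
      intro t
      by_contra hcon
      have := hPpos k _ hcon
      rw [hPupd k k x t le_rfl] at this
      exact this.ne h0
    · right
      obtain ⟨h1, h2, -⟩ := hline k x hpos
      refine ⟨h1, h2, ?_⟩
      have hc : Continuous fun t => Z k (Function.update x k t) :=
        continuous_iff_continuousAt.2 fun t => (h1 t).continuousAt
      have hu : Continuous fun t => Function.update x k t :=
        continuous_const.update k continuous_id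
      simp only [hμ, hPupd k k x _ le_rfl]
      exact (continuous_const.mul ((hPc _).comp hu)).div
        (continuous_const.mul ((hg k).comp hc)) fun t => (mul_pos hpos (hgpos _ _)).ne'
  · have h1 : ∀ k, μ k x * g k (Z k x) = P (k + 1) x / P k x * I k := fun k => by
      have := hgpos k (Z k x)
      have := hPpos k x hx
      simp only [hμ]
      field_simp
    rw [Finset.prod_congr rfl fun k _ => h1 k, Finset.prod_mul_distrib,
      Fin.prod_univ_eq_prod_range (fun j => P (j + 1) x / P j x) n,
      prod_range_div_of_ne_zero fun j => (hPpos j x hx).ne']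
    simp only [hP, tailCoords_zero, tailCoords_self, hm, margR_empty]
  · set A : Fin n → ℝ := fun k => (∫ z in (-R)..R, h k z * g k z) / I k with hA
    have hA0 : ∀ k, 0 ≤ A k := fun k => div_nonneg
      (intervalIntegral.integral_nonneg (by linarith) fun z _ =>
        mul_nonneg (hh0 k z) (hgpos k z).le) (hIpos k).le
    have hmeas : Measurable fun x => ENNReal.ofReal (F x * ∏ k, h k (Z k x)) :=
      (hF.measurable.mul (Finset.measurable_prod _ fun k _ =>
        (hh k).measurable.comp (hZm k))).ennreal_ofReal
    have key : ∀ i ≤ n, ∀ x, lmarginal (fun _ => volume) (tailCoords n (n - i))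
        (fun x => ENNReal.ofReal (F x * ∏ k, h k (Z k x))) x =
        ENNReal.ofReal (P (n - i) x * ∏ k : Fin n, if k.val < n - i then h k (Z k x) else A k) := by
      intro i
      induction i with
      | zero =>
        intro _ x
        simp [tailCoords_self, hP, margR_empty]
      | succ i ih =>
        intro hi x
        obtain ⟨k, hk⟩ : ∃ k : Fin n, k.val = n - (i + 1) := ⟨⟨n - (i + 1), by omega⟩, rfl⟩
        have hk' : n - i = k + 1 := by omega
        rw [← hk, ← insert_tailCoords, lmarginal_insert _ hmeas (hnot k)]
        simp_rw [← hk', ih (by omega)]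
        set C : ℝ := ∏ j ∈ Finset.univ.erase k, if j.val < k.val then h j (Z j x) else A j with hC
        have hC0 : 0 ≤ C := Finset.prod_nonneg fun j _ => by
          split_ifs
          exacts [hh0 _ _, hA0 _]
        have e1 : (∏ j : Fin n, if j.val < k.val then h j (Z j x) else A j) = A k * C := by
          rw [← Finset.mul_prod_erase _ _ (Finset.mem_univ k)]
          simp [hC]
        have e2 : ∀ t, P (n - i) (Function.update x k t) *
            (∏ j : Fin n, if j.val < n - i then h j (Z j (Function.update x k t)) else A j) =
            C * (h k (Z k (Function.update x k t)) * P (k + 1) (Function.update x k t)) := by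
          intro t
          rw [← Finset.mul_prod_erase _ _ (Finset.mem_univ k), hk', if_pos (Nat.lt_succ_self _)]
          have : (∏ j ∈ Finset.univ.erase k, if j.val < k.val + 1 then
              h j (Z j (Function.update x k t)) else A j) = C := by
            refine Finset.prod_congr rfl fun j hj => ?_
            have hne : j.val ≠ k.val := fun h => (Finset.ne_of_mem_erase hj) (Fin.ext h)
            by_cases hjk : j.val < k.val
            · rw [if_pos hjk, if_pos (by omega), hdep k j x t hjk]
            · rw [if_neg hjk, if_neg (by omega)]
          rw [this]
          ring
        simp_rw [e2, e1]
        have hnn : ∀ t, 0 ≤ C * (h k (Z k (Function.update x k t)) *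
            P (k + 1) (Function.update x k t)) := fun t =>
          mul_nonneg hC0 (mul_nonneg (hh0 _ _) (hP0 _ _))
        have hu : Continuous fun t => Function.update x k t :=
          continuous_const.update k continuous_id
        have hPcs : HasCompactSupport fun t => P (k + 1) (Function.update x k t) := by
          refine HasCompactSupport.intro (isCompact_Icc (a := -L) (b := L)) fun t ht => ?_
          refine margR_eq_zero hL (hnot k) ?_
          rw [Function.update_self]
          by_contra! hcon
          exact ht (abs_le.1 hcon.le)
        rcases (hP0 k x).eq_or_lt with h0 | hpos
        · have hz : ∀ t, P (k + 1) (Function.update x k t) = 0 := by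
            by_contra! hcon
            obtain ⟨t, ht⟩ := hcon
            have := ((hPc _).comp hu).integral_pos_of_hasCompactSupport_nonneg_nonzero
              (μ := volume) hPcs (fun _ => hP0 _ _) ht
            exact this.ne (h0.trans (hPint k x).symm)
          simp [hz, ← h0]
        · obtain ⟨h1, -, h3⟩ := hline k x hpos
          have hc : Continuous fun t => Z k (Function.update x k t) :=
            continuous_iff_continuousAt.2 fun t => (h1 t).continuousAt
          rw [← ofReal_integral_eq_lintegral_ofReal _ (Filter.Eventually.of_forall hnn),
            integral_const_mul, h3 _ (hh k)]
          · congr 1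
            simp only [hA]
            ring
          · exact (((((hh k).comp hc).mul ((hPc _).comp hu))).integrable_of_hasCompactSupport
              hPcs.mul_left).const_mul _
    have := key n le_rfl 0
    simp only [Nat.sub_self, tailCoords_zero, lmarginal_univ, hP, hm, not_lt_zero, if_false] at this
    exact this
lemma sum_prod_lt_mul_sq {n : ℕ} (z : Fin n → ℝ) :
    ∑ k, (√(∏ j ∈ Finset.Iio k, (1 + z j ^ 2)) * z k) ^ 2 = (∏ k, (1 + z k ^ 2)) - 1 := by
  have h := Finset.prod_add_ordered Finset.univ (fun _ : Fin n => (1 : ℝ)) (fun k => z k ^ 2)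
  simp only [Finset.prod_const_one, mul_one] at h
  rw [h, add_sub_cancel_left]
  refine Finset.sum_congr rfl fun k _ => ?_
  rw [mul_pow, Real.sq_sqrt (Finset.prod_nonneg fun j _ => by positivity), mul_comm]
  congr 2
  ext j; simp

lemma prod_sqrt_prod_lt_mul_rpow {n : ℕ} {a : Fin n → ℝ} (ha : ∀ k, 0 < a k) :
    ∏ k : Fin n, √(∏ j ∈ Finset.Iio k, a j) * a k ^ (((n : ℝ) + k + 1) / 2) =
      (∏ k, a k) ^ n := by
  have hpos : 0 < ∏ k, a k := Finset.prod_pos fun k _ => ha k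
  rw [← sq_eq_sq₀ (Finset.prod_nonneg fun k _ => mul_nonneg (Real.sqrt_nonneg _)
    (Real.rpow_nonneg (ha k).le _)) (by positivity), ← Finset.prod_pow]
  have h1 : ∀ k : Fin n, (√(∏ j ∈ Finset.Iio k, a j) * a k ^ (((n : ℝ) + k + 1) / 2)) ^ 2 =
      (∏ j ∈ Finset.Iio k, a j) * a k ^ (n + k + 1) := fun k => by
    rw [mul_pow, Real.sq_sqrt (Finset.prod_nonneg fun j _ => (ha j).le), ← Real.rpow_natCast,
      ← Real.rpow_mul (ha k).le, ← Real.rpow_natCast]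
    congr 2
    push_cast
    ring
  rw [Finset.prod_congr rfl fun k _ => h1 k, Finset.prod_mul_distrib]
  have h2 : ∏ k : Fin n, ∏ j ∈ Finset.Iio k, a j = ∏ j : Fin n, a j ^ (n - 1 - j) := by
    rw [Finset.prod_comm' (t' := Finset.univ) (s' := fun j => Finset.Ioi j) (by simp)]
    refine Finset.prod_congr rfl fun j _ => ?_
    rw [Finset.prod_const, Fin.card_Ioi]
  rw [h2, ← Finset.prod_mul_distrib, ← pow_mul, ← Finset.prod_pow]
  refine Finset.prod_congr rfl fun j _ => ?_
  rw [← pow_add]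
  congr 1
  have := j.isLt
  omega

lemma card_mul_rpow_prod_le_sum {n : ℕ} (hn : 0 < n) {l : Fin n → ℝ} (hl : ∀ k, 0 ≤ l k) :
    n * (∏ k, l k) ^ (1 / (n : ℝ)) ≤ ∑ k, l k := by
  have hn' : (0 : ℝ) < n := by exact_mod_cast hn
  have h := Real.geom_mean_le_arith_mean_weighted Finset.univ (fun _ => 1 / (n : ℝ)) l
    (fun _ _ => by positivity) (by simp [hn'.ne']) (fun k _ => hl k)
  rw [Real.finsetProd_rpow _ _ (fun k _ => hl k), ← Finset.mul_sum] at h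
  calc n * (∏ k, l k) ^ (1 / (n : ℝ)) ≤ n * (1 / n * ∑ k, l k) := by gcongr
    _ = _ := by field_simp

/-- Integration by parts on a line followed by Young's inequality. -/
lemma line_estimate {φ φ' T T' B : ℝ → ℝ} {L : ℝ} (hφ : ∀ t, HasDerivAt φ (φ' t) t)
    (hφ'c : Continuous φ') (hφ0 : ∀ t, 0 ≤ φ t)
    (hT : ∀ t, HasDerivAt T (T' t) t) (hT'c : Continuous T') (hT'0 : ∀ t, 0 ≤ T' t)
    (hL : ∀ t, L ≤ |t| → φ t = 0) (hL' : ∀ t, L ≤ |t| → φ' t = 0)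
    (hB : ∀ t, |φ' t * T t| ≤ B t) :
    ∫⁻ t, ENNReal.ofReal (φ t * T' t) ≤ ∫⁻ t, ENNReal.ofReal (B t) := by
  have hφc : Continuous φ := continuous_iff_continuousAt.2 fun t => (hφ t).continuousAt
  have hTc : Continuous T := continuous_iff_continuousAt.2 fun t => (hT t).continuousAt
  have hcs : ∀ f : ℝ → ℝ, (∀ t, L ≤ |t| → f t = 0) → HasCompactSupport f := fun f hf =>
    HasCompactSupport.intro (isCompact_Icc (a := -L) (b := L)) fun t ht => hf t <| by
      by_contra! hcon
      exact ht (abs_le.1 hcon.le)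
  have i1 : Integrable (φ * T') :=
    (hφc.mul hT'c).integrable_of_hasCompactSupport (hcs _ fun t ht => by simp [hL t ht])
  have i2 : Integrable (φ' * T) :=
    (hφ'c.mul hTc).integrable_of_hasCompactSupport (hcs _ fun t ht => by simp [hL' t ht])
  have i3 : Integrable (φ * T) :=
    (hφc.mul hTc).integrable_of_hasCompactSupport (hcs _ fun t ht => by simp [hL t ht])
  have hibp := integral_mul_deriv_eq_deriv_mul_of_integrable (fun t _ => hφ t) (fun t _ => hT t) i1 i2 i3
  have h1 : ∫⁻ t, ENNReal.ofReal (φ t * T' t) = ENNReal.ofReal (∫ t, φ t * T' t) :=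
    (ofReal_integral_eq_lintegral_ofReal i1
      (Filter.Eventually.of_forall fun t => mul_nonneg (hφ0 t) (hT'0 t))).symm
  rw [h1, hibp]
  calc ENNReal.ofReal (-∫ t, φ' t * T t)
      ≤ ENNReal.ofReal (∫ t, |φ' t * T t|) := by
        refine ENNReal.ofReal_le_ofReal ((neg_le_abs _).trans ?_)
        exact abs_integral_le_integral_abs
    _ = ∫⁻ t, ENNReal.ofReal |φ' t * T t| :=
        ofReal_integral_eq_lintegral_ofReal i2.abs
          (Filter.Eventually.of_forall fun t => abs_nonneg _)
    _ ≤ _ := lintegral_mono fun t => ENNReal.ofReal_le_ofReal (hB t)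

/-- The mass `∫_{-R}^R (1 + z²)^(-s) dz`. -/
noncomputable def japaneseMass (s R : ℝ) : ℝ := ∫ z in (-R)..R, (1 + z ^ 2) ^ (-s)

lemma continuous_one_add_sq_rpow (s : ℝ) : Continuous fun z : ℝ => (1 + z ^ 2) ^ s :=
  Continuous.rpow_const (by fun_prop) fun z => Or.inl (by positivity)

lemma japaneseMass_pos (s : ℝ) {R : ℝ} (hR : 0 < R) : 0 < japaneseMass s R :=
  intervalIntegral.intervalIntegral_pos_of_pos
    ((continuous_one_add_sq_rpow _).intervalIntegrable _ _) (fun z => by positivity) (by linarith)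

/-- The sharp Sobolev inequality with a truncated extremal profile. -/
lemma sobolev_truncated {n : ℕ} (hn : 3 ≤ n) {w : (Fin n → ℝ) → ℝ} (hw : Continuous w)
    {w' : Fin n → (Fin n → ℝ) → ℝ} (hw'c : ∀ k, Continuous (w' k))
    (hw' : ∀ k x t, HasDerivAt (fun t => w (Function.update x k t))
      (w' k (Function.update x k t)) t)
    {L : ℝ} (hL : ∀ x i, L ≤ |x i| → w x = 0) {R : ℝ} (hR : 0 < R) {m d : ℝ}
    (hm : ∫⁻ x, ENNReal.ofReal (|w x| ^ (2 * (n : ℝ) / (n - 2))) = ENNReal.ofReal m)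
    (hm0 : 0 < m)
    (hd : ∫⁻ x, ENNReal.ofReal (∑ k, w' k x ^ 2) = ENNReal.ofReal d) (hd0 : 0 ≤ d) :
    ((n : ℝ) - 2) ^ 2 / (n - 1) *
      ((∏ k : Fin n, japaneseMass (((n : ℝ) + k + 1) / 2) R) / m) ^ (2 / (n : ℝ)) * m *
      ((∏ k : Fin n, japaneseMass (((n : ℝ) + k + 1) / 2 - 1) R /
        japaneseMass (((n : ℝ) + k + 1) / 2) R) + n - 1) ≤ d := by
  have hn0 : (3 : ℝ) ≤ n := by exact_mod_cast hn
  have hn2 : (0 : ℝ) < n - 2 := by linarith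
  set p : ℝ := 2 * (n : ℝ) / (n - 2) with hp
  set q : ℝ := 2 * ((n : ℝ) - 1) / (n - 2) with hq
  have hq2 : 2 < q := by rw [hq, lt_div_iff₀ hn2]; linarith
  have hp0 : 0 < p := by rw [hp]; positivity
  have hqp : 2 * (q - 1) = p := by rw [hp, hq]; field_simp; ring
  have hqp' : q + p * (1 / n) = p := by rw [hp, hq]; field_simp; ring
  set F : (Fin n → ℝ) → ℝ := fun x => |w x| ^ p with hFdef
  have hF : Continuous F := hw.abs.rpow_const fun x => Or.inr hp0.le
  have hF0 : ∀ x, 0 ≤ F x := fun x => by positivity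
  have hFz : ∀ x, F x = 0 ↔ w x = 0 := fun x => by
    simp [hFdef, Real.rpow_eq_zero_iff_of_nonneg (abs_nonneg _), hp0.ne']
  have hFL : ∀ x i, L ≤ |x i| → F x = 0 := fun x i h => (hFz x).2 (hL x i h)
  have hFm : ∀ x, margR F Finset.univ x = m := fun x => by
    rw [← ENNReal.ofReal_eq_ofReal_iff (margR_nonneg hF0 x) hm0.le, margR_univ hF hF0 hFL, hm]
  set s : Fin n → ℝ := fun k => ((n : ℝ) + k + 1) / 2 with hs
  have hs0 : ∀ k, 0 ≤ s k := fun k => by simp only [hs]; positivity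
  set g : Fin n → ℝ → ℝ := fun k z => (1 + min (z ^ 2) (R ^ 2)) ^ (-s k) with hg
  have hmin : ∀ z : ℝ, 0 ≤ min (z ^ 2) (R ^ 2) := fun z => by positivity
  have hgc : ∀ k, Continuous (g k) := fun k =>
    Continuous.rpow_const (by fun_prop) fun z => Or.inl (by linarith [hmin z])
  have hgδ : ∀ k z, (1 + R ^ 2) ^ (-s k) ≤ g k z := fun k z => by
    refine Real.rpow_le_rpow_of_nonpos (by linarith [hmin z]) ?_ (by linarith [hs0 k])
    gcongr
    exact min_le_right _ _
  have hgR : ∀ k z, |z| ≤ R → g k z = (1 + z ^ 2) ^ (-s k) := fun k z hz => by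
    simp only [hg]
    rw [min_eq_left]
    exact sq_le_sq' (abs_le.1 hz).1 (abs_le.1 hz).2
  have hgI : ∀ k, ∫ z in (-R)..R, g k z = japaneseMass (s k) R := fun k => by
    refine intervalIntegral.integral_congr fun z hz => hgR k z ?_
    rw [Set.uIcc_of_le (by linarith)] at hz
    exact abs_le.2 hz
  have hgJ : ∀ k, ∫ z in (-R)..R, (1 + z ^ 2) * g k z = japaneseMass (s k - 1) R := fun k => by
    refine intervalIntegral.integral_congr fun z hz => ?_
    rw [Set.uIcc_of_le (by linarith)] at hz
    have h1 : (0 : ℝ) < 1 + z ^ 2 := by positivity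
    change (1 + z ^ 2) * g k z = _
    rw [hgR k z (abs_le.2 hz), ← Real.rpow_one_add' h1.le]
    · congr 1; ring
    · have : (3 : ℝ) / 2 < s k := by
        simp only [hs]; linarith [(Nat.cast_nonneg k.val : (0 : ℝ) ≤ k.val)]
      linarith
  obtain ⟨Z, μ, hZm, hμm, hμ0, hdep, hline, hjac, hpush⟩ :=
    exists_knothe hF hF0 hFL hFm hgc (δ := fun k => (1 + R ^ 2) ^ (-s k))
      (fun k => by positivity) hgδ hR
  set PI : ℝ := ∏ k, japaneseMass (s k) R with hPI
  have hPIpos : 0 < PI := Finset.prod_pos fun k _ => japaneseMass_pos _ hR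
  set W : (Fin n → ℝ) → ℝ := fun x => ∏ k, (1 + Z k x ^ 2) with hW
  have hW1 : ∀ x, 1 ≤ W x := fun x =>
    Finset.one_le_prod fun k _ => by nlinarith [sq_nonneg (Z k x)]
  set A : ℝ := ∏ k, japaneseMass (s k - 1) R / japaneseMass (s k) R with hA
  have hE : ∫⁻ x, ENNReal.ofReal (F x * W x) = ENNReal.ofReal (m * A) := by
    have := hpush (fun _ z => 1 + z ^ 2) (fun k => by fun_prop) (fun k z => by positivity)
    simp only [hgI, hgJ] at this
    exact this
  set ρ : Fin n → (Fin n → ℝ) → ℝ := fun k x => √(∏ j ∈ Finset.Iio k, (1 + Z j x ^ 2)) with hρ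
  set K : ℝ := (PI / m) ^ (1 / (n : ℝ)) with hK
  have hKpos : 0 < K := by positivity
  set β : ℝ := q / (2 * (n - 1) * K) with hβ
  have hβpos : 0 < β := by
    have : (0 : ℝ) < n - 1 := by linarith
    positivity
  set B : Fin n → (Fin n → ℝ) → ℝ := fun k x =>
    q * (β * w' k x ^ 2 / 2 + F x * (ρ k x * Z k x) ^ 2 / (2 * β)) with hB
  have hB0 : ∀ k x, 0 ≤ B k x := fun k x => by
    have := hF0 x
    simp only [hB]; positivity
  have hρm : ∀ k, Measurable (ρ k) := fun k =>
    (Finset.measurable_prod _ fun j _ => ((hZm j).pow_const 2).const_add 1).sqrt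
  have hBm : ∀ k, Measurable (B k) := fun k => by
    have h1 := hρm k
    have h2 := hZm k
    have h3 := (hw'c k).measurable
    have h4 := hF.measurable
    fun_prop
  have hφm : ∀ k, Measurable fun x => |w x| ^ q * (ρ k x * μ k x) := fun k =>
    (hw.abs.rpow_const fun x => Or.inr (by linarith)).measurable.mul ((hρm k).mul (hμm k))
  have hφ0 : ∀ k x, 0 ≤ |w x| ^ q * (ρ k x * μ k x) := fun k x =>
    mul_nonneg (by positivity) (mul_nonneg (Real.sqrt_nonneg _) (hμ0 k x))
  have hdir : ∀ k, ∫⁻ x, ENNReal.ofReal (|w x| ^ q * (ρ k x * μ k x)) ≤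
      ∫⁻ x, ENNReal.ofReal (B k x) := fun k => by
    refine lintegral_le_of_lmarginal_le {k} (hφm k).ennreal_ofReal (hBm k).ennreal_ofReal ?_
    intro x
    rw [lmarginal_singleton, lmarginal_singleton]
    rcases hline k x with h0 | ⟨h1, -, h3⟩
    · have : ∀ t, |w (Function.update x k t)| ^ q = 0 := fun t => by
        rw [(hFz _).1 (h0 t), abs_zero, Real.zero_rpow (by linarith)]
      simp [this]
    have hρu : ∀ t, ρ k (Function.update x k t) = ρ k x := fun t => by
      simp only [hρ]
      congr 1
      exact Finset.prod_congr rfl fun j hj => by rw [hdep k j x t (Finset.mem_Iio.1 hj)]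
    have hu : Continuous fun t => Function.update x k t :=
      continuous_const.update k continuous_id
    have hwL : ∀ t, L ≤ |t| → w (Function.update x k t) = 0 := fun t ht =>
      hL _ k (by simpa using ht)
    refine line_estimate (L := L) (φ := fun t => |w (Function.update x k t)| ^ q)
      (φ' := fun t => q * |w (Function.update x k t)| ^ (q - 2) * w (Function.update x k t) *
        w' k (Function.update x k t))
      (T := fun t => ρ k (Function.update x k t) * Z k (Function.update x k t))
      (fun t => (hasDerivAt_abs_rpow _ (by linarith)).comp t (hw' k x t)) ?_
      (fun t => by positivity) (fun t => ?_) ?_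
      (fun t => mul_nonneg (Real.sqrt_nonneg _) (hμ0 k _)) (fun t ht => ?_) (fun t ht => ?_)
      (fun t => ?_)
    · have := (hw.comp hu).abs.rpow_const (p := q - 2) fun x => Or.inr (by linarith)
      exact ((continuous_const.mul this).mul (hw.comp hu)).mul ((hw'c k).comp hu)
    · simp only [hρu]
      exact (h1 t).const_mul _
    · simp only [hρu]
      exact continuous_const.mul h3
    · simp only [hwL t ht, abs_zero]
      exact Real.zero_rpow (by linarith)
    · simp only [hwL t ht, mul_zero, zero_mul]
    · simp only [hB]
      generalize Function.update x k t = y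
      have e1 : |w y| ^ (q - 2) * |w y| = |w y| ^ (q - 1) := by
        rw [← Real.rpow_add_one' (abs_nonneg _) (by linarith)]; congr 1; ring
      have e2 : F y = (|w y| ^ (q - 1)) ^ 2 := by
        rw [← Real.rpow_natCast, ← Real.rpow_mul (abs_nonneg _)]
        simp only [hFdef]; congr 1; push_cast; linarith
      have e3 : |q * |w y| ^ (q - 2) * w y * w' k y * (ρ k y * Z k y)| =
          q * (|w' k y| * (|w y| ^ (q - 1) * |ρ k y * Z k y|)) := by
        rw [← e1, abs_mul, abs_mul, abs_mul, abs_mul, abs_of_pos (by linarith : 0 < q),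
          abs_of_nonneg (by positivity : 0 ≤ |w y| ^ (q - 2))]
        ring
      rw [e3, e2, ← sq_abs (w' k y), ← sq_abs (ρ k y * Z k y), ← mul_pow]
      gcongr
      generalize |w' k y| = a
      generalize |w y| ^ (q - 1) * |ρ k y * Z k y| = b
      have : β * a ^ 2 / 2 + b ^ 2 / (2 * β) - a * b = (β * a - b) ^ 2 / (2 * β) := by
        field_simp; ring
      have h2 : 0 ≤ (β * a - b) ^ 2 / (2 * β) := by positivity
      linarith
  have hpt : ∀ x, n * K * (F x * W x) ≤ ∑ k, |w x| ^ q * (ρ k x * μ k x) := fun x => by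
    by_cases hx : F x = 0
    · rw [hx, zero_mul, mul_zero]
      exact Finset.sum_nonneg fun k _ => hφ0 k x
    have hZR : ∀ k, |Z k x| ≤ R := fun k => by
      rcases hline k x with h0 | ⟨-, h2, -⟩
      · exact absurd (by simpa using h0 (x k)) hx
      · simpa using h2 (x k)
    have hprod : ∏ k, ρ k x * μ k x = F x * (PI / m) * W x ^ n := by
      have h1 := hjac x hx
      simp only [hgI] at h1
      have h2 := prod_sqrt_prod_lt_mul_rpow (a := fun k => 1 + Z k x ^ 2) fun k => by positivity
      rw [hW, ← h2, mul_div_assoc', mul_div_right_comm, ← h1, ← Finset.prod_mul_distrib]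
      refine Finset.prod_congr rfl fun k _ => ?_
      have h3 : (0 : ℝ) < 1 + Z k x ^ 2 := by positivity
      rw [hgR k _ (hZR k), Real.rpow_neg h3.le]
      have : 0 < (1 + Z k x ^ 2) ^ s k := by positivity
      simp only [hρ, hs] at this ⊢
      field_simp
    have hag := card_mul_rpow_prod_le_sum (by omega : 0 < n)
      (l := fun k => ρ k x * μ k x) fun k => mul_nonneg (Real.sqrt_nonneg _) (hμ0 k x)
    have hW0 : 0 ≤ W x := by linarith [hW1 x]
    rw [hprod, Real.mul_rpow (mul_nonneg (hF0 x) (by positivity)) (by positivity),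
      Real.mul_rpow (hF0 x) (by positivity), one_div, Real.pow_rpow_inv_natCast hW0 (by omega),
      ← one_div] at hag
    rw [← Finset.mul_sum]
    refine le_trans (le_of_eq ?_) (mul_le_mul_of_nonneg_left hag (by positivity))
    have hFq : F x = |w x| ^ q * F x ^ (1 / (n : ℝ)) := by
      simp only [hFdef]
      rw [← Real.rpow_mul (abs_nonneg _), ← Real.rpow_add' (abs_nonneg _), hqp']
      rw [hqp']; exact hp0.ne'
    rw [← hK]
    nth_rw 1 [hFq]
    ring
  have hWm : Measurable W := Finset.measurable_prod _ fun k _ => ((hZm k).pow_const 2).const_add 1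
  have hFW1 : (∫⁻ x, ENNReal.ofReal (F x * (W x - 1))) + ENNReal.ofReal m =
      ENNReal.ofReal (m * A) := by
    rw [← hE, ← hm, ← lintegral_add_right _ hF.measurable.ennreal_ofReal]
    refine lintegral_congr fun x => ?_
    rw [← ENNReal.ofReal_add (mul_nonneg (hF0 x) (by linarith [hW1 x])) (hF0 x)]
    congr 1; ring
  have hsum : ENNReal.ofReal (n * K) * ENNReal.ofReal (m * A) ≤
      ENNReal.ofReal (q * β / 2) * ENNReal.ofReal d +
      ENNReal.ofReal (q / (2 * β)) * ∫⁻ x, ENNReal.ofReal (F x * (W x - 1)) := by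
    have hFWm : Measurable fun x => F x * W x := hF.measurable.mul hWm
    have hFWm' : Measurable fun x => F x * (W x - 1) := hF.measurable.mul (hWm.sub_const 1)
    have hdm : Measurable fun x => ∑ k, w' k x ^ 2 :=
      Finset.measurable_sum _ fun k _ => (hw'c k).measurable.pow_const 2
    rw [← hE, ← hd, ← lintegral_const_mul _ hFWm.ennreal_ofReal,
      ← lintegral_const_mul _ hFWm'.ennreal_ofReal, ← lintegral_const_mul _ hdm.ennreal_ofReal,
      ← lintegral_add_left (hdm.ennreal_ofReal.const_mul _)]
    calc ∫⁻ x, ENNReal.ofReal (n * K) * ENNReal.ofReal (F x * W x)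
        ≤ ∫⁻ x, ∑ k, ENNReal.ofReal (|w x| ^ q * (ρ k x * μ k x)) := by
          refine lintegral_mono fun x => ?_
          rw [← ENNReal.ofReal_mul (by positivity), ← ENNReal.ofReal_sum_of_nonneg
            fun k _ => hφ0 k x]
          exact ENNReal.ofReal_le_ofReal (hpt x)
      _ = ∑ k, ∫⁻ x, ENNReal.ofReal (|w x| ^ q * (ρ k x * μ k x)) :=
          lintegral_finsetSum _ fun k _ => (hφm k).ennreal_ofReal
      _ ≤ ∑ k, ∫⁻ x, ENNReal.ofReal (B k x) := Finset.sum_le_sum fun k _ => hdir k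
      _ = ∫⁻ x, ∑ k, ENNReal.ofReal (B k x) :=
          (lintegral_finsetSum _ fun k _ => (hBm k).ennreal_ofReal).symm
      _ = _ := by
          refine lintegral_congr fun x => ?_
          rw [← ENNReal.ofReal_sum_of_nonneg fun k _ => hB0 k x,
            ← ENNReal.ofReal_mul (by positivity), ← ENNReal.ofReal_mul (by positivity),
            ← ENNReal.ofReal_add
              (mul_nonneg (by positivity) (Finset.sum_nonneg fun k _ => sq_nonneg _))
              (mul_nonneg (by positivity) (mul_nonneg (hF0 x) (by linarith [hW1 x])))]
          congr 1
          simp only [hB]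
          rw [← Finset.mul_sum, Finset.sum_add_distrib, ← Finset.sum_div, ← Finset.mul_sum,
            ← Finset.sum_div, ← Finset.mul_sum, sum_prod_lt_mul_sq fun k => Z k x]
          ring
  have hA0 : 0 ≤ A := Finset.prod_nonneg fun k _ =>
    div_nonneg (japaneseMass_pos _ hR).le (japaneseMass_pos _ hR).le
  have hmA : m ≤ m * A := by
    rw [← ENNReal.ofReal_le_ofReal_iff (by positivity), ← hFW1]
    exact le_add_self
  have hX : ∫⁻ x, ENNReal.ofReal (F x * (W x - 1)) = ENNReal.ofReal (m * A - m) := by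
    rw [ENNReal.ofReal_sub _ hm0.le, ← hFW1, ENNReal.add_sub_cancel_right ENNReal.ofReal_ne_top]
  have hn1 : (0 : ℝ) < n - 1 := by linarith
  have hfin : n * K * (m * A) ≤ q * β / 2 * d + q / (2 * β) * (m * A - m) := by
    rw [hX, ← ENNReal.ofReal_mul (by positivity), ← ENNReal.ofReal_mul (by positivity),
      ← ENNReal.ofReal_mul (by positivity), ← ENNReal.ofReal_add (by positivity)
        (mul_nonneg (by positivity) (by linarith)), ENNReal.ofReal_le_ofReal_iff] at hsum
    · exact hsum
    · exact add_nonneg (by positivity) (mul_nonneg (by positivity) (by linarith))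
  have hq0 : 0 < q := by linarith
  have e1 : q / (2 * β) = (n - 1) * K := by rw [hβ]; field_simp
  have e2 : q * β / 2 = (n - 1) / ((n - 2) ^ 2 * K) := by
    rw [hβ, hq]; field_simp
  have e3 : (PI / m) ^ (2 / (n : ℝ)) = K ^ 2 := by
    rw [hK, ← Real.rpow_natCast, ← Real.rpow_mul (by positivity)]
    congr 1; push_cast; ring
  rw [e1, e2] at hfin
  rw [e3]
  have h4 : K * (m * (A + n - 1)) ≤ (n - 1) / ((n - 2) ^ 2 * K) * d := by linarith
  calc ((n : ℝ) - 2) ^ 2 / (n - 1) * K ^ 2 * m * (A + n - 1)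
      = (n - 2) ^ 2 * K / (n - 1) * (K * (m * (A + n - 1))) := by ring
    _ ≤ (n - 2) ^ 2 * K / (n - 1) * ((n - 1) / ((n - 2) ^ 2 * K) * d) := by gcongr
    _ = d := by
        have h1 : K ≠ 0 := hKpos.ne'
        have h2 : (n : ℝ) - 1 ≠ 0 := hn1.ne'
        have h3 : (n : ℝ) - 2 ≠ 0 := hn2.ne'
        clear_value K
        generalize (n : ℝ) - 1 = b at h2 ⊢
        generalize (n : ℝ) - 2 = c at h3 ⊢
        field_simp

lemma lintegral_one_add_sq_rpow {s : ℝ} (hs : 1 / 2 < s) :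
    ∫⁻ z : ℝ, ENNReal.ofReal ((1 + z ^ 2) ^ (-s)) =
      ENNReal.ofReal (√π * Gamma (s - 1 / 2) / Gamma s) := by
  have hs0 : 0 < s := by linarith
  have hΓ : 0 < Gamma s := Gamma_pos_of_pos hs0
  have hΓ' : 0 < Gamma (s - 1 / 2) := Gamma_pos_of_pos (by linarith)
  have hint : ∀ a r : ℝ, 0 < a → 0 < r →
      ∫⁻ t in Set.Ioi (0 : ℝ), ENNReal.ofReal (t ^ (a - 1) * exp (-(r * t))) =
        ENNReal.ofReal ((1 / r) ^ a * Gamma a) := fun a r ha hr => by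
    have h := integral_rpow_mul_exp_neg_mul_Ioi ha hr
    rw [← h, ofReal_integral_eq_lintegral_ofReal]
    · by_contra hc
      rw [integral_undef hc] at h
      have := Gamma_pos_of_pos ha
      have : 0 < (1 / r) ^ a * Gamma a := by positivity
      linarith
    · refine (ae_restrict_iff' measurableSet_Ioi).2 (ae_of_all _ fun t ht => ?_)
      have : (0 : ℝ) < t := ht
      simp only [Pi.zero_apply]; positivity
  have hgauss : ∀ t : ℝ, 0 < t →
      ∫⁻ z : ℝ, ENNReal.ofReal (exp (-t * z ^ 2)) = ENNReal.ofReal (√(π / t)) := fun t ht => by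
    rw [← integral_gaussian, ofReal_integral_eq_lintegral_ofReal (integrable_exp_neg_mul_sq ht)]
    exact ae_of_all _ fun z => (exp_pos _).le
  have key : ENNReal.ofReal (Gamma s) * ∫⁻ z : ℝ, ENNReal.ofReal ((1 + z ^ 2) ^ (-s)) =
      ENNReal.ofReal (√π * Gamma (s - 1 / 2)) := by
    calc _ = ∫⁻ z : ℝ, ∫⁻ t in Set.Ioi (0 : ℝ),
          ENNReal.ofReal (t ^ (s - 1) * exp (-((1 + z ^ 2) * t))) := by
          rw [← lintegral_const_mul _ (by fun_prop)]
          refine lintegral_congr fun z => ?_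
          have hz : (0 : ℝ) < 1 + z ^ 2 := by positivity
          rw [hint s _ hs0 hz, ← ENNReal.ofReal_mul hΓ.le, one_div, Real.inv_rpow hz.le,
            Real.rpow_neg hz.le, mul_comm]
      _ = ∫⁻ t in Set.Ioi (0 : ℝ), ∫⁻ z : ℝ,
          ENNReal.ofReal (t ^ (s - 1) * exp (-((1 + z ^ 2) * t))) :=
          lintegral_lintegral_swap (by fun_prop)
      _ = ∫⁻ t in Set.Ioi (0 : ℝ), ENNReal.ofReal √π *
          ENNReal.ofReal (t ^ (s - 1 / 2 - 1) * exp (-(1 * t))) := by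
          refine setLIntegral_congr_fun measurableSet_Ioi fun t ht => ?_
          have ht : (0 : ℝ) < t := ht
          have e : ∀ z : ℝ, ENNReal.ofReal (t ^ (s - 1) * exp (-((1 + z ^ 2) * t))) =
              ENNReal.ofReal (t ^ (s - 1) * exp (-t)) * ENNReal.ofReal (exp (-t * z ^ 2)) :=
            fun z => by
              rw [← ENNReal.ofReal_mul (by positivity), mul_assoc, ← exp_add]
              congr 3; ring
          simp only [e]
          rw [lintegral_const_mul _ (by fun_prop), hgauss t ht,
            ← ENNReal.ofReal_mul (by positivity), ← ENNReal.ofReal_mul (by positivity)]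
          congr 1
          rw [Real.sqrt_div pi_pos.le, show s - 1 / 2 - 1 = (s - 1) - 1 / 2 by ring,
            Real.rpow_sub ht (s - 1), ← Real.sqrt_eq_rpow, one_mul]
          ring
      _ = _ := by
          rw [lintegral_const_mul _ (by fun_prop), hint _ 1 (by linarith) one_pos,
            ← ENNReal.ofReal_mul (by positivity)]
          simp
  have h0 : ENNReal.ofReal (Gamma s) ≠ 0 := by simpa using hΓ
  rw [ENNReal.ofReal_div_of_pos hΓ, ← key, mul_comm,
    ENNReal.mul_div_cancel_right h0 ENNReal.ofReal_ne_top]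

lemma tendsto_japaneseMass {s : ℝ} (hs : 1 / 2 < s) :
    Filter.Tendsto (japaneseMass s) Filter.atTop (nhds (√π * Gamma (s - 1 / 2) / Gamma s)) := by
  have hΓ : 0 < Gamma s := Gamma_pos_of_pos (by linarith)
  have hΓ' : 0 < Gamma (s - 1 / 2) := Gamma_pos_of_pos (by linarith)
  have h0 : ∀ z : ℝ, 0 ≤ (1 + z ^ 2) ^ (-s) := fun z => by positivity
  have hm : AEStronglyMeasurable (fun z : ℝ => (1 + z ^ 2) ^ (-s)) volume :=
    (continuous_one_add_sq_rpow _).aestronglyMeasurable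
  have hi : Integrable fun z : ℝ => (1 + z ^ 2) ^ (-s) := by
    refine ⟨hm, ?_⟩
    rw [hasFiniteIntegral_iff_ofReal (ae_of_all _ h0), lintegral_one_add_sq_rpow hs]
    exact ENNReal.ofReal_lt_top
  have h := intervalIntegral_tendsto_integral hi Filter.tendsto_neg_atTop_atBot Filter.tendsto_id
  rwa [integral_eq_lintegral_of_nonneg_ae (ae_of_all _ h0) hm, lintegral_one_add_sq_rpow hs,
    ENNReal.toReal_ofReal (by positivity)] at h

/-- The sharp Sobolev inequality on `ℝⁿ`. -/
lemma sobolev_sharp {n : ℕ} (hn : 3 ≤ n) {w : (Fin n → ℝ) → ℝ} (hw : Continuous w)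
    {w' : Fin n → (Fin n → ℝ) → ℝ} (hw'c : ∀ k, Continuous (w' k))
    (hw' : ∀ k x t, HasDerivAt (fun t => w (Function.update x k t))
      (w' k (Function.update x k t)) t)
    {L : ℝ} (hL : ∀ x i, L ≤ |x i| → w x = 0) {m d : ℝ}
    (hm : ∫⁻ x, ENNReal.ofReal (|w x| ^ (2 * (n : ℝ) / (n - 2))) = ENNReal.ofReal m)
    (hm0 : 0 < m)
    (hd : ∫⁻ x, ENNReal.ofReal (∑ k, w' k x ^ 2) = ENNReal.ofReal d) (hd0 : 0 ≤ d) :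
    sobolevConst n * m ^ (((n : ℝ) - 2) / n) ≤ d := by
  have hn0 : (3 : ℝ) ≤ n := by exact_mod_cast hn
  have hn2 : (n : ℝ) - 2 ≠ 0 := by linarith
  have hn1 : (n : ℝ) - 1 ≠ 0 := by linarith
  have hnn : (n : ℝ) ≠ 0 := by linarith
  have hk : ∀ k : ℕ, (0 : ℝ) ≤ k := fun k => Nat.cast_nonneg k
  have hG : ∀ x : ℝ, 0 < x → Gamma x ≠ 0 := fun x hx => (Gamma_pos_of_pos hx).ne'
  have hπ : √π ≠ 0 := by positivity
  have hI : ∏ k : Fin n, √π * Gamma (((n : ℝ) + k + 1) / 2 - 1 / 2) / Gamma (((n : ℝ) + k + 1) / 2)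
      = √π ^ n * (Gamma ((n : ℝ) / 2) / Gamma n) := by
    rw [← Finset.prod_range fun k : ℕ => √π * Gamma (((n : ℝ) + k + 1) / 2 - 1 / 2) /
      Gamma (((n : ℝ) + k + 1) / 2)]
    have : ∀ N : ℕ, ∏ k ∈ Finset.range N, √π * Gamma (((n : ℝ) + k + 1) / 2 - 1 / 2) /
        Gamma (((n : ℝ) + k + 1) / 2) =
        √π ^ N * (Gamma ((n : ℝ) / 2) / Gamma (((n : ℝ) + N) / 2)) := fun N => by
      induction N with
      | zero => simp [div_self (hG ((n : ℝ) / 2) (by linarith))]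
      | succ N ih =>
        rw [Finset.prod_range_succ, ih, show ((n : ℝ) + N + 1) / 2 - 1 / 2 = (n + N) / 2 by ring]
        have h1 := hG (((n : ℝ) + N) / 2) (by linarith [hk N])
        have h2 := hG (((n : ℝ) + N + 1) / 2) (by linarith [hk N])
        push_cast
        rw [← add_assoc]
        field_simp
        rw [pow_succ]
    rw [this n]
    congr 3; ring
  have hJ : ∏ k : Fin n, (√π * Gamma (((n : ℝ) + k + 1) / 2 - 1 - 1 / 2) /
      Gamma (((n : ℝ) + k + 1) / 2 - 1)) /
      (√π * Gamma (((n : ℝ) + k + 1) / 2 - 1 / 2) / Gamma (((n : ℝ) + k + 1) / 2))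
      = (2 * n - 2) / (n - 2) := by
    have e : ∀ k : Fin n, (√π * Gamma (((n : ℝ) + k + 1) / 2 - 1 - 1 / 2) /
        Gamma (((n : ℝ) + k + 1) / 2 - 1)) /
        (√π * Gamma (((n : ℝ) + k + 1) / 2 - 1 / 2) / Gamma (((n : ℝ) + k + 1) / 2))
        = ((n : ℝ) + k - 1) / (n + k - 2) := fun k => by
      have hk := hk k.val
      have h1 := Gamma_add_one (s := ((n : ℝ) + k + 1) / 2 - 1) (by linarith)
      have h2 := Gamma_add_one (s := ((n : ℝ) + k + 1) / 2 - 1 - 1 / 2) (by linarith)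
      rw [show ((n : ℝ) + k + 1) / 2 - 1 + 1 = (n + k + 1) / 2 by ring] at h1
      rw [show ((n : ℝ) + k + 1) / 2 - 1 - 1 / 2 + 1 = (n + k + 1) / 2 - 1 / 2 by ring] at h2
      rw [h1, h2]
      have h3 := hG (((n : ℝ) + k + 1) / 2 - 1) (by linarith)
      have h4 := hG (((n : ℝ) + k + 1) / 2 - 1 - 1 / 2) (by linarith)
      have e1 : ((n : ℝ) + k + 1) / 2 - 1 = (n + k - 1) / 2 := by ring
      have e2 : ((n : ℝ) + k + 1) / 2 - 1 - 1 / 2 = (n + k - 2) / 2 := by ring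
      generalize Gamma (((n : ℝ) + k + 1) / 2 - 1) = A at h3 ⊢
      generalize Gamma (((n : ℝ) + k + 1) / 2 - 1 - 1 / 2) = B at h4 ⊢
      rw [e2, e1]
      have h5 : (n : ℝ) + k - 1 ≠ 0 := by linarith
      have h6 : (n : ℝ) + k - 2 ≠ 0 := by linarith
      field_simp
    rw [Finset.prod_congr rfl fun k _ => e k,
      ← Finset.prod_range fun k : ℕ => ((n : ℝ) + k - 1) / (n + k - 2)]
    have : ∀ N : ℕ, ∏ k ∈ Finset.range N, ((n : ℝ) + k - 1) / (n + k - 2) =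
        (n + N - 2) / (n - 2) := fun N => by
      induction N with
      | zero => simp [div_self hn2]
      | succ N ih =>
        rw [Finset.prod_range_succ, ih]
        have h6 : (n : ℝ) + N - 2 ≠ 0 := by linarith [hk N]
        push_cast
        field_simp
        ring
    rw [this n]
    congr 1; ring
  have hlimI : ∀ k : Fin n, Filter.Tendsto (japaneseMass (((n : ℝ) + k + 1) / 2)) Filter.atTop
      (nhds (√π * Gamma (((n : ℝ) + k + 1) / 2 - 1 / 2) / Gamma (((n : ℝ) + k + 1) / 2))) :=
    fun k => tendsto_japaneseMass (by linarith [hk k.val])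
  have hlimJ : ∀ k : Fin n, Filter.Tendsto (japaneseMass (((n : ℝ) + k + 1) / 2 - 1)) Filter.atTop
      (nhds (√π * Gamma (((n : ℝ) + k + 1) / 2 - 1 - 1 / 2) /
        Gamma (((n : ℝ) + k + 1) / 2 - 1))) :=
    fun k => tendsto_japaneseMass (by linarith [hk k.val])
  have hne : ∀ k : Fin n,
      √π * Gamma (((n : ℝ) + k + 1) / 2 - 1 / 2) / Gamma (((n : ℝ) + k + 1) / 2) ≠ 0 := fun k =>
    div_ne_zero (mul_ne_zero hπ (hG _ (by linarith [hk k.val]))) (hG _ (by linarith [hk k.val]))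
  have h1 := tendsto_finsetProd Finset.univ fun k _ => hlimI k
  have h2 := tendsto_finsetProd Finset.univ fun k _ => (hlimJ k).div (hlimI k) (hne k)
  rw [hI] at h1
  simp only [Pi.div_apply] at h2
  rw [hJ] at h2
  have hΓ1 := Gamma_pos_of_pos (s := (n : ℝ) / 2) (by linarith)
  have hΓ2 := Gamma_pos_of_pos (s := (n : ℝ)) (by linarith)
  have h3 := (((((h1.div_const m).rpow_const (p := 2 / (n : ℝ)) (Or.inr (by positivity))).const_mul
    (((n : ℝ) - 2) ^ 2 / (n - 1))).mul_const m).mul ((h2.add_const (n : ℝ)).sub_const 1))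
  have h4 := le_of_tendsto h3 (Filter.eventually_atTop.2 ⟨1, fun R hR =>
    sobolev_truncated hn hw hw'c hw' hL (by linarith) hm hm0 hd hd0⟩)
  refine le_trans (le_of_eq ?_) h4
  have hP : (√π ^ n) ^ (2 / (n : ℝ)) = π := by
    rw [← Real.rpow_natCast, ← Real.rpow_mul (by positivity), mul_div_cancel₀ _ hnn]
    simp [Real.sq_sqrt pi_pos.le]
  have hM : m ^ (((n : ℝ) - 2) / n) = m / m ^ (2 / (n : ℝ)) := by
    rw [show ((n : ℝ) - 2) / n = 1 - 2 / n by field_simp, Real.rpow_sub hm0, Real.rpow_one]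
  rw [sobolevConst, Real.div_rpow (by positivity) hm0.le, Real.mul_rpow (by positivity)
    (by positivity), hP, hM]
  have : 0 < m ^ (2 / (n : ℝ)) := by positivity
  field_simp
  ring

lemma norm_sq_eq_sum_apply_single {n : ℕ} (l : EuclideanSpace ℝ (Fin n) →L[ℝ] ℝ) :
    ‖l‖ ^ 2 = ∑ k, l (EuclideanSpace.single k 1) ^ 2 := by
  set g := (InnerProductSpace.toDual ℝ (EuclideanSpace ℝ (Fin n))).symm l with hg
  have h1 : ‖l‖ = ‖g‖ := by rw [hg, LinearIsometryEquiv.norm_map]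
  have h2 : ∀ y, l y = inner ℝ g y := fun y => by
    rw [hg, InnerProductSpace.toDual_symm_apply]
  rw [h1, ← (EuclideanSpace.basisFun (Fin n) ℝ).sum_sq_norm_inner_right g]
  refine Finset.sum_congr rfl fun k _ => ?_
  rw [h2, EuclideanSpace.basisFun_apply, real_inner_comm, Real.norm_eq_abs, sq_abs]

/-- The sharp Sobolev inequality for compactly supported `C¹` functions on Euclidean space. -/
lemma sobolev_euclidean {n : ℕ} (hn : 3 ≤ n) {w : EuclideanSpace ℝ (Fin n) → ℝ}
    {w' : EuclideanSpace ℝ (Fin n) → EuclideanSpace ℝ (Fin n) →L[ℝ] ℝ}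
    (hw : ∀ y, HasFDerivAt w (w' y) y) (hw' : Continuous w') {L : ℝ}
    (hL : ∀ y, L ≤ ‖y‖ → w y = 0) :
    ENNReal.ofReal (sobolevConst n) *
      (∫⁻ y, ENNReal.ofReal (|w y| ^ (2 * (n : ℝ) / (n - 2)))) ^ (((n : ℝ) - 2) / n) ≤
      ∫⁻ y, ENNReal.ofReal (‖w' y‖ ^ 2) := by
  have hn0 : (3 : ℝ) ≤ n := by exact_mod_cast hn
  have hn2 : (0 : ℝ) < n - 2 := by linarith
  have hwc : Continuous w := continuous_iff_continuousAt.2 fun y => (hw y).continuousAt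
  set p : ℝ := 2 * (n : ℝ) / (n - 2) with hp
  have hp0 : 0 < p := by positivity
  rcases eq_or_ne (∫⁻ y, ENNReal.ofReal (‖w' y‖ ^ 2)) ⊤ with hd | hd
  · rw [hd]; exact le_top
  have hcs : HasCompactSupport fun y => |w y| ^ p :=
    HasCompactSupport.intro (isCompact_closedBall (0 : EuclideanSpace ℝ (Fin n)) L) fun y hy => by
      rw [hL y (by simpa using (lt_of_not_ge fun h => hy (by simpa using h)).le), abs_zero,
        Real.zero_rpow hp0.ne']
  have hFc : Continuous fun y => |w y| ^ p := hwc.abs.rpow_const fun y => Or.inr hp0.le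
  have hm : (∫⁻ y, ENNReal.ofReal (|w y| ^ p)) ≠ ⊤ := by
    have := (hFc.integrable_of_hasCompactSupport hcs (μ := volume)).hasFiniteIntegral
    rw [hasFiniteIntegral_iff_ofReal (ae_of_all _ fun y => by positivity)] at this
    exact this.ne
  rcases eq_or_ne (∫⁻ y, ENNReal.ofReal (|w y| ^ p)) 0 with hm0 | hm0
  · rw [hm0, ENNReal.zero_rpow_of_pos (by positivity), mul_zero]; exact zero_le
  have hmp := PiLp.volume_preserving_toLp (Fin n)
  have hme : MeasurableEmbedding (WithLp.toLp 2 : (Fin n → ℝ) → EuclideanSpace ℝ (Fin n)) :=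
    (MeasurableEquiv.toLp 2 (Fin n → ℝ)).measurableEmbedding
  have htc : Continuous (WithLp.toLp 2 : (Fin n → ℝ) → EuclideanSpace ℝ (Fin n)) :=
    PiLp.continuous_toLp 2 _
  have key := sobolev_sharp hn (w := fun x => w (WithLp.toLp 2 x))
    (w' := fun k x => w' (WithLp.toLp 2 x) (EuclideanSpace.single k 1)) (hwc.comp htc)
    (fun k => (hw'.comp htc).clm_apply continuous_const) (fun k x t => ?_) (L := L)
    (m := (∫⁻ y, ENNReal.ofReal (|w y| ^ p)).toReal)
    (d := (∫⁻ y, ENNReal.ofReal (‖w' y‖ ^ 2)).toReal)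
    (fun x i h => hL _ (h.trans ?_)) ?_ (ENNReal.toReal_pos hm0 hm) ?_ ENNReal.toReal_nonneg
  · have h := ENNReal.ofReal_le_ofReal key
    rw [ENNReal.ofReal_mul, ← ENNReal.ofReal_rpow_of_nonneg ENNReal.toReal_nonneg (by positivity),
      ENNReal.ofReal_toReal hm, ENNReal.ofReal_toReal hd] at h
    · exact h
    · have := Gamma_pos_of_pos (s := (n : ℝ) / 2) (by linarith)
      have := Gamma_pos_of_pos (s := (n : ℝ)) (by linarith)
      have := pi_pos
      unfold sobolevConst; positivity
  · have h1 := (PiLp.hasFDerivAt_toLp (𝕜 := ℝ) 2 (Function.update x k t)).comp_hasDerivAt t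
      (hasDerivAt_update x k t)
    exact (hw _).comp_hasDerivAt t h1
  · simpa using PiLp.norm_apply_le (WithLp.toLp 2 x : EuclideanSpace ℝ (Fin n)) i
  · rw [ENNReal.ofReal_toReal hm, ← hmp.lintegral_comp_emb hme]
  · rw [ENNReal.ofReal_toReal hd, ← hmp.lintegral_comp_emb hme]
    simp only [norm_sq_eq_sum_apply_single]

section Radial

set_option linter.unusedSectionVars false

variable {V : Type*} [NormedAddCommGroup V] [InnerProductSpace ℝ V]

/-- The scaling factor of the radial map `radialExp`. -/
noncomputable def radialScale (κ b : ℝ) (y : V) : ℝ := exp (b - ‖y‖ ^ (-κ)) / ‖y‖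

/-- The radial map sending the sphere of radius `r` to the sphere of radius
`exp (b - r ^ (-κ))`. -/
noncomputable def radialExp (κ b : ℝ) (y : V) : V := radialScale κ b y • y

/-- The derivative of `radialExp`. -/
noncomputable def radialExpDeriv (κ b : ℝ) (y : V) : V →L[ℝ] V :=
  radialScale κ b y • (ContinuousLinearMap.id ℝ V +
    (((κ * ‖y‖ ^ (-κ) - 1) / ‖y‖ ^ 2) • innerSL ℝ y).smulRight y)

lemma radialScale_zero (κ b : ℝ) : radialScale κ b (0 : V) = 0 := by simp [radialScale]

lemma radialExpDeriv_zero (κ b : ℝ) : radialExpDeriv κ b (0 : V) = 0 := by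
  simp [radialExpDeriv, radialScale_zero]

lemma radialScale_nonneg (κ b : ℝ) (y : V) : 0 ≤ radialScale κ b y := by
  unfold radialScale; positivity

lemma radialScale_pos (κ b : ℝ) {y : V} (hy : y ≠ 0) : 0 < radialScale κ b y := by
  have := norm_pos_iff.2 hy
  unfold radialScale; positivity

lemma norm_radialExp (κ b : ℝ) {y : V} (hy : y ≠ 0) :
    ‖radialExp κ b y‖ = exp (b - ‖y‖ ^ (-κ)) := by
  have := norm_pos_iff.2 hy
  rw [radialExp, norm_smul, Real.norm_of_nonneg (radialScale_nonneg κ b y), radialScale]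
  field_simp

lemma hasFDerivAt_norm_of_ne_zero {y : V} (hy : y ≠ 0) :
    HasFDerivAt (fun z : V => ‖z‖) (‖y‖⁻¹ • innerSL ℝ y) y := by
  have h0 := norm_pos_iff.2 hy
  have h := ((hasFDerivAt_id y).norm_sq).sqrt (by simpa using hy)
  have e : (fun z : V => √(‖id z‖ ^ 2)) = fun z => ‖z‖ := by
    funext z; simp [Real.sqrt_sq]
  rw [e] at h
  refine h.congr_fderiv ?_
  ext z
  simp [Real.sqrt_sq]
  field_simp

lemma hasFDerivAt_radialExp_of_ne_zero (κ b : ℝ) {y : V} (hy : y ≠ 0) :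
    HasFDerivAt (radialExp κ b) (radialExpDeriv κ b y) y := by
  have h0 := norm_pos_iff.2 hy
  have h1 : HasDerivAt (fun r : ℝ => exp (b - r ^ (-κ)) / r)
      (radialScale κ b y * (κ * ‖y‖ ^ (-κ) - 1) / ‖y‖) ‖y‖ := by
    have h := (((Real.hasDerivAt_rpow_const (p := -κ) (Or.inl h0.ne')).const_sub b).exp).div
      (hasDerivAt_id ‖y‖) h0.ne'
    refine h.congr_deriv ?_
    rw [Real.rpow_sub_one h0.ne', radialScale]
    simp only [id]
    field_simp
  have h2 := (h1.comp_hasFDerivAt y (hasFDerivAt_norm_of_ne_zero hy)).smul (hasFDerivAt_id y)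
  refine h2.congr_fderiv ?_
  ext z
  simp [radialExpDeriv, radialScale]
  simp only [smul_smul]
  congr 1
  field_simp

lemma radialExpDeriv_norm_le (κ b : ℝ) (y : V) :
    ‖radialExpDeriv κ b y‖ ≤ radialScale κ b y * (1 + |κ * ‖y‖ ^ (-κ) - 1|) := by
  rcases eq_or_ne y 0 with rfl | hy
  · simp [radialExpDeriv_zero, radialScale_zero]
  have h0 := norm_pos_iff.2 hy
  rw [radialExpDeriv, norm_smul, Real.norm_of_nonneg (radialScale_nonneg κ b y)]
  refine mul_le_mul_of_nonneg_left ((norm_add_le _ _).trans (add_le_add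
    ContinuousLinearMap.norm_id_le ?_)) (radialScale_nonneg κ b y)
  rw [ContinuousLinearMap.norm_smulRight_apply, norm_smul, innerSL_apply_norm, norm_div, norm_pow,
    norm_norm, Real.norm_eq_abs]
  refine le_of_eq ?_
  field_simp

lemma tendsto_radialScale_mul (b : ℝ) {κ : ℝ} (hκ : 0 < κ) (A B : ℝ) :
    Filter.Tendsto (fun y : V => radialScale κ b y * (A + B * ‖y‖ ^ (-κ)))
      (nhdsWithin 0 {0}ᶜ) (nhds 0) := by
  have h1 := tendsto_rpow_mul_exp_neg_mul_atTop_nhds_zero (1 / κ) 1 one_pos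
  have h2 := tendsto_rpow_mul_exp_neg_mul_atTop_nhds_zero (1 / κ + 1) 1 one_pos
  have h3 := ((h1.const_mul (exp b * A)).add (h2.const_mul (exp b * B))).comp
    ((tendsto_rpow_neg_nhdsGT_zero (neg_lt_zero.2 hκ)).comp (tendsto_norm_nhdsNE_zero (E := V)))
  simp only [mul_zero, add_zero] at h3
  refine h3.congr' ?_
  filter_upwards [self_mem_nhdsWithin] with y hy
  have h0 := norm_pos_iff.2 (show y ≠ 0 from hy)
  simp only [Function.comp_apply]
  have ht : 0 < ‖y‖ ^ (-κ) := by positivity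
  have e : (‖y‖ ^ (-κ)) ^ (1 / κ) = ‖y‖⁻¹ := by
    rw [← Real.rpow_mul h0.le, show -κ * (1 / κ) = -1 by field_simp, Real.rpow_neg_one]
  rw [Real.rpow_add ht, e, Real.rpow_one, radialScale, Real.exp_sub]
  rw [neg_one_mul, Real.exp_neg]
  ring

lemma hasFDerivAt_radialExp (b : ℝ) {κ : ℝ} (hκ : 0 < κ) (y : V) :
    HasFDerivAt (radialExp κ b) (radialExpDeriv κ b y) y := by
  rcases eq_or_ne y 0 with rfl | hy
  · rw [radialExpDeriv_zero, hasFDerivAt_iff_isLittleO_nhds_zero]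
    have h := tendsto_radialScale_mul (V := V) b hκ 1 0
    simp only [zero_mul, add_zero, mul_one] at h
    have h' : Filter.Tendsto (fun y : V => radialScale κ b y) (nhds 0) (nhds 0) := by
      have : ContinuousAt (fun y : V => radialScale κ b y) 0 :=
        continuousAt_iff_punctured_nhds.2 (by simpa [radialScale_zero] using h)
      simpa [ContinuousAt, radialScale_zero] using this
    have h2 := ((Asymptotics.isLittleO_one_iff ℝ).2 h').smul_isBigO
      (Asymptotics.isBigO_refl (fun y : V => y) (nhds 0))
    simpa [radialExp] using h2
  · exact hasFDerivAt_radialExp_of_ne_zero κ b hy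

lemma continuous_radialExpDeriv (b : ℝ) {κ : ℝ} (hκ : 0 < κ) :
    Continuous (radialExpDeriv κ b : V → V →L[ℝ] V) := by
  refine continuous_iff_continuousAt.2 fun y => ?_
  rcases eq_or_ne y 0 with rfl | hy
  · refine continuousAt_iff_punctured_nhds.2 ?_
    rw [radialExpDeriv_zero]
    refine squeeze_zero_norm (fun y => (radialExpDeriv_norm_le κ b y).trans ?_)
      (tendsto_radialScale_mul (V := V) b hκ 2 κ)
    refine mul_le_mul_of_nonneg_left ?_ (radialScale_nonneg κ b y)
    have : 0 ≤ κ * ‖y‖ ^ (-κ) := by positivity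
    have := abs_sub (κ * ‖y‖ ^ (-κ)) 1
    have := abs_le.2 ⟨(by linarith : -(κ * ‖y‖ ^ (-κ) + 1) ≤ κ * ‖y‖ ^ (-κ) - 1), by linarith⟩
    linarith
  · have h0 : ‖y‖ ≠ 0 := norm_ne_zero_iff.2 hy
    have h1 : ContinuousAt (fun z : V => ‖z‖ ^ (-κ)) y :=
      continuous_norm.continuousAt.rpow_const (Or.inl h0)
    have h2 : ContinuousAt (fun z : V => radialScale κ b z) y :=
      (continuousAt_const.sub h1).rexp.div continuous_norm.continuousAt h0
    have h3 : ContinuousAt (fun z : V => (κ * ‖z‖ ^ (-κ) - 1) / ‖z‖ ^ 2) y :=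
      ((h1.const_mul κ).sub continuousAt_const).div (by fun_prop) (by positivity)
    have h4 : ContinuousAt (fun z : V => (((κ * ‖z‖ ^ (-κ) - 1) / ‖z‖ ^ 2) •
        innerSL ℝ z).smulRight z) y :=
      ((ContinuousLinearMap.smulRightL ℝ V V).continuous₂.continuousAt).comp
        (f := fun z : V => (((κ * ‖z‖ ^ (-κ) - 1) / ‖z‖ ^ 2) • innerSL ℝ z, z))
        ((h3.smul (innerSL ℝ).continuous.continuousAt).prodMk continuousAt_id)
    exact h2.smul (continuousAt_const.add h4)

lemma det_radialExpDeriv [FiniteDimensional ℝ V] (κ b : ℝ) {y : V} (hy : y ≠ 0) :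
    (radialExpDeriv κ b y).det =
      radialScale κ b y ^ Module.finrank ℝ V * (κ * ‖y‖ ^ (-κ)) := by
  have h0 := norm_pos_iff.2 hy
  have e : ((radialExpDeriv κ b y : V →L[ℝ] V) : V →ₗ[ℝ] V) = radialScale κ b y •
      LinearMap.transvection
        ((((κ * ‖y‖ ^ (-κ) - 1) / ‖y‖ ^ 2) • innerSL ℝ y : V →L[ℝ] ℝ) : V →ₗ[ℝ] ℝ) y := by
    ext z
    simp [radialExpDeriv, LinearMap.transvection.apply]
  rw [ContinuousLinearMap.det, e, LinearMap.det_smul, LinearMap.transvection.det]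
  congr 1
  simp
  field_simp
  ring

lemma injOn_radialExp (b : ℝ) {κ : ℝ} (hκ : 0 < κ) :
    Set.InjOn (radialExp κ b : V → V) {0}ᶜ := by
  intro y hy z hz h
  have hy : y ≠ 0 := hy
  have hz : z ≠ 0 := hz
  have h1 := congrArg norm h
  rw [norm_radialExp κ b hy, norm_radialExp κ b hz, Real.exp_eq_exp, sub_right_inj,
    Real.rpow_left_inj (norm_nonneg _) (norm_nonneg _) (by linarith)] at h1
  have h2 : radialScale κ b y = radialScale κ b z := by simp only [radialScale, h1]
  rw [radialExp, radialExp, h2] at h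
  exact smul_right_injective V (radialScale_pos κ b hz).ne' h

lemma exists_radialExp_eq {κ : ℝ} (hκ : 0 < κ) {b : ℝ} {x : V} (hx : x ≠ 0)
    (hb : ‖x‖ < exp b) : ∃ y : V, y ≠ 0 ∧ radialExp κ b y = x := by
  have h0 := norm_pos_iff.2 hx
  have ht : 0 < b - log ‖x‖ := by
    have := Real.log_lt_log h0 hb
    rw [Real.log_exp] at this; linarith
  set r : ℝ := (b - log ‖x‖) ^ (-κ⁻¹) with hr
  have hr0 : 0 < r := by positivity
  have hn : ‖(r / ‖x‖) • x‖ = r := by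
    rw [norm_smul, Real.norm_of_nonneg (by positivity)]; field_simp
  refine ⟨(r / ‖x‖) • x, smul_ne_zero (by positivity) hx, ?_⟩
  have hrt : r ^ (-κ) = b - log ‖x‖ := by
    rw [hr, ← Real.rpow_mul ht.le, show -κ⁻¹ * -κ = 1 by field_simp, Real.rpow_one]
  rw [radialExp, radialScale, hn, hrt, smul_smul, sub_sub_cancel, Real.exp_log h0]
  convert one_smul ℝ x
  field_simp

end Radial

/-- The weighted Sobolev inequality for functions supported in the ball of radius
`exp (b - a)`. -/
lemma weighted_sobolev {n : ℕ} (hn : 3 ≤ n) {a b : ℝ} (ha : 1 ≤ ((n : ℝ) - 2) * a)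
    {v : EuclideanSpace ℝ (Fin n) → ℝ}
    {v' : EuclideanSpace ℝ (Fin n) → EuclideanSpace ℝ (Fin n) →L[ℝ] ℝ}
    (hv : ∀ x, HasFDerivAt v (v' x) x) (hv' : Continuous v')
    (hs : ∀ x, exp (b - a) < ‖x‖ → v x = 0 ∧ v' x = 0) :
    ENNReal.ofReal (sobolevConst n) *
      (∫⁻ x, ENNReal.ofReal (‖x‖ ^ (-(n : ℝ)) *
        (b - log ‖x‖) ^ (-(2 * ((n : ℝ) - 1) / (n - 2))) *
        |v x| ^ (2 * (n : ℝ) / (n - 2)))) ^ (((n : ℝ) - 2) / n) ≤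
      ENNReal.ofReal (((n : ℝ) - 2) ^ (2 * ((n : ℝ) - 1) / n)) *
        ∫⁻ x, ENNReal.ofReal (‖x‖ ^ (-((n : ℝ) - 2)) * ‖v' x‖ ^ 2) := by
  have hn0 : (3 : ℝ) ≤ n := by exact_mod_cast hn
  have hκ : (0 : ℝ) < n - 2 := by linarith
  have ha0 : 0 < a := by
    by_contra h
    nlinarith
  have : NeZero n := ⟨by omega⟩
  set κ : ℝ := (n : ℝ) - 2 with hκdef
  set p : ℝ := 2 * (n : ℝ) / κ with hp
  set q : ℝ := 2 * ((n : ℝ) - 1) / κ with hq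
  have hp0 : 0 < p := by positivity
  let Φ : EuclideanSpace ℝ (Fin n) → EuclideanSpace ℝ (Fin n) := radialExp κ b
  set G : EuclideanSpace ℝ (Fin n) → ENNReal := fun x =>
    ENNReal.ofReal (‖x‖ ^ (-(n : ℝ)) * (b - log ‖x‖) ^ (-q) * |v x| ^ p) with hG
  set H : EuclideanSpace ℝ (Fin n) → ENNReal := fun x =>
    ENNReal.ofReal (‖x‖ ^ (-κ) * ‖v' x‖ ^ 2) with hH
  set w : EuclideanSpace ℝ (Fin n) → ℝ := fun y => v (Φ y) with hwdef
  set w' : EuclideanSpace ℝ (Fin n) → EuclideanSpace ℝ (Fin n) →L[ℝ] ℝ := fun y =>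
    (v' (Φ y)).comp (radialExpDeriv κ b y) with hw'def
  have hΦ : ∀ y, HasFDerivAt Φ (radialExpDeriv κ b y) y := hasFDerivAt_radialExp b hκ
  have hΦc : Continuous Φ := continuous_iff_continuousAt.2 fun y => (hΦ y).continuousAt
  have hw : ∀ y, HasFDerivAt w (w' y) y := fun y => (hv (Φ y)).comp y (hΦ y)
  have hw'c : Continuous w' := (hv'.comp hΦc).clm_comp (continuous_radialExpDeriv b hκ)
  have hΦn : ∀ y, y ≠ 0 → ‖Φ y‖ = exp (b - ‖y‖ ^ (-κ)) := fun y hy => norm_radialExp κ b hy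
  have hout : ∀ y, y ≠ 0 → ‖y‖ ^ (-κ) < a → v (Φ y) = 0 ∧ v' (Φ y) = 0 := fun y hy h =>
    hs _ (by rw [hΦn y hy, Real.exp_lt_exp]; linarith)
  have hsob := sobolev_euclidean hn hw hw'c (L := a ^ (-κ⁻¹) + 1) fun y hy => by
    have h1 : a ^ (-κ⁻¹) < ‖y‖ := by linarith
    have h2 : 0 < ‖y‖ := lt_of_le_of_lt (by positivity) h1
    refine (hout y (norm_pos_iff.1 h2) ?_).1
    have h3 := Real.rpow_lt_rpow_of_neg (by positivity) h1 (neg_lt_zero.2 hκ)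
    rwa [← Real.rpow_mul ha0.le, show -κ⁻¹ * -κ = 1 by field_simp, Real.rpow_one] at h3
  have hcv := fun g : EuclideanSpace ℝ (Fin n) → ENNReal =>
    lintegral_image_eq_lintegral_abs_det_fderiv_mul volume
      (measurableSet_singleton (0 : EuclideanSpace ℝ (Fin n))).compl
      (fun y _ => (hΦ y).hasFDerivWithinAt) (injOn_radialExp b hκ) g
  have hdet : ∀ y : EuclideanSpace ℝ (Fin n), y ≠ 0 → ENNReal.ofReal |(radialExpDeriv κ b y).det| =
      ENNReal.ofReal (radialScale κ b y ^ n * (κ * ‖y‖ ^ (-κ))) := fun y hy => by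
    rw [det_radialExpDeriv κ b hy, finrank_euclideanSpace_fin, abs_of_nonneg]
    have := radialScale_nonneg κ b y
    positivity
  have hne : ∀ᵐ y : EuclideanSpace ℝ (Fin n), y ≠ 0 := by
    simp [ae_iff]
  have hGM : ∫⁻ x, G x ≤ ENNReal.ofReal κ * ∫⁻ y, ENNReal.ofReal (|w y| ^ p) := by
    calc ∫⁻ x, G x ≤ ∫⁻ x, (Φ '' {0}ᶜ).indicator G x := by
          refine lintegral_mono_ae ?_
          filter_upwards [hne] with x hx
          by_cases hxI : x ∈ Φ '' {0}ᶜ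
          · rw [Set.indicator_of_mem hxI]
          · have h1 : exp b ≤ ‖x‖ := by
              by_contra hlt
              obtain ⟨y, hy, rfl⟩ := exists_radialExp_eq hκ hx (not_le.1 hlt)
              exact hxI ⟨y, hy, rfl⟩
            have h2 : v x = 0 := (hs x (lt_of_lt_of_le (Real.exp_lt_exp.2 (by linarith)) h1)).1
            simp [hG, h2, Real.zero_rpow hp0.ne']
      _ ≤ ∫⁻ x in Φ '' {0}ᶜ, G x := lintegral_indicator_le _ _
      _ = ∫⁻ y in {0}ᶜ, ENNReal.ofReal κ * ENNReal.ofReal (|w y| ^ p) := by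
          rw [hcv]
          refine setLIntegral_congr_fun (measurableSet_singleton _).compl fun y hy => ?_
          have hy : y ≠ 0 := hy
          have hr := norm_pos_iff.2 hy
          have hc := radialScale_pos κ b hy
          have ht : 0 < ‖y‖ ^ (-κ) := by positivity
          simp only [hG]
          rw [hdet y hy, ← ENNReal.ofReal_mul (by positivity), ← ENNReal.ofReal_mul hκ.le,
            show b - log ‖Φ y‖ = ‖y‖ ^ (-κ) by rw [hΦn y hy, Real.log_exp]; ring,
            show ‖Φ y‖ = radialScale κ b y * ‖y‖ by
              simp only [Φ, radialExp]; rw [norm_smul, Real.norm_of_nonneg hc.le]]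
          congr 1
          have e1 : (‖y‖ ^ (-κ)) ^ (-q) = ‖y‖ ^ (n : ℝ) / ‖y‖ ^ (-κ) := by
            rw [← Real.rpow_mul hr.le, ← Real.rpow_sub hr]
            congr 1
            have : κ * q = 2 * ((n : ℝ) - 1) := by rw [hq]; field_simp
            linarith
          rw [e1, Real.mul_rpow hc.le hr.le, Real.rpow_neg hc.le, Real.rpow_neg hr.le (n : ℝ),
            Real.rpow_natCast, Real.rpow_natCast]
          simp only [hwdef]
          field_simp
      _ = ENNReal.ofReal κ * ∫⁻ y in {0}ᶜ, ENNReal.ofReal (|w y| ^ p) := by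
          rw [lintegral_const_mul' _ _ ENNReal.ofReal_ne_top]
      _ ≤ _ := by gcongr; exact Measure.restrict_le_self
  have hHD : ∫⁻ y, ENNReal.ofReal (‖w' y‖ ^ 2) ≤ ENNReal.ofReal κ * ∫⁻ x, H x := by
    calc ∫⁻ y, ENNReal.ofReal (‖w' y‖ ^ 2) = ∫⁻ y in {0}ᶜ, ENNReal.ofReal (‖w' y‖ ^ 2) := by
          rw [Measure.restrict_eq_self_of_ae_mem (s := {0}ᶜ) (by simpa using hne)]
      _ ≤ ∫⁻ y in {0}ᶜ, ENNReal.ofReal κ *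
          (ENNReal.ofReal |(radialExpDeriv κ b y).det| * H (Φ y)) := by
          refine setLIntegral_mono' (measurableSet_singleton _).compl fun y hy => ?_
          have hy : y ≠ 0 := hy
          have hr := norm_pos_iff.2 hy
          have hc := radialScale_pos κ b hy
          have ht : 0 < ‖y‖ ^ (-κ) := by positivity
          simp only [hH]
          rw [hdet y hy, ← ENNReal.ofReal_mul (by positivity), ← ENNReal.ofReal_mul hκ.le]
          refine ENNReal.ofReal_le_ofReal ?_
          rcases lt_or_ge (‖y‖ ^ (-κ)) a with hlt | hge
          · simp only [hw'def]
            rw [(hout y hy hlt).2]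
            simp
          have h1 : 1 ≤ κ * ‖y‖ ^ (-κ) := ha.trans (by gcongr)
          have h2 : ‖w' y‖ ≤ ‖v' (Φ y)‖ * (radialScale κ b y * (κ * ‖y‖ ^ (-κ))) := by
            refine (ContinuousLinearMap.opNorm_comp_le _ _).trans ?_
            gcongr
            refine (radialExpDeriv_norm_le κ b y).trans (le_of_eq ?_)
            rw [abs_of_nonneg (by linarith)]; ring
          have h3 : ‖Φ y‖ = radialScale κ b y * ‖y‖ := by
            simp only [Φ, radialExp]; rw [norm_smul, Real.norm_of_nonneg hc.le]
          have h4 : radialScale κ b y ^ n * radialScale κ b y ^ (-κ) = radialScale κ b y ^ 2 := by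
            rw [← Real.rpow_natCast, ← Real.rpow_add hc, ← Real.rpow_natCast]
            congr 1; rw [hκdef]; push_cast; ring
          calc ‖w' y‖ ^ 2 ≤ (‖v' (Φ y)‖ * (radialScale κ b y * (κ * ‖y‖ ^ (-κ)))) ^ 2 := by gcongr
            _ = _ := by
              rw [h3, Real.mul_rpow hc.le hr.le, mul_pow, mul_pow, ← h4]
              ring
      _ = ENNReal.ofReal κ * ∫⁻ x in Φ '' {0}ᶜ, H x := by
          rw [lintegral_const_mul' _ _ ENNReal.ofReal_ne_top, hcv]
      _ ≤ _ := by gcongr; exact Measure.restrict_le_self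
  have hθ : 0 ≤ κ / n := by positivity
  have e : ENNReal.ofReal (κ ^ (2 * ((n : ℝ) - 1) / n)) =
      ENNReal.ofReal κ ^ (κ / n) * ENNReal.ofReal κ := by
    rw [ENNReal.ofReal_rpow_of_pos hκ, ← ENNReal.ofReal_mul (by positivity),
      ← Real.rpow_add_one hκ.ne']
    congr 2; rw [hκdef]; field_simp; ring
  calc ENNReal.ofReal (sobolevConst n) * (∫⁻ x, G x) ^ (κ / n)
      ≤ ENNReal.ofReal (sobolevConst n) *
        (ENNReal.ofReal κ * ∫⁻ y, ENNReal.ofReal (|w y| ^ p)) ^ (κ / n) := by gcongr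
    _ = ENNReal.ofReal κ ^ (κ / n) * (ENNReal.ofReal (sobolevConst n) *
        (∫⁻ y, ENNReal.ofReal (|w y| ^ p)) ^ (κ / n)) := by
        rw [ENNReal.mul_rpow_of_nonneg _ _ hθ]; ring
    _ ≤ ENNReal.ofReal κ ^ (κ / n) * ∫⁻ y, ENNReal.ofReal (‖w' y‖ ^ 2) := by gcongr
    _ ≤ ENNReal.ofReal κ ^ (κ / n) * (ENNReal.ofReal κ * ∫⁻ x, H x) := by gcongr
    _ = _ := by rw [e, mul_assoc]

lemma sobolevConst_pos {n : ℕ} (hn : 3 ≤ n) : 0 < sobolevConst n := by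
  have hn0 : (3 : ℝ) ≤ n := by exact_mod_cast hn
  have hn2 : (0 : ℝ) < n - 2 := by linarith
  have := Gamma_pos_of_pos (s := (n : ℝ) / 2) (by linarith)
  have := Gamma_pos_of_pos (s := (n : ℝ)) (by linarith)
  have := pi_pos
  unfold sobolevConst
  positivity

lemma integrableOn_norm_rpow_ball {n : ℕ} (hn : 3 ≤ n) :
    IntegrableOn (fun x : EuclideanSpace ℝ (Fin n) => ‖x‖ ^ (-((n : ℝ) - 2)))
      (Metric.ball 0 1) := by
  have : NeZero n := ⟨by omega⟩
  have h := (integrable_fun_norm_addHaar (E := EuclideanSpace ℝ (Fin n)) volume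
    (f := (Set.Iio (1 : ℝ)).indicator fun r => r ^ (-((n : ℝ) - 2)))).2 ?_
  · rw [← integrable_indicator_iff measurableSet_ball]
    refine h.congr (ae_of_all _ fun x => ?_)
    by_cases hx : ‖x‖ < 1 <;> simp [Set.indicator, hx]
  · have h1 : IntegrableOn (fun r : ℝ => r) (Set.Ioc 0 1) :=
      (continuous_id.integrableOn_Icc).mono_set Set.Ioc_subset_Icc_self
    have h2 : IntegrableOn ((Set.Iio (1 : ℝ)).indicator fun r : ℝ => r) (Set.Ioi 0) := by
      rw [integrableOn_indicator_iff measurableSet_Iio]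
      exact h1.mono_set fun r hr => ⟨hr.2, le_of_lt hr.1⟩
    refine h2.congr_fun (fun r hr => ?_) measurableSet_Ioi
    have hr : (0 : ℝ) < r := hr
    by_cases h1 : r < 1
    · rw [Set.indicator_of_mem (by simpa using h1)]
      simp only [Set.indicator_of_mem (show r ∈ Set.Iio (1 : ℝ) from h1)]
      rw [smul_eq_mul, finrank_euclideanSpace_fin, ← Real.rpow_natCast, ← Real.rpow_add hr,
        Nat.cast_sub (by omega)]
      rw [show ((n : ℝ) - (1 : ℕ) + -((n : ℝ) - 2)) = 1 by push_cast; ring, Real.rpow_one]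
    · simp only [Set.indicator_of_notMem (show r ∉ Set.Iio (1 : ℝ) from h1), smul_zero]

lemma integrableOn_weighted_gradient {n : ℕ} (hn : 3 ≤ n) {v : EuclideanSpace ℝ (Fin n) → ℝ}
    (hv : ContDiff ℝ 1 v) (hcs : HasCompactSupport v) :
    IntegrableOn (fun x => ‖x‖ ^ (-((n : ℝ) - 2)) * ‖fderiv ℝ v x‖ ^ 2) (Metric.ball 0 1) := by
  have hc : Continuous (fderiv ℝ v) := hv.continuous_fderiv one_ne_zero
  obtain ⟨C, hC⟩ := (hcs.fderiv (𝕜 := ℝ)).exists_bound_of_continuous hc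
  refine ((integrableOn_norm_rpow_ball hn).mul_const (C ^ 2)).mono' ?_ (ae_of_all _ fun x => ?_)
  · refine Measurable.aestronglyMeasurable ?_
    exact (measurable_norm.pow_const _).mul (hc.norm.measurable.pow_const 2)
  · rw [Real.norm_of_nonneg (by positivity)]
    gcongr
    exact hC x

/-- The strict weighted inequality when `1 / (n - 2) ≤ a`. -/
lemma weighted_sobolev_strict {n : ℕ} (hn : 3 ≤ n) {a : ℝ} (ha : 1 / ((n : ℝ) - 2) ≤ a)
    {v : EuclideanSpace ℝ (Fin n) → ℝ} (hv : ContDiff ℝ 1 v) (hcs : HasCompactSupport v)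
    (hsupp : tsupport v ⊆ Metric.ball 0 1) (hne : v ≠ 0) :
    IntegrableOn (fun x => ‖x‖ ^ (-(n : ℝ)) * (X1 a ‖x‖) ^ (2 * ((n : ℝ) - 1) / ((n : ℝ) - 2)) *
      |v x| ^ (2 * (n : ℝ) / ((n : ℝ) - 2))) (Metric.ball 0 1) ∧
    ((n : ℝ) - 2) ^ (-(2 * ((n : ℝ) - 1)) / (n : ℝ)) * sobolevConst n *
      (∫ x in Metric.ball (0 : EuclideanSpace ℝ (Fin n)) 1,
        ‖x‖ ^ (-(n : ℝ)) * (X1 a ‖x‖) ^ (2 * ((n : ℝ) - 1) / ((n : ℝ) - 2)) *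
          |v x| ^ (2 * (n : ℝ) / ((n : ℝ) - 2))) ^ (((n : ℝ) - 2) / (n : ℝ)) <
      ∫ x in Metric.ball (0 : EuclideanSpace ℝ (Fin n)) 1,
        ‖x‖ ^ (-((n : ℝ) - 2)) * ‖fderiv ℝ v x‖ ^ 2 := by
  have hn0 : (3 : ℝ) ≤ n := by exact_mod_cast hn
  have hκ : (0 : ℝ) < n - 2 := by linarith
  have : NeZero n := ⟨by omega⟩
  have ha1 : 1 ≤ ((n : ℝ) - 2) * a := by rwa [div_le_iff₀' hκ] at ha
  have ha0 : 0 < a := lt_of_lt_of_le (by positivity) ha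
  have hS := sobolevConst_pos hn
  have hD := integrableOn_weighted_gradient hn hv hcs
  set κ : ℝ := (n : ℝ) - 2 with hκdef
  set p : ℝ := 2 * (n : ℝ) / κ with hp
  set q : ℝ := 2 * ((n : ℝ) - 1) / κ with hq
  have hp0 : 0 < p := by positivity
  have hq0 : 0 < q := by
    have : (0 : ℝ) < n - 1 := by linarith
    positivity
  obtain ⟨R, ⟨hR0, hR1⟩, hR⟩ := exists_pos_lt_subset_ball one_pos (isClosed_tsupport v) hsupp
  have hRx : ∀ x, R ≤ ‖x‖ → x ∉ tsupport v := fun x hx hxt => by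
    have := hR hxt
    rw [mem_ball_zero_iff] at this
    linarith
  have hv0 : ∀ x, R ≤ ‖x‖ → v x = 0 := fun x hx => image_eq_zero_of_notMem_tsupport (hRx x hx)
  have hv'0 : ∀ x, R ≤ ‖x‖ → fderiv ℝ v x = 0 := fun x hx =>
    fderiv_of_notMem_tsupport ℝ (hRx x hx)
  have hlogR : log R < 0 := Real.log_neg hR0 hR1
  have hx0 : ∀ᵐ x : EuclideanSpace ℝ (Fin n), x ≠ 0 := by simp [ae_iff]
  set g : ℝ → EuclideanSpace ℝ (Fin n) → ℝ := fun c x =>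
    ‖x‖ ^ (-(n : ℝ)) * (c - log ‖x‖) ^ (-q) * |v x| ^ p with hg
  have hgm : ∀ c, Measurable (g c) := fun c =>
    ((measurable_norm.pow_const _).mul ((measurable_norm.log.const_sub c).pow_const _)).mul
      (hv.continuous.abs.measurable.pow_const _)
  have hsupp0 : ∀ c x, R ≤ ‖x‖ → g c x = 0 := fun c x hx => by
    simp [hg, hv0 x hx, Real.zero_rpow hp0.ne']
  have key := weighted_sobolev hn (a := a) (b := a + log R) ha1
    (fun x => (hv.differentiable one_ne_zero x).hasFDerivAt)
    (hv.continuous_fderiv one_ne_zero) fun x hx => by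
      rw [add_sub_cancel_left, Real.exp_log hR0] at hx
      exact ⟨hv0 x hx.le, hv'0 x hx.le⟩
  change ENNReal.ofReal (sobolevConst n) *
    (∫⁻ x, ENNReal.ofReal (g (a + log R) x)) ^ (κ / n) ≤ _ at key
  have hDeq : ∫⁻ x, ENNReal.ofReal (‖x‖ ^ (-κ) * ‖fderiv ℝ v x‖ ^ 2) =
      ENNReal.ofReal (∫ x in Metric.ball (0 : EuclideanSpace ℝ (Fin n)) 1,
        ‖x‖ ^ (-κ) * ‖fderiv ℝ v x‖ ^ 2) := by
    rw [ofReal_integral_eq_lintegral_ofReal hD (ae_of_all _ fun x => by positivity),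
      setLIntegral_eq_of_support_subset]
    intro x hx
    rw [mem_ball_zero_iff]
    by_contra h
    exact hx (by simp [hv'0 x (by linarith)])
  set D : ℝ := ∫ x in Metric.ball (0 : EuclideanSpace ℝ (Fin n)) 1,
    ‖x‖ ^ (-κ) * ‖fderiv ℝ v x‖ ^ 2 with hDdef
  have hD0 : 0 ≤ D := integral_nonneg fun x => by positivity
  rw [hDeq, ← ENNReal.ofReal_mul (by positivity)] at key
  have hJb : ∫⁻ x, ENNReal.ofReal (g (a + log R) x) ≠ ⊤ := fun htop => by
    rw [htop, ENNReal.top_rpow_of_pos (by positivity), ENNReal.mul_top (by simpa using hS)] at key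
    exact absurd key (by simp)
  have hlt : ∀ x, x ≠ 0 → v x ≠ 0 → 0 < a + log R - log ‖x‖ := fun x hx hvx => by
    have h1 : ‖x‖ < R := lt_of_not_ge fun h => hvx (hv0 x h)
    have := Real.log_lt_log (norm_pos_iff.2 hx) h1
    linarith
  have hglt : ∀ x, x ≠ 0 → v x ≠ 0 → g a x < g (a + log R) x := fun x hx hvx => by
    have h1 := hlt x hx hvx
    have h2 := norm_pos_iff.2 hx
    have h3 := abs_pos.2 hvx
    have h4 := Real.rpow_lt_rpow_of_neg h1
      (show a + log R - log ‖x‖ < a - log ‖x‖ by linarith) (neg_lt_zero.2 hq0)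
    simp only [hg]
    gcongr
  have hg0 : ∀ x, x ≠ 0 → 0 ≤ g a x := fun x hx => by
    by_cases hvx : v x = 0
    · simp [hg, hvx, Real.zero_rpow hp0.ne']
    · have h1 := hlt x hx hvx
      have : 0 < a - log ‖x‖ := by linarith
      simp only [hg]; positivity
  have hle : (fun x => ENNReal.ofReal (g a x)) ≤ᵐ[volume]
      fun x => ENNReal.ofReal (g (a + log R) x) := by
    filter_upwards [hx0] with x hx
    by_cases hvx : v x = 0
    · simp [hg, hvx, Real.zero_rpow hp0.ne']
    · exact ENNReal.ofReal_le_ofReal (hglt x hx hvx).le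
  have hJa : ∫⁻ x, ENNReal.ofReal (g a x) ≠ ⊤ := ((lintegral_mono_ae hle).trans_lt hJb.lt_top).ne
  have hJlt : ∫⁻ x, ENNReal.ofReal (g a x) < ∫⁻ x, ENNReal.ofReal (g (a + log R) x) := by
    obtain ⟨x₀, hx₀⟩ := Function.ne_iff.1 hne
    have hopen : IsOpen {x | v x ≠ 0} := isOpen_ne_fun hv.continuous continuous_const
    refine lintegral_strict_mono_of_ae_le_of_ae_lt_on (hgm _).ennreal_ofReal.aemeasurable hJa hle
      (hopen.measure_pos volume ⟨x₀, hx₀⟩).ne' ?_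
    filter_upwards [hx0] with x hx hvx
    exact (ENNReal.ofReal_lt_ofReal_iff_of_nonneg (hg0 x hx)).2 (hglt x hx hvx)
  have hgi : Integrable (g a) := by
    refine ⟨(hgm a).aestronglyMeasurable, ?_⟩
    rw [hasFiniteIntegral_iff_ofReal (by filter_upwards [hx0] with x hx using hg0 x hx)]
    exact hJa.lt_top
  have hXg : Set.EqOn (g a) (fun x => ‖x‖ ^ (-(n : ℝ)) * X1 a ‖x‖ ^ q * |v x| ^ p)
      (Metric.ball 0 1) := fun x hx => by
    rw [mem_ball_zero_iff] at hx
    have h1 : 0 ≤ a - log ‖x‖ := by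
      have := Real.log_nonpos (norm_nonneg x) hx.le
      linarith
    simp only [hg, X1]
    rw [Real.inv_rpow h1, Real.rpow_neg h1]
  refine ⟨hgi.integrableOn.congr_fun hXg measurableSet_ball, ?_⟩
  rw [← setIntegral_congr_fun measurableSet_ball hXg]
  have hJeq : ∫⁻ x, ENNReal.ofReal (g a x) =
      ENNReal.ofReal (∫ x in Metric.ball (0 : EuclideanSpace ℝ (Fin n)) 1, g a x) := by
    rw [ofReal_integral_eq_lintegral_ofReal hgi.integrableOn
      (ae_restrict_of_ae (by filter_upwards [hx0] with x hx using hg0 x hx)),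
      setLIntegral_eq_of_support_subset]
    intro x hx
    rw [mem_ball_zero_iff]
    by_contra h
    exact hx (by simp [hsupp0 a x (by linarith)])
  set J : ℝ := ∫ x in Metric.ball (0 : EuclideanSpace ℝ (Fin n)) 1, g a x with hJ
  have hJ0 : 0 ≤ J := integral_nonneg_of_ae
    (ae_restrict_of_ae (by filter_upwards [hx0] with x hx using hg0 x hx))
  have hfin : ENNReal.ofReal (sobolevConst n * J ^ (κ / n)) <
      ENNReal.ofReal (κ ^ (2 * ((n : ℝ) - 1) / n) * D) := by
    refine lt_of_lt_of_le ?_ key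
    rw [ENNReal.ofReal_mul hS.le, ← ENNReal.ofReal_rpow_of_nonneg hJ0 (by positivity), ← hJeq]
    refine ENNReal.mul_lt_mul_right (by simpa using hS) ENNReal.ofReal_ne_top ?_
    exact ENNReal.rpow_lt_rpow hJlt (by positivity)
  have hfin' := (ENNReal.ofReal_lt_ofReal_iff_of_nonneg (by positivity)).1 hfin
  rw [neg_div, Real.rpow_neg hκ.le, mul_assoc, inv_mul_lt_iff₀ (by positivity)]
  exact hfin'

theorem stmt11 (n : ℕ) (hn : 3 ≤ n) (a : ℝ) (ha0 : 0 < a)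
    (Cna : ℝ)
    (hCna : Cna = if 1 / ((n : ℝ) - 2) ≤ a then ((n : ℝ) - 2) ^ (-(2 * ((n : ℝ) - 1)) / (n : ℝ)) * sobolevConst n else a ^ (2 * ((n : ℝ) - 1) / (n : ℝ)) * sobolevConst n)
    (v : EuclideanSpace ℝ (Fin n) → ℝ) (hu : ContDiff ℝ (⊤ : ℕ∞) v)
    (hcs : HasCompactSupport v)
    (hsupp : tsupport v ⊆ Metric.ball (0 : EuclideanSpace ℝ (Fin n)) 1) (hne : v ≠ 0) :
    (∫ x in Metric.ball (0 : EuclideanSpace ℝ (Fin n)) 1, ‖x‖ ^ (-((n : ℝ) - 2)) * ‖gradient v x‖ ^ 2)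
      > Cna *
          (∫ x in Metric.ball (0 : EuclideanSpace ℝ (Fin n)) 1,
              ‖x‖ ^ (-(n : ℝ)) * (X1 a ‖x‖) ^ (2 * ((n : ℝ) - 1) / ((n : ℝ) - 2)) *
                |v x| ^ (2 * (n : ℝ) / ((n : ℝ) - 2)))
            ^ (((n : ℝ) - 2) / (n : ℝ)) := by
  have hv : ContDiff ℝ 1 v := hu.of_le (by exact_mod_cast le_top)
  have hgrad : ∀ x, ‖gradient v x‖ = ‖fderiv ℝ v x‖ := fun x =>
    LinearIsometryEquiv.norm_map _ _
  simp only [hgrad]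
  rw [gt_iff_lt, hCna]
  split_ifs with h
  · exact (weighted_sobolev_strict hn h hv hcs hsupp hne).2
  have hn0 : (3 : ℝ) ≤ n := by exact_mod_cast hn
  have hκ : (0 : ℝ) < n - 2 := by linarith
  have hn1 : (0 : ℝ) < n - 1 := by linarith
  have hS := sobolevConst_pos hn
  obtain ⟨hi, hlt⟩ := weighted_sobolev_strict hn le_rfl hv hcs hsupp hne
  refine lt_of_le_of_lt ?_ hlt
  set κ : ℝ := (n : ℝ) - 2 with hκdef
  set p : ℝ := 2 * (n : ℝ) / κ with hp
  set q : ℝ := 2 * ((n : ℝ) - 1) / κ with hq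
  have hq0 : 0 < q := by positivity
  have hka : 1 ≤ 1 / κ / a := by
    rw [le_div_iff₀ ha0]; linarith
  have hX : ∀ c, 0 < c → ∀ x ∈ Metric.ball (0 : EuclideanSpace ℝ (Fin n)) 1,
      0 < c - log ‖x‖ := fun c hc x hx => by
    have := Real.log_nonpos (norm_nonneg x) (mem_ball_zero_iff.1 hx).le
    linarith
  have hle : ∫ x in Metric.ball (0 : EuclideanSpace ℝ (Fin n)) 1,
      ‖x‖ ^ (-(n : ℝ)) * X1 a ‖x‖ ^ q * |v x| ^ p ≤
      (1 / κ / a) ^ q * ∫ x in Metric.ball (0 : EuclideanSpace ℝ (Fin n)) 1,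
        ‖x‖ ^ (-(n : ℝ)) * X1 (1 / κ) ‖x‖ ^ q * |v x| ^ p := by
    rw [← integral_const_mul]
    refine integral_mono_of_nonneg ?_ (hi.const_mul _) ?_
    · filter_upwards [ae_restrict_mem measurableSet_ball] with x hx
      have := hX a ha0 x hx
      simp only [Pi.zero_apply, X1]
      positivity
    · filter_upwards [ae_restrict_mem measurableSet_ball] with x hx
      have h1 := hX a ha0 x hx
      have h2 := hX (1 / κ) (by positivity) x hx
      have h3 : X1 a ‖x‖ ≤ 1 / κ / a * X1 (1 / κ) ‖x‖ := by
        have hl := Real.log_nonpos (norm_nonneg x) (mem_ball_zero_iff.1 hx).le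
        simp only [X1]
        rw [inv_eq_one_div, inv_eq_one_div (1 / κ - log ‖x‖), div_mul_div_comm,
          div_le_div_iff₀ h1 (by positivity)]
        nlinarith
      have h4 : 0 ≤ X1 a ‖x‖ := by simp only [X1]; positivity
      have h5 : 0 ≤ X1 (1 / κ) ‖x‖ := by simp only [X1]; positivity
      calc _ ≤ ‖x‖ ^ (-(n : ℝ)) * (1 / κ / a * X1 (1 / κ) ‖x‖) ^ q * |v x| ^ p := by gcongr
        _ = _ := by rw [Real.mul_rpow (by positivity) h5]; ring
  have hJ0 : 0 ≤ ∫ x in Metric.ball (0 : EuclideanSpace ℝ (Fin n)) 1,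
      ‖x‖ ^ (-(n : ℝ)) * X1 a ‖x‖ ^ q * |v x| ^ p := by
    refine setIntegral_nonneg measurableSet_ball fun x hx => ?_
    have := hX a ha0 x hx
    simp only [X1]
    positivity
  have hJ1 : 0 ≤ ∫ x in Metric.ball (0 : EuclideanSpace ℝ (Fin n)) 1,
      ‖x‖ ^ (-(n : ℝ)) * X1 (1 / κ) ‖x‖ ^ q * |v x| ^ p := by
    refine setIntegral_nonneg measurableSet_ball fun x hx => ?_
    have := hX (1 / κ) (by positivity) x hx
    simp only [X1]
    positivity
  have hqe : q * (κ / n) = 2 * ((n : ℝ) - 1) / n := by rw [hq]; field_simp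
  calc _ ≤ a ^ (2 * ((n : ℝ) - 1) / n) * sobolevConst n *
        ((1 / κ / a) ^ q * ∫ x in Metric.ball (0 : EuclideanSpace ℝ (Fin n)) 1,
          ‖x‖ ^ (-(n : ℝ)) * X1 (1 / κ) ‖x‖ ^ q * |v x| ^ p) ^ (κ / n) := by gcongr
    _ = _ := by
      rw [Real.mul_rpow (by positivity) hJ1, ← Real.rpow_mul (by positivity), hqe,
        Real.div_rpow (by positivity) ha0.le, one_div, Real.inv_rpow hκ.le, neg_div,
        Real.rpow_neg hκ.le]
      have : 0 < a ^ (2 * ((n : ℝ) - 1) / n) := by positivity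
      field_simp
end
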